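/- (Fomin–Fulton–Li–Poon) Let p ≥ q ≥ 1 and n = p + q. An element (λ, s) with λ = (λ₁ ≥ … ≥ λ_n) ∈ ℝⁿ and s = (s₁ ≥ … ≥ s_q ≥ 0) ∈ ℝ^q belongs to A(p,q) if and only if for every integer r with 1 ≤ r ≤ q and every triple (I,J,K) ∈ LR^q_r one has |λ|_I − |λ|_{J^o} ≥ 2|s|_K, where J^o = {n+1−j : j ∈ J} is taken relative to [n] and I, J, K ⊂ [q] are viewed as subsets of [n]. -/

import Mathlib

open Matrix

/-- Eigenvalues of a (Hermitian) complex matrix, listed in decreasing order. -/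
noncomputable def eigVec {k : ℕ} (X : Matrix (Fin k) (Fin k) ℂ) (hX : X.IsHermitian) :
    Fin k → ℝ :=
  fun i => hX.eigenvalues (Tuple.sort hX.eigenvalues i.rev)

/-- The `i`-th (0-based) singular value of a rectangular complex matrix:
the square root of the `i`-th largest eigenvalue of `Y * Yᴴ` (and `0` for `i ≥ a`). -/
noncomputable def sval {a b : ℕ} (Y : Matrix (Fin a) (Fin b) ℂ) (i : ℕ) : ℝ :=
  if h : i < a then
    Real.sqrt (eigVec (Y * Yᴴ) (Matrix.isHermitian_mul_conjTranspose_self Y) ⟨i, h⟩)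
  else 0

/-- The Horn cone `Horn(k)`. -/
def Horn (k : ℕ) : Set ((Fin k → ℝ) × (Fin k → ℝ) × (Fin k → ℝ)) :=
  { v | ∃ (X Y : Matrix (Fin k) (Fin k) ℂ) (hX : X.IsHermitian) (hY : Y.IsHermitian),
      v.1 = eigVec X hX ∧ v.2.1 = eigVec Y hY ∧ v.2.2 = eigVec (X + Y) (hX.add hY) }

/-- The Littlewood–Richardson cone `LR(m,n)`. -/
def LRcone (m n : ℕ) : Set ((Fin (m + n) → ℝ) × (Fin m → ℝ) × (Fin n → ℝ)) :=
  { v | ∃ (M : Matrix (Fin (m + n)) (Fin (m + n)) ℂ) (hM : M.IsHermitian),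
      v.1 = eigVec M hM ∧
      v.2.1 = eigVec (M.submatrix (Fin.castAdd n) (Fin.castAdd n))
        (hM.submatrix (Fin.castAdd n)) ∧
      v.2.2 = eigVec (M.submatrix (Fin.natAdd m) (Fin.natAdd m))
        (hM.submatrix (Fin.natAdd m)) }

/-- Top-left `p × p` block. -/
def blockTL (p q : ℕ) (X : Matrix (Fin (p + q)) (Fin (p + q)) ℂ) : Matrix (Fin p) (Fin p) ℂ :=
  X.submatrix (Fin.castAdd q) (Fin.castAdd q)

/-- Top-right `p × q` block. -/
def blockTR (p q : ℕ) (X : Matrix (Fin (p + q)) (Fin (p + q)) ℂ) : Matrix (Fin p) (Fin q) ℂ :=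
  X.submatrix (Fin.castAdd q) (Fin.natAdd p)

/-- Bottom-left `q × p` block. -/
def blockBL (p q : ℕ) (X : Matrix (Fin (p + q)) (Fin (p + q)) ℂ) : Matrix (Fin q) (Fin p) ℂ :=
  X.submatrix (Fin.natAdd p) (Fin.castAdd q)

/-- Bottom-right `q × q` block. -/
def blockBR (p q : ℕ) (X : Matrix (Fin (p + q)) (Fin (p + q)) ℂ) : Matrix (Fin q) (Fin q) ℂ :=
  X.submatrix (Fin.natAdd p) (Fin.natAdd p)

/-- `λ* = (−λ_k, …, −λ_1)`. -/
def starVec {k : ℕ} (x : Fin k → ℝ) : Fin k → ℝ := fun i => -x i.rev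

/-- `ŝ^{p,q} = (s₁, …, s_q, 0, …, 0, −s_q, …, −s₁) ∈ ℝ^{p+q}` (with `p − q` middle zeros). -/
noncomputable def hatPQ (p q : ℕ) (s : Fin q → ℝ) : Fin (p + q) → ℝ :=
  fun i =>
    if h : (i : ℕ) < q then s ⟨i, h⟩
    else if h' : (i : ℕ) < p then 0
    else -s ⟨p + q - 1 - i, by have := i.isLt; omega⟩

/-- The cone `A(p,q)`: pairs `(e(X), s(X₁₂))` for `X` Hermitian of size `p+q`. -/
def coneA (p q : ℕ) : Set ((Fin (p + q) → ℝ) × (Fin q → ℝ)) :=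
  { v | ∃ (X : Matrix (Fin (p + q)) (Fin (p + q)) ℂ) (hX : X.IsHermitian),
      v.1 = eigVec X hX ∧ ∀ i : Fin q, v.2 i = sval (blockTR p q X) (i : ℕ) }

/-- The cone `S(p,q)`: triples `(s(X), s(X₁₂), s(X₂₁))`. -/
def coneS (p q : ℕ) : Set ((Fin (p + q) → ℝ) × (Fin q → ℝ) × (Fin q → ℝ)) :=
  { v | ∃ X : Matrix (Fin (p + q)) (Fin (p + q)) ℂ,
      (∀ i : Fin (p + q), v.1 i = sval X (i : ℕ)) ∧
      (∀ i : Fin q, v.2.1 i = sval (blockTR p q X) (i : ℕ)) ∧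
      (∀ i : Fin q, v.2.2 i = sval (blockBL p q X) (i : ℕ)) }

/-- The cone `T(p,q)`: triples `(s(X), s(X₁₁), s(X₂₂))`. -/
def coneT (p q : ℕ) : Set ((Fin (p + q) → ℝ) × (Fin p → ℝ) × (Fin q → ℝ)) :=
  { v | ∃ X : Matrix (Fin (p + q)) (Fin (p + q)) ℂ,
      (∀ i : Fin (p + q), v.1 i = sval X (i : ℕ)) ∧
      (∀ i : Fin p, v.2.1 i = sval (blockTL p q X) (i : ℕ)) ∧
      (∀ i : Fin q, v.2.2 i = sval (blockBR p q X) (i : ℕ)) }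

/-- `μ(A) = (a_r − r ≥ … ≥ a₂ − 2 ≥ a₁ − 1)` as a decreasing real vector, for
`A = {a₁ < … < a_r}` a subset of `[n]` (0-based indexing internally). -/
noncomputable def muVec {n r : ℕ} (A : Finset (Fin n)) (h : A.card = r) : Fin r → ℝ :=
  fun k => (((A.orderIsoOfFin h k.rev : Fin n) : ℕ) : ℝ) - ((k.rev : ℕ) : ℝ)

/-- `A^o = {ℓ + 1 − a : a ∈ A}` inside `[ℓ]`. -/
def opp {n : ℕ} (A : Finset (Fin n)) : Finset (Fin n) := A.image Fin.rev

/-- `|s|_{K ∩ [q]}` where `K ⊆ [n]`, `s ∈ ℝ^q` and `[q]` is viewed inside `[n]`. -/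
noncomputable def sumRestr {n q : ℕ} (s : Fin q → ℝ) (K : Finset (Fin n)) : ℝ :=
  ∑ i ∈ K, (if h : (i : ℕ) < q then s ⟨i, h⟩ else 0)

/-- The augmented matrix `Ŷ^{p,q} = [[0, Y], [Yᴴ, 0]]` of size `p + q`. -/
def hatM (p q : ℕ) (Y : Matrix (Fin p) (Fin q) ℂ) : Matrix (Fin (p + q)) (Fin (p + q)) ℂ :=
  Matrix.reindex finSumFinEquiv finSumFinEquiv (Matrix.fromBlocks 0 Y Yᴴ 0)

section Spectra

variable {ι κ : Type*} [Fintype ι] [DecidableEq ι] [Fintype κ] [DecidableEq κ]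

/-- The characteristic polynomial of `A` has the roots `v k` (with multiplicity). -/
def HasSpec (A : Matrix ι ι ℂ) (v : κ → ℝ) : Prop :=
  A.charpoly = ∏ k, (Polynomial.X - Polynomial.C (v k : ℂ))

omit [DecidableEq κ] in
theorem roots_prod_X_sub_C_ofReal (u : κ → ℝ) :
    (∏ k, (Polynomial.X - Polynomial.C (u k : ℂ))).roots =
      (Finset.univ.val.map u).map Complex.ofReal := by
  rw [Multiset.map_map]
  have := Polynomial.roots_multiset_prod_X_sub_C (Finset.univ.val.map (fun k => (u k : ℂ)))
  rw [Multiset.map_map] at this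
  exact this

omit [DecidableEq κ] in
theorem HasSpec.map_eq {κ' : Type*} [Fintype κ'] {A : Matrix ι ι ℂ} {v : κ → ℝ} {w : κ' → ℝ}
    (hv : HasSpec A v) (hw : HasSpec A w) :
    Finset.univ.val.map v = Finset.univ.val.map w := by
  apply Multiset.map_injective Complex.ofReal_injective
  rw [← roots_prod_X_sub_C_ofReal v, ← roots_prod_X_sub_C_ofReal w, ← hv, ← hw]

omit [DecidableEq κ] in
theorem HasSpec.card_filter_eq {κ' : Type*} [Fintype κ'] {A : Matrix ι ι ℂ} {v : κ → ℝ}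
    {w : κ' → ℝ} (hv : HasSpec A v) (hw : HasSpec A w) (P : ℝ → Prop) [DecidablePred P] :
    (Finset.univ.filter (fun k => P (v k))).card = (Finset.univ.filter (fun k => P (w k))).card := by
  have h := congrArg (Multiset.countP P) (hv.map_eq hw)
  rw [Multiset.countP_map, Multiset.countP_map] at h
  simpa [Finset.card, Finset.filter] using h

theorem HasSpec.conj {κ' : Type*} [Fintype κ'] {A : Matrix ι ι ℂ} {v : κ' → ℝ} (hv : HasSpec A v)
    {U : Matrix ι κ ℂ} {V : Matrix κ ι ℂ} (h1 : U * V = 1) (h2 : V * U = 1) :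
    HasSpec (V * A * U) v := by
  have hc : Fintype.card ι = Fintype.card κ := by
    have e1 := congrArg trace h1
    have e2 := congrArg trace h2
    rw [trace_mul_comm, e2, trace_one, trace_one] at e1
    exact_mod_cast e1.symm
  have h := Matrix.charpoly_mul_comm' V (A * U)
  rw [← hc] at h
  have h' := mul_left_cancel₀ (pow_ne_zero _ Polynomial.X_ne_zero) h
  unfold HasSpec
  rw [Matrix.mul_assoc, h', Matrix.mul_assoc, h1, Matrix.mul_one, hv]

theorem hasSpec_diagonal (v : κ → ℝ) : HasSpec (diagonal (fun k => (v k : ℂ))) v := by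
  unfold HasSpec
  rw [Matrix.charpoly_diagonal]

theorem hasSpec_of_eq {A : Matrix ι ι ℂ} {v : κ → ℝ} {U : Matrix ι κ ℂ} (h1 : U * Uᴴ = 1)
    (h2 : Uᴴ * U = 1) (hA : A = U * diagonal (fun k => (v k : ℂ)) * Uᴴ) : HasSpec A v := by
  rw [hA]
  exact (hasSpec_diagonal v).conj h2 h1

theorem HasSpec.reindex {κ' : Type*} [Fintype κ'] {A : Matrix ι ι ℂ} {v : κ' → ℝ}
    (hv : HasSpec A v) (e : κ ≃ ι) : HasSpec (A.submatrix e e) v := by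
  unfold HasSpec
  rw [← hv]
  exact Matrix.charpoly_reindex e.symm A

omit [DecidableEq κ] in
theorem HasSpec.comp_equiv {κ' : Type*} [Fintype κ'] {A : Matrix ι ι ℂ} {v : κ → ℝ}
    (hv : HasSpec A v) (e : κ' ≃ κ) : HasSpec A (v ∘ e) := by
  unfold HasSpec
  rw [hv]
  exact (Equiv.prod_comp e (fun k => Polynomial.X - Polynomial.C (v k : ℂ))).symm

omit [DecidableEq κ] in
theorem HasSpec.fromBlocks {ι' κ' : Type*} [Fintype ι'] [DecidableEq ι'] [Fintype κ']
    {A : Matrix ι ι ℂ} {B : Matrix ι' ι' ℂ} {v : κ → ℝ} {w : κ' → ℝ}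
    (hv : HasSpec A v) (hw : HasSpec B w) :
    HasSpec (fromBlocks A 0 0 B) (Sum.elim v w) := by
  unfold HasSpec
  rw [Matrix.charpoly_fromBlocks_zero₁₂, hv, hw, Fintype.prod_sum_type]
  simp

theorem HasSpec.neg {A : Matrix ι ι ℂ} {v : κ → ℝ} {U : Matrix ι κ ℂ} (h1 : U * Uᴴ = 1)
    (h2 : Uᴴ * U = 1) (hA : A = U * diagonal (fun k => (v k : ℂ)) * Uᴴ) :
    HasSpec (-A) (fun k => - v k) := by
  apply hasSpec_of_eq h1 h2
  rw [hA]
  have : (diagonal fun k => ((-v k : ℝ) : ℂ)) = - diagonal (fun k => (v k : ℂ)) := by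
    ext i j; by_cases h : i = j <;> simp [h]
  rw [this, Matrix.mul_neg, Matrix.neg_mul]

theorem exists_diag_fintype {A : Matrix ι ι ℂ} (hA : A.IsHermitian) :
    ∃ U : Matrix ι ι ℂ, U * Uᴴ = 1 ∧ Uᴴ * U = 1 ∧
      A = U * diagonal (fun k => (hA.eigenvalues k : ℂ)) * Uᴴ := by
  refine ⟨hA.eigenvectorUnitary, ?_, ?_, ?_⟩
  · exact Unitary.mul_star_self_of_mem hA.eigenvectorUnitary.2
  · exact Unitary.star_mul_self_of_mem hA.eigenvectorUnitary.2
  · have := hA.spectral_theorem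
    rw [Unitary.conjStarAlgAut_apply] at this
    exact this

/-- Diagonalization with a decreasing list of eigenvalues. -/
theorem exists_diag_antitone {A : Matrix ι ι ℂ} (hA : A.IsHermitian) {k : ℕ}
    (hk : Fintype.card ι = k) :
    ∃ (U : Matrix ι (Fin k) ℂ) (v : Fin k → ℝ), Antitone v ∧ U * Uᴴ = 1 ∧ Uᴴ * U = 1 ∧
      A = U * diagonal (fun k => (v k : ℂ)) * Uᴴ := by
  obtain ⟨U, h1, h2, h3⟩ := exists_diag_fintype hA
  let e0 : Fin k ≃ ι := (Fintype.equivFinOfCardEq hk).symm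
  let w : Fin k → ℝ := fun i => hA.eigenvalues (e0 i)
  let e : Fin k ≃ ι := (Fin.revPerm.trans (Tuple.sort w)).trans e0
  refine ⟨U.submatrix id e, fun i => hA.eigenvalues (e i), ?_, ?_, ?_, ?_⟩
  · intro i j hij
    have := Tuple.monotone_sort w (Fin.rev_le_rev.2 hij)
    simpa [e, w] using this
  · rw [conjTranspose_submatrix, submatrix_mul_equiv, h1, submatrix_one _ Function.injective_id]
  · rw [conjTranspose_submatrix, ← submatrix_mul _ _ _ _ _ Function.bijective_id, h2,
      submatrix_one _ e.injective]
  · have : diagonal (fun k => ((hA.eigenvalues (e k) : ℝ) : ℂ)) =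
        (diagonal (fun k => (hA.eigenvalues k : ℂ))).submatrix e e := by
      rw [submatrix_diagonal_equiv]; rfl
    rw [this, conjTranspose_submatrix, submatrix_mul_equiv, submatrix_mul_equiv]
    simpa using h3

theorem antitone_eq_of_map_eq {k : ℕ} {v w : Fin k → ℝ} (hv : Antitone v) (hw : Antitone w)
    (h : Finset.univ.val.map v = Finset.univ.val.map w) : v = w := by
  apply List.ofFn_injective
  have hp : (List.ofFn v).Perm (List.ofFn w) := by
    simpa [Fin.univ_val_map] using h
  exact hp.eq_of_pairwise' hv.sortedGE_ofFn.pairwise hw.sortedGE_ofFn.pairwise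

end Spectra

theorem eigVec_antitone {k : ℕ} (X : Matrix (Fin k) (Fin k) ℂ) (hX : X.IsHermitian) :
    Antitone (eigVec X hX) := by
  intro i j hij
  exact Tuple.monotone_sort hX.eigenvalues (Fin.rev_le_rev.2 hij)

theorem hasSpec_eigVec {k : ℕ} (X : Matrix (Fin k) (Fin k) ℂ) (hX : X.IsHermitian) :
    HasSpec X (eigVec X hX) := by
  have h : HasSpec X hX.eigenvalues := hX.charpoly_eq
  exact h.comp_equiv (Fin.revPerm.trans (Tuple.sort hX.eigenvalues))

theorem eigVec_eq {k : ℕ} {X : Matrix (Fin k) (Fin k) ℂ} (hX : X.IsHermitian) {v : Fin k → ℝ}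
    (hv : Antitone v) (h : HasSpec X v) : eigVec X hX = v :=
  antitone_eq_of_map_eq (eigVec_antitone X hX) hv ((hasSpec_eigVec X hX).map_eq h)

theorem exists_diag_of_hasSpec {k : ℕ} {X : Matrix (Fin k) (Fin k) ℂ} (hX : X.IsHermitian)
    {v : Fin k → ℝ} (hv : Antitone v) (h : HasSpec X v) :
    ∃ U : Matrix (Fin k) (Fin k) ℂ, U * Uᴴ = 1 ∧ Uᴴ * U = 1 ∧
      X = U * diagonal (fun k => (v k : ℂ)) * Uᴴ := by
  obtain ⟨U, w, hw, h1, h2, h3⟩ := exists_diag_antitone hX (Fintype.card_fin k)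
  have : w = v := antitone_eq_of_map_eq hw hv ((hasSpec_of_eq h1 h2 h3).map_eq h)
  subst this
  exact ⟨U, h1, h2, h3⟩

/-- A decreasing list is determined by its counting function. -/
theorem antitone_eq_of_card {k : ℕ} {v : Fin k → ℝ} (hv : Antitone v) (i : Fin k) (c : ℝ)
    (h1 : (Finset.univ.filter (fun j => c < v j)).card ≤ i)
    (h2 : (i : ℕ) < (Finset.univ.filter (fun j => c ≤ v j)).card) : v i = c := by
  apply le_antisymm
  · by_contra hlt
    push Not at hlt
    have : Finset.Iic i ⊆ Finset.univ.filter (fun j => c < v j) := by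
      intro j hj
      simp only [Finset.mem_Iic] at hj
      simpa using lt_of_lt_of_le hlt (hv hj)
    have := Finset.card_le_card this
    simp at this
    omega
  · by_contra hlt
    push Not at hlt
    have : Finset.univ.filter (fun j => c ≤ v j) ⊆ Finset.Iio i := by
      intro j hj
      simp only [Finset.mem_filter, Finset.mem_univ, true_and] at hj
      simp only [Finset.mem_Iio]
      by_contra hji
      push Not at hji
      exact absurd (lt_of_lt_of_le hlt hj) (not_lt.2 (hv hji))
    have := Finset.card_le_card this
    simp at this
    omega

section Echelon

variable {K : Type*} [Field K]

theorem exists_submatrix_det_ne_zero {n d : Type*} [Fintype n] [Fintype d]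
    [DecidableEq d] (Y : Matrix n d K) (L : Matrix d n K) (hL : L * Y = 1) :
    ∃ F : d → n, (Y.submatrix F id).det ≠ 0 := by
  classical
  by_contra hcon
  push Not at hcon
  have h1 : (L * Y).det = 1 := by rw [hL, det_one]
  have h2 : (L * Y) = fun i => ∑ f, L i f • Y f := by
    ext i j
    simp [Matrix.mul_apply, Finset.sum_apply]
  rw [h2] at h1
  change detRowAlternating.toMultilinearMap (fun i => ∑ f, L i f • Y f) = 1 at h1
  rw [MultilinearMap.map_sum] at h1
  rw [Finset.sum_eq_zero] at h1
  · exact zero_ne_one h1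
  · intro F _
    rw [MultilinearMap.map_smul_univ]
    have : detRowAlternating.toMultilinearMap (fun i => Y (F i)) = 0 := hcon F
    rw [this, smul_zero]

/-- Column echelon form, with the pivots as far up as possible. -/
theorem exists_echelon {n d : ℕ} (Y : Matrix (Fin n) (Fin d) K) (L : Matrix (Fin d) (Fin n) K)
    (hL : L * Y = 1) :
    ∃ F : Fin d → Fin n, StrictMono F ∧ ∃ R R' : Matrix (Fin d) (Fin d) K, R * R' = 1 ∧
      (∀ i j, (Y * R) (F i) j = (1 : Matrix (Fin d) (Fin d) K) i j) ∧
      ∀ f j, f < F j → (Y * R) f j = 0 := by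
  classical
  let S : Finset (Fin d → Fin n) := Finset.univ.filter (fun F => (Y.submatrix F id).det ≠ 0)
  have hS : S.Nonempty := by
    obtain ⟨F, hF⟩ := exists_submatrix_det_ne_zero Y L hL
    exact ⟨F, by simp [S, hF]⟩
  obtain ⟨F0, hF0, hmin⟩ := S.exists_min_image (fun F => ∑ i, (F i : ℕ)) hS
  simp only [S, Finset.mem_filter, Finset.mem_univ, true_and] at hF0 hmin
  have hinj0 : Function.Injective F0 := by
    intro a b hab
    by_contra hne
    apply hF0
    apply det_zero_of_row_eq hne
    ext j; simp [hab]
  let F := F0 ∘ Tuple.sort F0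
  have hFdet : (Y.submatrix F id).det ≠ 0 := by
    have : Y.submatrix F id = (Y.submatrix F0 id).submatrix (Tuple.sort F0) id := rfl
    rw [this, det_permute]
    rcases Int.units_eq_one_or (Equiv.Perm.sign (Tuple.sort F0)) with h | h <;>
      simpa [h] using hF0
  have hsum : ∑ i, (F i : ℕ) = ∑ i, (F0 i : ℕ) :=
    Equiv.sum_comp (Tuple.sort F0) (fun i => (F0 i : ℕ))
  have hFs : StrictMono F :=
    (Tuple.monotone_sort F0).strictMono_of_injective (hinj0.comp (Tuple.sort F0).injective)
  have hu : IsUnit (Y.submatrix F id).det := isUnit_iff_ne_zero.2 hFdet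
  set R := (Y.submatrix F id)⁻¹ with hR
  have hYR : (Y * R).submatrix F id = 1 := by
    rw [submatrix_mul _ _ _ id _ Function.bijective_id, submatrix_id_id, mul_nonsing_inv _ hu]
  refine ⟨F, hFs, R, Y.submatrix F id, nonsing_inv_mul _ hu, fun i j => ?_, fun f j hfj => ?_⟩
  · rw [← hYR]; rfl
  · by_contra hne
    let F' := Function.update F j f
    have hF'det : ((Y * R).submatrix F' id).det ≠ 0 := by
      have : (Y * R).submatrix F' id = updateRow 1 j ((Y * R) f) := by
        ext a b
        by_cases h : a = j
        · subst h; simp [F']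
        · rw [← hYR]; simp [F', h]
      rw [this, det_eq_sum_mul_adjugate_row _ j, Finset.sum_eq_single j]
      · have h1 : (updateRow (1 : Matrix (Fin d) (Fin d) K) j (Pi.single j 1)) = 1 := by
          ext a b
          by_cases h : a = j
          · subst h; simp [Matrix.one_apply, Pi.single_apply, eq_comm]
          · simp [h]
        rw [adjugate_apply, updateRow_idem, h1]
        simpa using hne
      · intro b _ hb
        have : (updateRow (1 : Matrix (Fin d) (Fin d) K) j ((Y * R) f)).adjugate b j = 0 := by
          rw [adjugate_apply, updateRow_idem]
          apply det_zero_of_row_eq (Ne.symm hb)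
          ext c
          simp [hb, Matrix.one_apply, Pi.single_apply, eq_comm]
        rw [this, mul_zero]
      · simp
    have hF'' : (Y.submatrix F' id).det ≠ 0 := by
      intro h0
      apply hF'det
      rw [submatrix_mul _ _ _ id _ Function.bijective_id, det_mul, h0, zero_mul]
    have h1 := hmin F' hF''
    rw [← hsum] at h1
    have h2 : ∑ i, (F' i : ℕ) < ∑ i, (F i : ℕ) := by
      apply Finset.sum_lt_sum
      · intro i _
        by_cases h : i = j
        · subst h; simp [F']; exact hfj.le
        · simp [F', h]
      · exact ⟨j, Finset.mem_univ _, by simpa [F'] using hfj⟩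
    omega

end Echelon

section GramSchmidt

open scoped ComplexOrder

/-- Gram–Schmidt by column operations that preserve lower triangular patterns. -/
theorem exists_lower_orthonormal {n : Type*} [Fintype n] {d : ℕ}
    (Y : Matrix n (Fin d) ℂ) (L : Matrix (Fin d) n ℂ) [DecidableEq n] (hL : L * Y = 1) :
    ∃ R R' : Matrix (Fin d) (Fin d) ℂ, R * R' = 1 ∧ (∀ i j, i < j → R i j = 0) ∧
      (Y * R)ᴴ * (Y * R) = 1 := by
  have hinj : Function.Injective Y.mulVec := by
    intro a b hab
    have := congrArg (L.mulVec) hab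
    simpa [mulVec_mulVec, hL] using this
  have hpd : (Yᴴ * Y).PosDef := PosDef.conjTranspose_mul_self _ hinj
  let e : (Fin d)ᵒᵈ ≃ Fin d := OrderDual.ofDual
  have hpd' : ((Yᴴ * Y).submatrix e e).PosDef := hpd.submatrix e.injective
  set S := (Yᴴ * Y).submatrix e e
  set T := LDL.lowerInv hpd' with hT
  have hD := LDL.diag_eq_lowerInv_conj hpd'
  rw [← hT] at hD
  have hTu : IsUnit T := by
    have := LDL.invertibleLowerInv hpd'
    exact isUnit_of_invertible (LDL.lowerInv hpd')
  have hDpd : (LDL.diag hpd').PosDef := by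
    rw [hD]
    exact hpd'.mul_mul_conjTranspose_same (vecMul_injective_of_isUnit hTu)
  let δ : (Fin d)ᵒᵈ → ℂ := LDL.diagEntries hpd'
  have hDd : LDL.diag hpd' = diagonal δ := rfl
  rw [hDd] at hDpd
  have hδ : ∀ i, 0 < δ i := posDef_diagonal_iff.1 hDpd
  let ρ : (Fin d)ᵒᵈ → ℂ := fun i => ((Real.sqrt (δ i).re)⁻¹ : ℝ)
  have hρ : ∀ i, ρ i * δ i * ρ i = 1 := by
    intro i
    have h0 := hδ i
    rw [Complex.lt_def] at h0
    have hre : 0 < (δ i).re := by simpa using h0.1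
    have him : δ i = ((δ i).re : ℂ) := by
      apply Complex.ext <;> simp [← h0.2]
    rw [him]
    simp only [ρ]
    norm_cast
    have := Real.mul_self_sqrt hre.le
    have h3 := Real.sqrt_pos.2 hre
    field_simp
    nlinarith
  let R0 : Matrix (Fin d)ᵒᵈ (Fin d)ᵒᵈ ℂ := Tᴴ * diagonal ρ
  have hR0 : R0ᴴ * S * R0 = 1 := by
    have hρs : (diagonal ρ)ᴴ = diagonal ρ := by
      rw [diagonal_conjTranspose]
      congr 1; ext i; simp [ρ]
    simp only [R0, conjTranspose_mul, conjTranspose_conjTranspose, hρs]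
    have : diagonal ρ * T * S * (Tᴴ * diagonal ρ) = diagonal ρ * (T * S * Tᴴ) * diagonal ρ := by
      simp only [Matrix.mul_assoc]
    rw [this, ← hD, hDd, diagonal_mul_diagonal, diagonal_mul_diagonal]
    simp [hρ]
  have hR1 : (Y * R0.submatrix e.symm e.symm)ᴴ * (Y * R0.submatrix e.symm e.symm) = 1 := by
    have h1 := congrArg (fun M => M.submatrix e.symm e.symm) hR0
    simp only [submatrix_one_equiv] at h1
    rw [← h1]
    rw [conjTranspose_mul, Matrix.mul_assoc, ← Matrix.mul_assoc Yᴴ]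
    have : Yᴴ * Y = S.submatrix e.symm e.symm := by simp [S]
    rw [this, conjTranspose_submatrix, ← Matrix.mul_assoc, submatrix_mul_equiv,
      submatrix_mul_equiv]
  refine ⟨R0.submatrix e.symm e.symm,
    (R0.submatrix e.symm e.symm)ᴴ * (Yᴴ * Y), ?_, ?_, hR1⟩
  · rw [mul_eq_one_comm]
    simpa [conjTranspose_mul, Matrix.mul_assoc] using hR1
  · intro i j hij
    simp only [submatrix_apply, R0, mul_diagonal, conjTranspose_apply]
    have : T (e.symm j) (e.symm i) = 0 := LDL.lowerInv_triangular hpd' hij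
    rw [this]; simp

theorem exists_orthonormal_pattern {n : Type*} [Fintype n] [DecidableEq n] [Preorder n] {d : ℕ}
    {Y : Matrix n (Fin d) ℂ} {L : Matrix (Fin d) n ℂ} (hL : L * Y = 1) {F : Fin d → n}
    (hF : Monotone F) (hY : ∀ f j, f < F j → Y f j = 0) :
    ∃ R R' : Matrix (Fin d) (Fin d) ℂ, R * R' = 1 ∧ (Y * R)ᴴ * (Y * R) = 1 ∧
      ∀ f j, f < F j → (Y * R) f j = 0 := by
  obtain ⟨R, R', h1, h2, h3⟩ := exists_lower_orthonormal Y L hL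
  refine ⟨R, R', h1, h3, fun f j hfj => ?_⟩
  rw [mul_apply]
  apply Finset.sum_eq_zero
  intro i _
  rcases lt_or_ge i j with h | h
  · rw [h2 i j h, mul_zero]
  · rw [hY f i (lt_of_lt_of_le hfj (hF h)), zero_mul]

end GramSchmidt

/-- For a dense set of triples `g`, there is a `d`-dimensional subspace in position at least `F k`
with respect to the flag of (reversed) columns of each `g k`. -/
def DenseInt (n d : ℕ) (F : Fin 3 → Fin d → Fin n) : Prop :=
  ∀ U : Set (Fin 3 → Matrix (Fin n) (Fin n) ℂ), IsOpen U → U.Nonempty → ∃ g ∈ U,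
    ∃ (Ω : Matrix (Fin n) (Fin d) ℂ) (L : Matrix (Fin d) (Fin n) ℂ)
      (w w' : Fin 3 → Matrix (Fin d) (Fin d) ℂ) (y : Fin 3 → Matrix (Fin n) (Fin d) ℂ),
      L * Ω = 1 ∧ (∀ k, w k * w' k = 1) ∧ (∀ k, Ω * w k = g k * y k) ∧
        ∀ k f j, f < F k j → y k f j = 0

section Compactness

variable {n d : Type*} [Fintype n] [Fintype d] [DecidableEq d]

omit [Fintype d] in
theorem norm_apply_le_of_orthonormal {M : Matrix n d ℂ} (hM : Mᴴ * M = 1) (i : n) (j : d) :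
    ‖M i j‖ ≤ 1 := by
  have h := congrFun (congrFun hM j) j
  simp only [mul_apply, conjTranspose_apply, one_apply_eq] at h
  have h' : ∑ x, ‖M x j‖ ^ 2 = 1 := by
    have : ∀ x, star (M x j) * M x j = ((‖M x j‖ ^ 2 : ℝ) : ℂ) := by
      intro x
      rw [Complex.star_def, Complex.conj_mul']
      push_cast; rfl
    simp_rw [this] at h
    exact_mod_cast h
  have h2 : ‖M i j‖ ^ 2 ≤ 1 := by
    rw [← h']
    exact Finset.single_le_sum (f := fun x => ‖M x j‖ ^ 2) (fun x _ => by positivity)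
      (Finset.mem_univ i)
  have := norm_nonneg (M i j)
  nlinarith

omit [Fintype d] in
theorem isCompact_orthonormal : IsCompact {M : Matrix n d ℂ | Mᴴ * M = 1} := by
  have h1 : IsCompact (Set.pi Set.univ (fun _ : n => Set.pi Set.univ
      (fun _ : d => Metric.closedBall (0 : ℂ) 1))) :=
    isCompact_univ_pi fun _ => isCompact_univ_pi fun _ => isCompact_closedBall _ _
  refine IsCompact.of_isClosed_subset h1 ?_ ?_
  · have : Continuous fun M : Matrix n d ℂ => Mᴴ * M := by fun_prop
    exact isClosed_eq this continuous_const
  · intro M hM i _ j _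
    simpa using norm_apply_le_of_orthonormal hM i j

end Compactness

theorem DenseInt.exists_orthonormal {n d : ℕ} {F : Fin 3 → Fin d → Fin n} (h : DenseInt n d F)
    (hF : ∀ k, Monotone (F k)) (U : Fin 3 → Matrix (Fin n) (Fin n) ℂ) 
    (hU : ∀ k, (U k)ᴴ * U k = 1) :
    ∃ (Ω : Matrix (Fin n) (Fin d) ℂ) (z : Fin 3 → Matrix (Fin n) (Fin d) ℂ)
      (T : Fin 3 → Matrix (Fin d) (Fin d) ℂ), Ωᴴ * Ω = 1 ∧ (∀ k, (z k)ᴴ * z k = 1) ∧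
      (∀ k, Ω * T k = U k * z k) ∧ (∀ k, (T k)ᴴ * T k = 1) ∧ ∀ k f j, f < F k j → z k f j = 0 := by
  let Kc : Set (Matrix (Fin n) (Fin d) ℂ × (Fin 3 → Matrix (Fin n) (Fin d) ℂ)) :=
    {M | Mᴴ * M = 1} ×ˢ Set.pi Set.univ (fun _ => {M | Mᴴ * M = 1})
  have hKc : IsCompact Kc :=
    isCompact_orthonormal.prod (isCompact_univ_pi fun _ => isCompact_orthonormal)
  have : CompactSpace Kc := isCompact_iff_compactSpace.1 hKc
  let C : Set ((Fin 3 → Matrix (Fin n) (Fin n) ℂ) × Kc) :=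
    {x | ∀ k, x.2.1.1 * (x.2.1.1)ᴴ * (x.1 k * x.2.1.2 k) = x.1 k * x.2.1.2 k ∧
      ∀ f j, f < F k j → x.2.1.2 k f j = 0}
  have hC : IsClosed C := by
    have e : C = ⋂ k, ({x | x.2.1.1 * (x.2.1.1)ᴴ * (x.1 k * x.2.1.2 k) = x.1 k * x.2.1.2 k} ∩
      ⋂ f, ⋂ j, ⋂ (_ : f < F k j), {x | x.2.1.2 k f j = 0}) := by
      ext x; simp [C]
    rw [e]
    refine isClosed_iInter fun k => IsClosed.inter (isClosed_eq ?_ ?_) (isClosed_iInter fun f =>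
      isClosed_iInter fun j => isClosed_iInter fun _ => isClosed_eq ?_ continuous_const) <;>
    fun_prop
  have himg : IsClosed (Prod.fst '' C) := isClosedMap_fst_of_compactSpace _ hC
  have hdense : Prod.fst '' C = Set.univ := by
    by_contra hne
    obtain ⟨g, hg, Ω, L, w, w', y, hL, hw, hΩ, hy⟩ :=
      h _ himg.isOpen_compl (Set.nonempty_compl.2 hne)
    apply hg
    have hw' : ∀ k, w' k * w k = 1 := fun k => mul_eq_one_comm.1 (hw k)
    have hyL : ∀ k, (w' k * L * g k) * y k = 1 := by
      intro k
      rw [Matrix.mul_assoc, ← hΩ k, Matrix.mul_assoc, ← Matrix.mul_assoc L, hL, Matrix.one_mul,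
        hw' k]
    obtain ⟨R, R', hR, -, hRo⟩ := exists_lower_orthonormal Ω L hL
    choose Q Q' hQ hQo hQp using fun k => exists_orthonormal_pattern (hyL k) (hF k) (hy k)
    refine ⟨(g, ⟨(Ω * R, fun k => y k * Q k), ?_, ?_⟩), ?_, rfl⟩
    · exact hRo
    · intro k _; exact hQo k
    · intro k
      refine ⟨?_, hQp k⟩
      change Ω * R * (Ω * R)ᴴ * (g k * (y k * Q k)) = g k * (y k * Q k)
      have e : g k * (y k * Q k) = Ω * R * (R' * w k * Q k) := by
        rw [← Matrix.mul_assoc, ← hΩ k]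
        simp only [Matrix.mul_assoc]
        rw [← Matrix.mul_assoc R, hR, Matrix.one_mul]
      rw [e, Matrix.mul_assoc (Ω * R), ← Matrix.mul_assoc (Ω * R)ᴴ, hRo, Matrix.one_mul]
  have hmem : U ∈ Prod.fst '' C := by rw [hdense]; trivial
  obtain ⟨⟨g, ⟨Ω, z⟩, hΩ, hz⟩, hx, rfl⟩ := hmem
  have hx1 : ∀ k, Ω * Ωᴴ * (g k * z k) = g k * z k := fun k => (hx k).1
  have hz' : ∀ k, (z k)ᴴ * z k = 1 := fun k => hz k trivial
  refine ⟨Ω, z, fun k => Ωᴴ * (g k * z k), hΩ, hz', fun k => ?_, fun k => ?_, fun k => (hx k).2⟩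
  · rw [← Matrix.mul_assoc, hx1]
  · rw [conjTranspose_mul, conjTranspose_conjTranspose, Matrix.mul_assoc, ← Matrix.mul_assoc Ω,
      hx1, conjTranspose_mul, Matrix.mul_assoc, ← Matrix.mul_assoc (g k)ᴴ]
    change (z k)ᴴ * ((g k)ᴴ * g k * z k) = 1
    rw [hU k, Matrix.one_mul, hz']

theorem re_trace_diagonal_conj {n d : Type*} [Fintype n] [Fintype d] [DecidableEq n]
    (a : n → ℝ) (z : Matrix n d ℂ) :
    (trace (zᴴ * diagonal (fun f => (a f : ℂ)) * z)).re = ∑ j, ∑ f, a f * ‖z f j‖ ^ 2 := by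
  rw [trace, Complex.re_sum]
  refine Finset.sum_congr rfl fun j _ => ?_
  rw [diag_apply, mul_apply, Complex.re_sum]
  refine Finset.sum_congr rfl fun f _ => ?_
  rw [mul_diagonal, conjTranspose_apply, mul_comm (star _), mul_assoc, Complex.star_def,
    Complex.conj_mul']
  norm_cast

theorem DenseInt.sum_le {n d : ℕ} {F : Fin 3 → Fin d → Fin n} (h : DenseInt n d F)
    (hF : ∀ k, Monotone (F k)) {A U : Fin 3 → Matrix (Fin n) (Fin n) ℂ} {a : Fin 3 → Fin n → ℝ}
    (hU : ∀ k, (U k)ᴴ * U k = 1) (ha : ∀ k, Antitone (a k))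
    (hA : ∀ k, A k = U k * diagonal (fun f => (a k f : ℂ)) * (U k)ᴴ) {c : ℝ}
    (hc : ∑ k, A k = (c : ℂ) • 1) : c * d ≤ ∑ k, ∑ j, a k (F k j) := by
  obtain ⟨Ω, z, T, hΩ, hz, hT, hTT, hp⟩ := h.exists_orthonormal hF U hU
  have h1 : ∀ k, trace (Ωᴴ * A k * Ω) =
      trace ((z k)ᴴ * diagonal (fun f => (a k f : ℂ)) * z k) := by
    intro k
    have hTT' : T k * (T k)ᴴ = 1 := mul_eq_one_comm.1 (hTT k)
    have e1 : trace (Ωᴴ * A k * Ω) = trace ((Ω * T k)ᴴ * A k * (Ω * T k)) := by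
      rw [conjTranspose_mul, ← Matrix.mul_one (Ωᴴ * A k * Ω), ← hTT', ← Matrix.mul_assoc,
        trace_mul_comm]
      simp only [Matrix.mul_assoc]
    rw [e1, hT k, hA k, conjTranspose_mul]
    have e2 : (z k)ᴴ * (U k)ᴴ * (U k * diagonal (fun f => (a k f : ℂ)) * (U k)ᴴ) * (U k * z k) =
      (z k)ᴴ * ((U k)ᴴ * U k) * diagonal (fun f => (a k f : ℂ)) * ((U k)ᴴ * U k) * z k := by
      simp only [Matrix.mul_assoc]
    rw [e2, hU k, Matrix.mul_one, Matrix.mul_one]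
  have h2 : ∑ k, trace (Ωᴴ * A k * Ω) = ((c * d : ℝ) : ℂ) := by
    rw [← trace_sum, ← Matrix.sum_mul, ← Matrix.mul_sum, hc]
    simp [hΩ]
  have h3 : c * d = ∑ k, (trace (Ωᴴ * A k * Ω)).re := by
    rw [← Complex.re_sum, h2, Complex.ofReal_re]
  rw [h3]
  refine Finset.sum_le_sum fun k _ => ?_
  rw [h1 k, re_trace_diagonal_conj]
  refine Finset.sum_le_sum fun j _ => ?_
  have hz1 : ∑ f, ‖z k f j‖ ^ 2 = 1 := by
    have h := congrFun (congrFun (hz k) j) j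
    simp only [mul_apply, conjTranspose_apply, one_apply_eq] at h
    have : ∀ x, star (z k x j) * z k x j = ((‖z k x j‖ ^ 2 : ℝ) : ℂ) := by
      intro x
      rw [Complex.star_def, Complex.conj_mul']
      push_cast; rfl
    simp_rw [this] at h
    exact_mod_cast h
  calc ∑ f, a k f * ‖z k f j‖ ^ 2 ≤ ∑ f, a k (F k j) * ‖z k f j‖ ^ 2 := by
        refine Finset.sum_le_sum fun f _ => ?_
        rcases lt_or_ge f (F k j) with hf | hf
        · rw [hp k f j hf]; simp
        · exact mul_le_mul_of_nonneg_right (ha k hf) (by positivity)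
    _ = a k (F k j) := by rw [← Finset.mul_sum, hz1, mul_one]

section LinearAlgebra

variable {K : Type*} [Field K]

theorem exists_frame {d : ℕ} (S : Submodule K (Fin d → K)) :
    ∃ (d₁ : ℕ) (Q : Matrix (Fin d) (Fin d₁) K) (P : Matrix (Fin d₁) (Fin d) K),
      P * Q = 1 ∧ (∀ v, Q *ᵥ v ∈ S) ∧ (∀ x ∈ S, Q *ᵥ (P *ᵥ x) = x) ∧ (S ≠ ⊤ → d₁ < d) := by
  let b := Module.finBasis K S
  let f : (Fin (Module.finrank K S) → K) →ₗ[K] (Fin d → K) :=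
    S.subtype ∘ₗ b.equivFun.symm.toLinearMap
  have hf : LinearMap.ker f = ⊥ := by
    rw [LinearMap.ker_eq_bot]
    exact S.injective_subtype.comp b.equivFun.symm.injective
  obtain ⟨g, hg⟩ := f.exists_leftInverse_of_injective hf
  refine ⟨_, LinearMap.toMatrix' f, LinearMap.toMatrix' g, ?_, ?_, ?_, ?_⟩
  · rw [← LinearMap.toMatrix'_comp, hg, LinearMap.toMatrix'_id]
  · intro v
    rw [LinearMap.toMatrix'_mulVec]
    exact (b.equivFun.symm v).2
  · intro x hx
    rw [LinearMap.toMatrix'_mulVec, LinearMap.toMatrix'_mulVec]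
    have : f (b.equivFun ⟨x, hx⟩) = x := by simp [f]
    have h2 : g (f (b.equivFun ⟨x, hx⟩)) = b.equivFun ⟨x, hx⟩ := LinearMap.congr_fun hg _
    rw [← this, h2]
  · intro h
    have := Submodule.finrank_lt h
    simpa using this

theorem exists_sum_mul_of_ker {N d : Type*} [Fintype N] [Fintype d] [DecidableEq N] 
    {h : Type*} [Fintype h] (φ : h → Matrix N d K) (θ : Matrix N d K)
    (hθ : ∀ x, (∀ a, φ a *ᵥ x = 0) → θ *ᵥ x = 0) :
    ∃ X : h → Matrix N N K, θ = ∑ a, X a * φ a := by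
  classical
  have key : ∀ t, ∃ c : h × N → K, ∀ x, (θ *ᵥ x) t = ∑ as, c as * (φ as.1 *ᵥ x) as.2 := by
    intro t
    let L : h × N → ((d → K) →ₗ[K] K) := fun as =>
      LinearMap.proj as.2 ∘ₗ (φ as.1).mulVecLin
    let Kt : (d → K) →ₗ[K] K := LinearMap.proj t ∘ₗ θ.mulVecLin
    have hm : Kt ∈ Submodule.span K (Set.range L) := by
      apply mem_span_of_iInf_ker_le_ker
      intro x hx
      simp only [Submodule.mem_iInf, LinearMap.mem_ker] at hx ⊢
      have : θ *ᵥ x = 0 := hθ x fun a => by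
        ext s; exact hx (a, s)
      exact congrFun this t
    obtain ⟨c, hc⟩ := (Submodule.mem_span_range_iff_exists_fun K).1 hm
    refine ⟨c, fun x => ?_⟩
    have := LinearMap.congr_fun hc x
    simp only [LinearMap.sum_apply, LinearMap.smul_apply] at this
    exact this.symm
  choose c hc using key
  refine ⟨fun a => of fun t s => c t (a, s), ?_⟩
  apply Matrix.ext_of_mulVec_single
  intro j
  ext t
  rw [hc t, Fintype.sum_prod_type, Matrix.sum_mulVec, Finset.sum_apply]
  refine Finset.sum_congr rfl fun a _ => ?_
  rw [← mulVec_mulVec]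
  rfl

end LinearAlgebra

section Derivations

variable {K : Type*} [Field K]

theorem map_derivation_mul {l m n : Type*} [Fintype m] (D : Derivation ℤ K K) (A : Matrix l m K)
    (B : Matrix m n K) : (A * B).map D = A.map D * B + A * B.map D := by
  ext i j
  simp only [map_apply, mul_apply, Matrix.add_apply, map_sum, Derivation.leibniz, smul_eq_mul]
  rw [← Finset.sum_add_distrib]
  exact Finset.sum_congr rfl fun x _ => by ring

variable {N d : ℕ}

/-- Solutions of the homogeneous incidence conditions. -/
def incHom (w : Fin 3 → Matrix (Fin d) (Fin d) K) (p : Fin 3 → Matrix (Fin N) (Fin N) K)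
    (m : Fin 3 → Fin d → ℕ) : Submodule K (Matrix (Fin N) (Fin d) K) where
  carrier := {φ | ∀ k (t : Fin N) j, (t : ℕ) < m k j → (p k * φ * w k) t j = 0}
  zero_mem' := by intro k t j _; simp
  add_mem' := by
    intro a b ha hb k t j h
    rw [Matrix.mul_add, Matrix.add_mul, Matrix.add_apply, ha k t j h, hb k t j h, add_zero]
  smul_mem' := by
    intro c a ha k t j h
    rw [Matrix.mul_smul, Matrix.smul_mul, Matrix.smul_apply, ha k t j h, smul_zero]

/-- The inhomogeneous incidence conditions are always solvable. -/
def IncSurj (w : Fin 3 → Matrix (Fin d) (Fin d) K) (p : Fin 3 → Matrix (Fin N) (Fin N) K)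
    (m : Fin 3 → Fin d → ℕ) : Prop :=
  ∀ τ : Fin 3 → Matrix (Fin N) (Fin d) K, ∃ φ : Matrix (Fin N) (Fin d) K,
    ∀ k (t : Fin N) j, (t : ℕ) < m k j → (p k * φ * w k) t j = τ k t j

/-- Genericity of a pair of triples of matrices, up to a common left gauge and triangular right
gauges for `w`. -/
def IncGeneric (w : Fin 3 → Matrix (Fin d) (Fin d) K) (p : Fin 3 → Matrix (Fin N) (Fin N) K) :
    Prop :=
  ∀ (ξ : Fin 3 → Matrix (Fin d) (Fin d) K) (η : Fin 3 → Matrix (Fin N) (Fin N) K),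
    ∃ (D : Derivation ℤ K K) (M : Matrix (Fin d) (Fin d) K) (b : Fin 3 → Matrix (Fin d) (Fin d) K),
      (∀ k f j, f < j → b k f j = 0) ∧
      (∀ k, (w k).map D = (ξ k + M) * w k + w k * b k) ∧ ∀ k, (p k).map D = p k * η k

/-- The semistability inequalities. -/
def IncStable (N : ℕ) (w : Fin 3 → Matrix (Fin d) (Fin d) K) (m : Fin 3 → Fin d → ℕ) : Prop :=
  ∀ (e : ℕ) (Q : Matrix (Fin d) (Fin e) K) (P : Matrix (Fin e) (Fin d) K)
    (c c' : Fin 3 → Matrix (Fin e) (Fin e) K) (y : Fin 3 → Matrix (Fin d) (Fin e) K)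
    (F : Fin 3 → Fin e → Fin d), P * Q = 1 → (∀ k, c k * c' k = 1) →
    (∀ k, StrictMono (F k)) → (∀ k, Q * c k = w k * y k) →
    (∀ k f j, f < F k j → y k f j = 0) → ∑ k, ∑ j, m k (F k j) ≤ e * N

theorem incHom_derivation {w : Fin 3 → Matrix (Fin d) (Fin d) K}
    {p : Fin 3 → Matrix (Fin N) (Fin N) K} {m : Fin 3 → Fin d → ℕ} (hm : ∀ k, Monotone (m k))
    {ξ : Fin 3 → Matrix (Fin d) (Fin d) K} {η : Fin 3 → Matrix (Fin N) (Fin N) K}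
    {D : Derivation ℤ K K} {M : Matrix (Fin d) (Fin d) K} {b : Fin 3 → Matrix (Fin d) (Fin d) K}
    (hb : ∀ k f j, f < j → b k f j = 0)
    (hw : ∀ k, (w k).map D = (ξ k + M) * w k + w k * b k) (hp : ∀ k, (p k).map D = p k * η k)
    {φ : Matrix (Fin N) (Fin d) K} (hφ : φ ∈ incHom w p m) (k : Fin 3) (t : Fin N) (j : Fin d)
    (ht : (t : ℕ) < m k j) :
    (p k * (φ.map D + φ * M) * w k) t j + (p k * (η k * φ + φ * ξ k) * w k) t j = 0 := by
  have h1 : (p k * φ * w k).map D = p k * (φ.map D + φ * M) * w k +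
      p k * (η k * φ + φ * ξ k) * w k + p k * φ * w k * b k := by
    rw [map_derivation_mul, map_derivation_mul, hw, hp]
    simp only [Matrix.mul_add, Matrix.add_mul, Matrix.mul_assoc]
    abel
  have h2 : ((p k * φ * w k).map D) t j = 0 := by
    rw [map_apply, hφ k t j ht, map_zero]
  have h3 : (p k * φ * w k * b k) t j = 0 := by
    rw [mul_apply]
    refine Finset.sum_eq_zero fun f _ => ?_
    rcases lt_or_ge f j with h | h
    · rw [hb k f j h, mul_zero]
    · rw [hφ k t f (lt_of_lt_of_le ht (hm k h)), zero_mul]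
  rw [h1, Matrix.add_apply, h3, add_zero, Matrix.add_apply] at h2
  exact h2

theorem incSurj_of_generic_of_stable (d : ℕ) (w w' : Fin 3 → Matrix (Fin d) (Fin d) K)
    (p p' : Fin 3 → Matrix (Fin N) (Fin N) K) (m : Fin 3 → Fin d → ℕ)
    (hw : ∀ k, w k * w' k = 1) (hp : ∀ k, p k * p' k = 1) (hm : ∀ k, Monotone (m k))
    (hG : IncGeneric w p) (hS : IncStable N w m) : IncSurj w p m := by
  induction d using Nat.strong_induction_on with
  | _ d ih =>
  have hw2 : ∀ k, w' k * w k = 1 := fun k => mul_eq_one_comm.1 (hw k)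
  have hp2 : ∀ k, p' k * p k = 1 := fun k => mul_eq_one_comm.1 (hp k)
  by_cases hbot : incHom w p m = ⊥
  · let κ := Σ k : Fin 3, {x : Fin N × Fin d // (x.1 : ℕ) < m k x.2}
    let T : Matrix (Fin N) (Fin d) K →ₗ[K] (κ → K) :=
      { toFun := fun φ x => (p x.1 * φ * w x.1) x.2.1.1 x.2.1.2
        map_add' := by
          intro a b; ext x; simp [Matrix.mul_add, Matrix.add_mul]
        map_smul' := by
          intro c a; ext x; simp }
    have hinj : Function.Injective T := by
      rw [← LinearMap.ker_eq_bot, ← hbot]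
      ext φ
      constructor
      · intro h k t j ht
        exact congrFun h ⟨k, ⟨(t, j), ht⟩⟩
      · intro h
        ext x
        exact h x.1 x.2.1.1 x.2.1.2 x.2.2
    have hcard : Fintype.card κ ≤ d * N := by
      have h1 := hS d 1 1 w w' (fun _ => 1) (fun _ => id) (Matrix.mul_one _) hw
        (fun _ => strictMono_id) (by simp) (by
          intro k f j h; exact Matrix.one_apply_ne (ne_of_lt h))
      refine le_trans ?_ h1
      rw [Fintype.card_sigma]
      refine Finset.sum_le_sum fun k _ => ?_
      rw [Fintype.card_subtype, Finset.card_eq_sum_card_fiberwise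
        (f := Prod.snd) (t := Finset.univ) (by intro _ _; simp)]
      refine Finset.sum_le_sum fun j _ => ?_
      calc _ ≤ (Finset.range (m k j)).card := by
            apply Finset.card_le_card_of_injOn (fun x => (x.1 : ℕ))
            · intro x hx
              simp only [Finset.coe_filter, Finset.mem_filter, Finset.mem_univ, true_and,
                Set.mem_ofPred_eq] at hx
              simpa [← hx.2] using hx.1
            · intro x hx x' hx' h
              simp only [Finset.coe_filter, Finset.mem_filter, Finset.mem_univ, true_and,
                Set.mem_ofPred_eq] at hx hx'
              exact Prod.ext (Fin.ext h) (hx.2.trans hx'.2.symm)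
        _ = m k j := Finset.card_range _
    have hfin : Module.finrank K (Matrix (Fin N) (Fin d) K) = Module.finrank K (κ → K) := by
      apply le_antisymm (LinearMap.finrank_le_finrank_of_injective hinj)
      rw [Module.finrank_fintype_fun_eq_card, Module.finrank_matrix]
      simpa [mul_comm] using hcard
    have hsurj := (LinearMap.injective_iff_surjective_of_finrank_eq_finrank hfin).1 hinj
    intro τ
    obtain ⟨φ, hφ⟩ := hsurj (fun x => τ x.1 x.2.1.1 x.2.1.2)
    exact ⟨φ, fun k t j ht => congrFun hφ ⟨k, ⟨(t, j), ht⟩⟩⟩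
  · let S : Submodule K (Fin d → K) :=
      ⨅ φ : incHom w p m, LinearMap.ker (φ : Matrix (Fin N) (Fin d) K).mulVecLin
    have hSmem : ∀ x, x ∈ S ↔ ∀ φ ∈ incHom w p m, φ *ᵥ x = 0 := by
      intro x; simp [S, Submodule.mem_iInf]
    have hS_ne_top : S ≠ ⊤ := by
      intro h
      apply hbot
      rw [Submodule.eq_bot_iff]
      intro φ hφ
      apply Matrix.ext_of_mulVec_single
      intro j
      rw [(hSmem _).1 (h ▸ Submodule.mem_top) φ hφ, zero_mulVec]
    obtain ⟨e, Q, P, hPS, hQ1, hQ2, he⟩ := exists_frame S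
    have hed := he hS_ne_top
    have hφQ : ∀ φ ∈ incHom w p m, φ * Q = 0 := by
      intro φ hφ
      apply Matrix.ext_of_mulVec_single
      intro j
      rw [← mulVec_mulVec, zero_mulVec]
      exact (hSmem _).1 (hQ1 _) φ hφ
    have hQX : ∀ X : Matrix (Fin d) (Fin e) K, (∀ φ ∈ incHom w p m, φ * X = 0) →
        Q * (P * X) = X := by
      intro X hX
      apply Matrix.ext_of_mulVec_single
      intro j
      rw [← mulVec_mulVec, ← mulVec_mulVec]
      apply hQ2
      rw [hSmem]
      intro φ hφ
      rw [mulVec_mulVec, hX φ hφ, zero_mulVec]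
    have hleft : ∀ k, (P * w k) * (w' k * Q) = 1 := by
      intro k
      rw [Matrix.mul_assoc, ← Matrix.mul_assoc (w k), hw, Matrix.one_mul, hPS]
    choose F hF c c' hc hy1 hy2 using fun k => exists_echelon _ _ (hleft k)
    have hc2 : ∀ k, c' k * c k = 1 := fun k => mul_eq_one_comm.1 (hc k)
    set y : Fin 3 → Matrix (Fin d) (Fin e) K := fun k => w' k * Q * c k with hy
    have hwy : ∀ k, Q * c k = w k * y k := by
      intro k
      simp only [hy]
      rw [← Matrix.mul_assoc, ← Matrix.mul_assoc, hw, Matrix.one_mul]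
    have hy1' : ∀ k i j, y k (F k i) j = (1 : Matrix (Fin e) (Fin e) K) i j := hy1
    have hy2' : ∀ k f j, f < F k j → y k f j = 0 := hy2
    have hyrow : ∀ k (β : Matrix (Fin e) (Fin e) K) i j, (y k * β) (F k i) j = β i j := by
      intro k β i j
      have : (y k * β) (F k i) j = ((1 : Matrix (Fin e) (Fin e) K) * β) i j := by
        rw [mul_apply, mul_apply]
        exact Finset.sum_congr rfl fun x _ => by rw [hy1']
      rw [this, Matrix.one_mul]
    have hsurj' : IncSurj c p (fun k => m k ∘ F k) := by
      apply ih e hed c c' _ hc (fun k => (hm k).comp (hF k).monotone)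
      · intro ξ' η
        obtain ⟨D0, M0, b0, hb0, hw0, hp0⟩ := hG (fun _ => 0) η
        let z : Fin 3 → Matrix (Fin e) (Fin e) K := fun k => (ξ' k * c k - (c k).map D0) * c' k
        have hz : ∀ k, z k * c k = ξ' k * c k - (c k).map D0 := by
          intro k
          simp only [z]
          rw [Matrix.mul_assoc, hc2, Matrix.mul_one]
        obtain ⟨D1, M1, b1, hb1, hw1, hp1⟩ := hG (fun k => Q * z k * P) (fun _ => 0)
        have hstab : ∀ φ ∈ incHom w p m, φ.map D1 + φ * M1 ∈ incHom w p m := by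
          intro φ hφ k t j ht
          have := incHom_derivation hm hb1 hw1 hp1 hφ k t j ht
          have e1 : φ * (Q * z k * P) = 0 := by
            rw [← Matrix.mul_assoc, ← Matrix.mul_assoc, hφQ φ hφ, Matrix.zero_mul,
              Matrix.zero_mul]
          rw [e1] at this
          simpa using this
        let M' := P * (Q.map D1 - M1 * Q)
        have hDQ : Q * M' = Q.map D1 - M1 * Q := by
          apply hQX
          intro φ hφ
          have h1 := hφQ _ (hstab φ hφ)
          have h2 : (φ * Q).map D1 = 0 := by rw [hφQ φ hφ]; ext; simp
          rw [map_derivation_mul] at h2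
          rw [Matrix.add_mul] at h1
          rw [Matrix.mul_sub, ← Matrix.mul_assoc]
          rw [eq_neg_of_add_eq_zero_right h2, eq_neg_of_add_eq_zero_right h1]
          simp
        let β : Fin 3 → Matrix (Fin e) (Fin e) K := fun k =>
          c' k * (M' * c k + (c k).map D1 - z k * c k)
        have hcβ : ∀ k, c k * β k = M' * c k + (c k).map D1 - z k * c k := by
          intro k
          simp only [β]
          rw [← Matrix.mul_assoc, hc, Matrix.one_mul]
        have hβ : ∀ k, b1 k * y k + (y k).map D1 = y k * β k := by
          intro k
          have h1 := congrArg (fun A => A.map D1) (hwy k)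
          simp only [map_derivation_mul, hw1] at h1
          have h2 : Q.map D1 = Q * M' + M1 * Q := by rw [hDQ]; abel
          have h3 : w k * (b1 k * y k + (y k).map D1) = w k * (y k * β k) := by
            have e1 : w k * (y k * β k) = Q * (M' * c k + (c k).map D1 - z k * c k) := by
              rw [← Matrix.mul_assoc, ← hwy, Matrix.mul_assoc, hcβ]
            have e2 : Q * z k * P * (w k * y k) = Q * (z k * c k) := by
              rw [← hwy]
              simp only [Matrix.mul_assoc]
              rw [← Matrix.mul_assoc P, hPS, Matrix.one_mul]
            have e3 : M1 * (w k * y k) = M1 * Q * c k := by rw [← hwy, Matrix.mul_assoc]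
            rw [e1]
            rw [h2] at h1
            have h4 : w k * (b1 k * y k + (y k).map D1) =
                (((Q * z k * P + M1) * w k + w k * b1 k) * y k + w k * (y k).map D1)
                - Q * z k * P * (w k * y k) - M1 * (w k * y k) := by
              simp only [Matrix.mul_add, Matrix.add_mul, Matrix.mul_assoc]
              abel
            rw [h4, ← h1, e2, e3]
            simp only [Matrix.mul_add, Matrix.add_mul, Matrix.mul_sub, Matrix.mul_assoc]
            abel
          have h5 := congrArg (fun A => w' k * A) h3
          simp only [← Matrix.mul_assoc (w' k), hw2, Matrix.one_mul] at h5
          exact h5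
        refine ⟨D0 + D1, -M', β, ?_, ?_, ?_⟩
        · intro k i j hij
          have h1 := congrFun (congrFun (hβ k) (F k i)) j
          rw [hyrow, Matrix.add_apply, map_apply, hy1'] at h1
          rw [← h1]
          have h2 : D1 ((1 : Matrix (Fin e) (Fin e) K) i j) = 0 := by
            rw [Matrix.one_apply_ne (ne_of_lt hij), map_zero]
          rw [h2, add_zero, mul_apply]
          refine Finset.sum_eq_zero fun f _ => ?_
          rcases lt_or_ge (F k i) f with h | h
          · rw [hb1 k _ _ h, zero_mul]
          · rw [hy2' k f j (lt_of_le_of_lt h (hF k hij)), mul_zero]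
        · intro k
          have e1 : (c k).map (D0 + D1 : Derivation ℤ K K) = (c k).map D0 + (c k).map D1 := by
            ext; simp
          rw [e1, hcβ, hz]
          simp only [Matrix.add_mul, Matrix.neg_mul]
          abel
        · intro k
          have e1 : (p k).map (D0 + D1 : Derivation ℤ K K) = (p k).map D0 + (p k).map D1 := by
            ext; simp
          rw [e1, hp0, hp1]
          simp
      · intro e' Q₂ P₂ c₂ c₂' y₂ F₂ hP₂ hc₂ hF₂ hy₂ hpat
        refine hS e' (Q * Q₂) (P₂ * P) c₂ c₂' (fun k => y k * y₂ k) (fun k => F k ∘ F₂ k)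
          ?_ hc₂ (fun k => (hF k).comp (hF₂ k)) ?_ ?_
        · rw [Matrix.mul_assoc, ← Matrix.mul_assoc P, hPS, Matrix.one_mul, hP₂]
        · intro k
          rw [Matrix.mul_assoc, hy₂, ← Matrix.mul_assoc, hwy, Matrix.mul_assoc]
        · intro k f j hfj
          rw [mul_apply]
          refine Finset.sum_eq_zero fun i _ => ?_
          rcases lt_or_ge f (F k i) with h | h
          · rw [hy2' k f i h, zero_mul]
          · rw [hpat k i j, mul_zero]
            by_contra h'
            exact absurd hfj (not_lt.2 (le_trans ((hF k).monotone (not_lt.1 h')) h))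
    have hslot : ∀ (k : Fin 3) (θ : Matrix (Fin N) (Fin d) K), θ * Q = 0 →
        ∃ φ : Matrix (Fin N) (Fin d) K, ∀ l (t : Fin N) j, (t : ℕ) < m l j →
          (p l * φ * w l) t j = if l = k then (p l * θ * w l) t j else 0 := by
      intro k θ hθ
      obtain ⟨h, φ, hφ⟩ := Submodule.fg_iff_exists_fin_generating_family.1
        (IsNoetherian.noetherian (incHom w p m))
      have hφm : ∀ a, φ a ∈ incHom w p m := fun a => by
        rw [← hφ]; exact Submodule.subset_span ⟨a, rfl⟩
      obtain ⟨X, hX⟩ := exists_sum_mul_of_ker φ θ (by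
        intro x hx
        have hxS : x ∈ S := by
          rw [hSmem]
          intro ψ hψ
          rw [← hφ] at hψ
          induction hψ using Submodule.span_induction with
          | mem _ h => obtain ⟨a, rfl⟩ := h; exact hx a
          | zero => simp
          | add _ _ _ _ h1 h2 => rw [add_mulVec, h1, h2, add_zero]
          | smul _ _ _ h1 => rw [smul_mulVec, h1, smul_zero]
        rw [← hQ2 x hxS, mulVec_mulVec, hθ, zero_mulVec])
      have hone : ∀ a, ∃ ψ : Matrix (Fin N) (Fin d) K, ∀ l (t : Fin N) j, (t : ℕ) < m l j →
          (p l * ψ * w l) t j = if l = k then (p l * (X a * φ a) * w l) t j else 0 := by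
        intro a
        obtain ⟨D, M, b, hb, hwD, hpD⟩ := hG (fun _ => 0) (fun l => if l = k then X a else 0)
        refine ⟨-((φ a).map D + φ a * M), fun l t j ht => ?_⟩
        have := incHom_derivation hm hb hwD hpD (hφm a) l t j ht
        rw [Matrix.mul_neg, Matrix.neg_mul, Matrix.neg_apply, neg_eq_of_add_eq_zero_right this]
        by_cases hl : l = k <;> simp [hl]
      choose ψ hψ using hone
      refine ⟨∑ a, ψ a, fun l t j ht => ?_⟩
      rw [hX, Matrix.mul_sum, Matrix.sum_mul, Matrix.mul_sum, Matrix.sum_mul, Matrix.sum_apply, Matrix.sum_apply,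
        Finset.sum_congr rfl fun a _ => hψ a l t j ht]
      split_ifs <;> simp
    intro τ
    obtain ⟨ψ, hψ⟩ := hsurj' (fun k => τ k * y k)
    let φ0 := ψ * P
    let Δ : Fin 3 → Matrix (Fin N) (Fin d) K := fun k => τ k - p k * φ0 * w k
    have hΔy : ∀ k (t : Fin N) i, (t : ℕ) < m k (F k i) → (Δ k * y k) t i = 0 := by
      intro k t i ht
      have e1 : Δ k * y k = τ k * y k - p k * ψ * c k := by
        simp only [Δ, φ0]
        rw [Matrix.sub_mul, Matrix.mul_assoc _ (w k), ← hwy]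
        simp only [Matrix.mul_assoc]
        rw [← Matrix.mul_assoc P, hPS, Matrix.one_mul]
      rw [e1, Matrix.sub_apply, hψ k t i ht, sub_self]
    let E : Fin 3 → Matrix (Fin e) (Fin d) K := fun k => of fun i j => if F k i = j then 1 else 0
    have hEy : ∀ k, E k * y k = 1 := by
      intro k
      ext i j
      rw [mul_apply, Finset.sum_eq_single (F k i)]
      · simp [E, hy1']
      · intro f _ hf
        simp [E, Ne.symm hf]
      · simp
    let Δ' : Fin 3 → Matrix (Fin N) (Fin d) K := fun k => Δ k - Δ k * y k * E k
    have hΔ'y : ∀ k, Δ' k * y k = 0 := by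
      intro k
      simp only [Δ']
      rw [Matrix.sub_mul, Matrix.mul_assoc _ (E k), hEy, Matrix.mul_one, sub_self]
    have hΔ' : ∀ k (t : Fin N) j, (t : ℕ) < m k j → Δ' k t j = Δ k t j := by
      intro k t j ht
      simp only [Δ', Matrix.sub_apply, sub_eq_self]
      rw [mul_apply]
      refine Finset.sum_eq_zero fun i _ => ?_
      by_cases h : F k i = j
      · rw [hΔy k t i (by rw [h]; exact ht), zero_mul]
      · simp [E, h]
    choose φ hφ using fun k => hslot k (p' k * Δ' k * w' k) (by
      have : w' k * Q = y k * c' k := by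
        simp only [hy]
        rw [Matrix.mul_assoc _ (c k), hc, Matrix.mul_one]
      rw [Matrix.mul_assoc, this, Matrix.mul_assoc, ← Matrix.mul_assoc (Δ' k), hΔ'y,
        Matrix.zero_mul, Matrix.mul_zero])
    refine ⟨φ0 + ∑ k, φ k, fun l t j ht => ?_⟩
    rw [Matrix.mul_add, Matrix.add_mul, Matrix.mul_sum, Matrix.sum_mul, Matrix.add_apply, Matrix.sum_apply,
      Finset.sum_congr rfl fun k _ => hφ k l t j ht]
    have e1 : p l * (p' l * Δ' l * w' l) * w l = Δ' l := by
      simp only [Matrix.mul_assoc]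
      rw [hw2, Matrix.mul_one, ← Matrix.mul_assoc, hp, Matrix.one_mul]
    rw [Finset.sum_ite_eq, if_pos (Finset.mem_univ _), e1, hΔ' l t j ht]
    simp [Δ]

end Derivations

section Dominance

open MvPolynomial

theorem exists_eval_ne_zero {τ : Type*} [Finite τ] {Q : MvPolynomial τ ℂ} (hQ : Q ≠ 0)
    {U : Set (τ → ℂ)} (hU : IsOpen U) (hne : U.Nonempty) : ∃ x ∈ U, eval x Q ≠ 0 := by
  have := Fintype.ofFinite τ
  by_contra! hcon
  obtain ⟨x, hx⟩ := hne
  obtain ⟨ε, hε, hball⟩ := Metric.isOpen_iff.1 hU x hx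
  apply hQ
  refine funext_set (fun i => Metric.ball (x i) ε) (fun i => ?_) fun z hz => ?_
  · exact infinite_of_mem_nhds (x i) (Metric.ball_mem_nhds _ hε)
  · rw [map_zero]
    refine hcon z (hball ?_)
    rw [Metric.mem_ball, dist_pi_lt_iff hε]
    exact fun i => hz i trivial

theorem exists_basicOpen_subset_range {A B : Type*} [CommRing A] [IsDomain A] [IsNoetherianRing A]
    [CommRing B] [IsDomain B] {φ : A →+* B} (hφ : Function.Injective φ) (hft : φ.FiniteType) :
    ∃ Q : A, Q ≠ 0 ∧ ∀ 𝔭 : PrimeSpectrum A, Q ∉ 𝔭.asIdeal →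
      ∃ 𝔮 : PrimeSpectrum B, PrimeSpectrum.comap φ 𝔮 = 𝔭 := by
  have hc := PrimeSpectrum.isConstructible_range_comap
    (RingHom.FinitePresentation.of_finiteType.1 hft)
  obtain ⟨S, hS⟩ := PrimeSpectrum.exists_constructibleSetData_iff.2 hc
  let η : PrimeSpectrum A := ⟨⊥, Ideal.isPrime_bot⟩
  have hη : η ∈ S.toSet := by
    rw [hS]
    refine ⟨⟨⊥, Ideal.isPrime_bot⟩, ?_⟩
    ext a
    simp [η, map_eq_zero_iff φ hφ]
  simp only [PrimeSpectrum.ConstructibleSetData.toSet, Set.mem_iUnion] at hη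
  obtain ⟨D, hD, hηD⟩ := hη
  simp only [PrimeSpectrum.BasicConstructibleSetData.toSet, Set.mem_sdiff,
    PrimeSpectrum.mem_zeroLocus] at hηD
  refine ⟨D.f, fun h0 => hηD.2 (by simp [h0]), fun 𝔭 h𝔭 => ?_⟩
  have : 𝔭 ∈ S.toSet := by
    simp only [PrimeSpectrum.ConstructibleSetData.toSet, Set.mem_iUnion]
    refine ⟨D, hD, ?_⟩
    simp only [PrimeSpectrum.BasicConstructibleSetData.toSet, Set.mem_sdiff,
      PrimeSpectrum.mem_zeroLocus]
    refine ⟨fun a ha => ?_, by simpa using h𝔭⟩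
    have : a = 0 := by simpa [η] using hηD.1 ha
    simp [this]
  rw [hS] at this
  exact this

theorem dense_range_eval {σ τ : Type*} [Finite σ] [Finite τ] (f : τ → MvPolynomial σ ℂ)
    (h : (interior (Set.range fun x i => eval x (f i))).Nonempty) {U : Set (τ → ℂ)}
    (hU : IsOpen U) (hne : U.Nonempty) : ∃ x, (fun i => eval x (f i)) ∈ U := by
  let φ : MvPolynomial τ ℂ →ₐ[ℂ] MvPolynomial σ ℂ := aeval f
  have hev : ∀ x Q, eval x (φ Q) = eval (fun i => eval x (f i)) Q := by
    intro x Q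
    induction Q using MvPolynomial.induction_on with
    | C a => simp [φ]
    | add p q hp hq => simp only [map_add, hp, hq]
    | mul_X p i hp => simp only [map_mul, hp, eval_X]; simp [φ]
  have hinj : Function.Injective φ := by
    rw [injective_iff_map_eq_zero]
    intro Q hQ
    by_contra hQ0
    obtain ⟨g, hg, hgQ⟩ := exists_eval_ne_zero hQ0 isOpen_interior h
    obtain ⟨x, rfl⟩ := interior_subset hg
    apply hgQ
    rw [← hev, hQ, map_zero]
  have hft : (φ : MvPolynomial τ ℂ →+* MvPolynomial σ ℂ).FiniteType :=
    RingHom.FiniteType.of_comp_finiteType (f := algebraMap ℂ (MvPolynomial τ ℂ)) (by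
      rw [AlgHom.comp_algebraMap]
      exact (RingHom.finiteType_algebraMap).2 inferInstance)
  obtain ⟨Q, hQ0, hQ⟩ := exists_basicOpen_subset_range hinj hft
  obtain ⟨g, hg, hgQ⟩ := exists_eval_ne_zero hQ0 hU hne
  obtain ⟨𝔮, h𝔮⟩ := hQ ⟨RingHom.ker (eval g), RingHom.ker_isPrime _⟩ (by simpa using hgQ)
  have hzl : (zeroLocus ℂ 𝔮.asIdeal).Nonempty := by
    by_contra hemp
    rw [Set.not_nonempty_iff_eq_empty] at hemp
    have := MvPolynomial.IsPrime.vanishingIdeal_zeroLocus (K := ℂ) 𝔮.asIdeal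
    rw [hemp, vanishingIdeal_empty] at this
    exact 𝔮.2.ne_top this.symm
  obtain ⟨x, hx⟩ := hzl
  refine ⟨x, ?_⟩
  convert hg using 1
  ext i
  have h1 : X i - C (g i) ∈ (PrimeSpectrum.comap φ.toRingHom 𝔮).asIdeal := by
    rw [h𝔮]; simp
  rw [PrimeSpectrum.comap_asIdeal, Ideal.mem_comap] at h1
  have := (mem_zeroLocus_iff.1 hx) _ h1
  simpa [φ, sub_eq_zero] using this

end Dominance

section Specialization

open MvPolynomial

variable {σ : Type} {K : Type} [Field K] [Algebra (MvPolynomial σ ℂ) K]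
  [IsFractionRing (MvPolynomial σ ℂ) K]

theorem exists_specialization {ι : Type*} [Finite ι] (a : ι → K) :
    ∃ δ : MvPolynomial σ ℂ, δ ≠ 0 ∧ ∀ x, eval x δ ≠ 0 → ∃ (L : Type) (_ : CommRing L)
      (i : L →+* K) (e : L →+* ℂ), Function.Injective i ∧
      (∀ j, ∃ l, i l = a j) ∧ ∀ r, ∃ l, i l = algebraMap _ _ r ∧ e l = eval x r := by
  obtain ⟨δ, hδ⟩ := IsLocalization.exist_integer_multiples_of_finite
    (nonZeroDivisors (MvPolynomial σ ℂ)) a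
  refine ⟨δ, nonZeroDivisors.coe_ne_zero δ, fun x hx => ?_⟩
  have hδ0 : (δ : MvPolynomial σ ℂ) ≠ 0 := nonZeroDivisors.coe_ne_zero δ
  have hle : Submonoid.powers (δ : MvPolynomial σ ℂ) ≤ nonZeroDivisors _ :=
    powers_le_nonZeroDivisors_of_noZeroDivisors hδ0
  let L := Localization.Away (δ : MvPolynomial σ ℂ)
  let i : L →+* K :=
    IsLocalization.lift (M := Submonoid.powers (δ : MvPolynomial σ ℂ)) (g := algebraMap _ _)
      fun y => IsLocalization.map_units K
        (⟨(y : MvPolynomial σ ℂ), hle y.2⟩ : nonZeroDivisors (MvPolynomial σ ℂ))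
  let e : L →+* ℂ := IsLocalization.Away.lift (δ : MvPolynomial σ ℂ) (g := eval x)
    (isUnit_iff_ne_zero.2 hx)
  have hi : ∀ r, i (algebraMap _ _ r) = algebraMap _ _ r := fun r => IsLocalization.lift_eq _ _
  refine ⟨L, inferInstance, i, e, ?_, ?_, ?_⟩
  · rw [injective_iff_map_eq_zero]
    intro l hl
    obtain ⟨⟨r, s⟩, hrs⟩ := IsLocalization.surj (Submonoid.powers (δ : MvPolynomial σ ℂ)) l
    have : algebraMap _ K r = 0 := by
      rw [← hi, ← hrs, map_mul, hl, zero_mul]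
    have hr : r = 0 := by simpa only [map_eq_zero_iff _ (IsFractionRing.injective (MvPolynomial σ ℂ) K)] using this
    have hu := IsLocalization.map_units L s
    simp only [hr, map_zero] at hrs
    exact hu.mul_left_eq_zero.1 hrs
  · intro j
    obtain ⟨r, hr⟩ := hδ j
    refine ⟨IsLocalization.mk' L r ⟨δ, Submonoid.mem_powers _⟩, ?_⟩
    have hne : algebraMap _ K (δ : MvPolynomial σ ℂ) ≠ 0 := by
      simp
    have h1 := IsLocalization.mk'_spec L r
      (⟨δ, Submonoid.mem_powers _⟩ : Submonoid.powers (δ : MvPolynomial σ ℂ))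
    apply_fun i at h1
    rw [map_mul, hi, hi, hr, Algebra.smul_def, mul_comm] at h1
    exact mul_left_cancel₀ hne h1
  · exact fun r => ⟨algebraMap _ _ r, hi r, IsLocalization.Away.lift_eq _ _ _⟩

theorem exists_derivation (f : σ → K) : ∃ D : Derivation ℤ K K, ∀ i, D (algebraMap (MvPolynomial σ ℂ) K (X i)) = f i := by
  let g : MvPolynomial σ ℂ →+* TrivSqZeroExt K K :=
    eval₂Hom ((TrivSqZeroExt.inlHom K K).comp ((algebraMap (MvPolynomial σ ℂ) K).comp C))
      fun i => TrivSqZeroExt.inl (algebraMap (MvPolynomial σ ℂ) K (X i)) + TrivSqZeroExt.inr (f i)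
  have hg : ∀ r, (g r).fst = algebraMap _ K r := by
    intro r
    induction r using MvPolynomial.induction_on with
    | C a => simp [g]
    | add p q hp hq => rw [map_add, TrivSqZeroExt.fst_add, hp, hq, map_add]
    | mul_X p i hp =>
      rw [map_mul, TrivSqZeroExt.fst_mul, hp, map_mul]
      simp [g]
  have hu : ∀ y : nonZeroDivisors (MvPolynomial σ ℂ), IsUnit (g y) := by
    intro y
    rw [TrivSqZeroExt.isUnit_iff_isUnit_fst, hg]
    exact IsLocalization.map_units K y
  let G : K →+* TrivSqZeroExt K K := IsLocalization.lift hu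
  have hG : ∀ r, G (algebraMap _ _ r) = g r := fun r => IsLocalization.lift_eq hu r
  have hG1 : ∀ z, (G z).fst = z := by
    intro z
    have : ((TrivSqZeroExt.fstHom K K K : TrivSqZeroExt K K →ₐ[K] K) :
        TrivSqZeroExt K K →+* K).comp G = RingHom.id K := by
      refine IsLocalization.ringHom_ext (nonZeroDivisors (MvPolynomial σ ℂ)) (RingHom.ext fun r => ?_)
      simp [hG, hg]
    exact congrArg (fun h => h z) this
  refine ⟨Derivation.mk' (AddMonoidHom.toIntLinearMap
    { toFun := fun z => (G z).snd
      map_zero' := by rw [map_zero, TrivSqZeroExt.snd_zero]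
      map_add' := fun a b => by rw [map_add, TrivSqZeroExt.snd_add] }) ?_, ?_⟩
  · intro a b
    change (G (a * b)).snd = a • (G b).snd + b • (G a).snd
    rw [map_mul, TrivSqZeroExt.snd_mul, hG1, hG1]
    simp [mul_comm]
  · intro i
    change (G (algebraMap (MvPolynomial σ ℂ) K (X i))).snd = f i
    rw [hG]
    simp [g]

end Specialization

section GenericPoint

open MvPolynomial

/-- Indices for the entries of three `r × r` and three `N × N` matrices. -/
abbrev IncIdx (r N : ℕ) : Type := (Fin 3 × Fin r × Fin r) ⊕ (Fin 3 × Fin N × Fin N)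

variable {r N : ℕ} {K : Type} [Field K] [Algebra (MvPolynomial (IncIdx r N) ℂ) K]
  [IsFractionRing (MvPolynomial (IncIdx r N) ℂ) K]

variable (r N K) in
/-- The generic `r × r` matrices. -/
noncomputable def genericW (k : Fin 3) : Matrix (Fin r) (Fin r) K :=
  of fun i j => algebraMap (MvPolynomial (IncIdx r N) ℂ) K (X (Sum.inl (k, i, j)))

variable (r N K) in
/-- The generic `N × N` matrices. -/
noncomputable def genericP (k : Fin 3) : Matrix (Fin N) (Fin N) K :=
  of fun i j => algebraMap (MvPolynomial (IncIdx r N) ℂ) K (X (Sum.inr (k, i, j)))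

theorem det_generic_ne_zero {n : ℕ} {σ : Type} {K : Type} [Field K] [Algebra (MvPolynomial σ ℂ) K]
    [IsFractionRing (MvPolynomial σ ℂ) K] (f : Fin n × Fin n → σ) (hf : Function.Injective f) :
    (of fun i j => algebraMap (MvPolynomial σ ℂ) K (X (f (i, j)))).det ≠ 0 := by
  classical
  have h1 : (of fun i j => algebraMap (MvPolynomial σ ℂ) K (X (f (i, j)))) =
      (algebraMap (MvPolynomial σ ℂ) K).mapMatrix (of fun i j => X (f (i, j))) := rfl
  rw [h1, ← RingHom.map_det, Ne, map_eq_zero_iff _ (IsFractionRing.injective (MvPolynomial σ ℂ) K)]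
  intro h0
  let x : σ → ℂ := Function.extend f (fun ij => (1 : Matrix (Fin n) (Fin n) ℂ) ij.1 ij.2) 0
  have h2 := congrArg (eval x) h0
  rw [RingHom.map_det, map_zero] at h2
  have h3 : (eval x).mapMatrix (of fun i j => X (f (i, j)) : Matrix (Fin n) (Fin n) _) = 1 := by
    ext i j
    simp [x, hf.extend_apply]
  rw [h3, det_one] at h2
  exact one_ne_zero h2

theorem incGeneric_generic : IncGeneric (genericW r N K) (genericP r N K) := by
  intro ξ η
  obtain ⟨D, hD⟩ := exists_derivation (σ := IncIdx r N) (K := K) (Sum.elim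
    (fun x => (ξ x.1 * genericW r N K x.1) x.2.1 x.2.2)
    (fun x => (genericP r N K x.1 * η x.1) x.2.1 x.2.2))
  refine ⟨D, 0, 0, fun _ _ _ _ => rfl, fun k => ?_, fun k => ?_⟩
  · ext i j
    simp [genericW, hD]
  · ext i j
    simp [genericP, hD]

/-- The point of affine space given by two triples of matrices, read backwards. -/
def matOfPoint {n : ℕ} {σ : Type} (f : Fin 3 × Fin n × Fin n → σ) (x : σ → ℂ) (k : Fin 3) :
    Matrix (Fin n) (Fin n) ℂ := of fun i j => x (f (k, i, j))

theorem incStable_generic {m : Fin 3 → Fin r → ℕ}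
    (h : ∀ (e : ℕ) (F : Fin 3 → Fin e → Fin r), (∀ k, StrictMono (F k)) → DenseInt r e F →
      ∑ k, ∑ j, m k (F k j) ≤ e * N) : IncStable N (genericW r N K) m := by
  intro e Q P c c' y F hPQ hc hF hQ hy
  refine h e F hF fun U hU hUne => ?_
  obtain ⟨δ, hδ, hspec⟩ := exists_specialization (σ := IncIdx r N) (K := K)
    (ι := (Fin r × Fin e) ⊕ (Fin e × Fin r) ⊕ (Fin 3 × Fin e × Fin e) ⊕ (Fin 3 × Fin e × Fin e) ⊕
      (Fin 3 × Fin r × Fin e))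
    (Sum.elim (fun x => Q x.1 x.2) <| Sum.elim (fun x => P x.1 x.2) <|
      Sum.elim (fun x => c x.1 x.2.1 x.2.2) <| Sum.elim (fun x => c' x.1 x.2.1 x.2.2) <|
      fun x => y x.1 x.2.1 x.2.2)
  have hcont : Continuous (matOfPoint (Sum.inl : _ → IncIdx r N)) := by
    unfold matOfPoint; fun_prop
  have hne' : (matOfPoint (Sum.inl : _ → IncIdx r N) ⁻¹' U).Nonempty := by
    obtain ⟨g, hg⟩ := hUne
    refine ⟨Sum.elim (fun x => g x.1 x.2.1 x.2.2) 0, ?_⟩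
    exact hg
  obtain ⟨x, hxU, hx⟩ := exists_eval_ne_zero hδ (hU.preimage hcont) hne'
  obtain ⟨L, _, i, ev, hi, hl, hX⟩ := hspec x hx
  choose l hl using hl
  choose X' hX1 hX2 using hX
  let Ql : Matrix (Fin r) (Fin e) L := of fun a b => l (.inl (a, b))
  let Pl : Matrix (Fin e) (Fin r) L := of fun a b => l (.inr <| .inl (a, b))
  let cl : Fin 3 → Matrix (Fin e) (Fin e) L := fun k => of fun a b => l (.inr <| .inr <| .inl (k, a, b))
  let cl' : Fin 3 → Matrix (Fin e) (Fin e) L :=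
    fun k => of fun a b => l (.inr <| .inr <| .inr <| .inl (k, a, b))
  let yl : Fin 3 → Matrix (Fin r) (Fin e) L :=
    fun k => of fun a b => l (.inr <| .inr <| .inr <| .inr (k, a, b))
  let wl : Fin 3 → Matrix (Fin r) (Fin r) L := fun k => of fun a b => X' (X (Sum.inl (k, a, b)))
  have hQl : Ql.map i = Q := by ext a b; simp [Ql, hl]
  have hPl : Pl.map i = P := by ext a b; simp [Pl, hl]
  have hcl : ∀ k, (cl k).map i = c k := by intro k; ext a b; simp [cl, hl]
  have hcl' : ∀ k, (cl' k).map i = c' k := by intro k; ext a b; simp [cl', hl]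
  have hyl : ∀ k, (yl k).map i = y k := by intro k; ext a b; simp [yl, hl]
  have hwl : ∀ k, (wl k).map i = genericW r N K k := by intro k; ext a b; simp [wl, hX1, genericW]
  have hwe : ∀ k, (wl k).map ev = matOfPoint (Sum.inl : _ → IncIdx r N) x k := by
    intro k; ext a b; simp [wl, hX2, matOfPoint]
  refine ⟨_, hxU, Ql.map ev, Pl.map ev, fun k => (cl k).map ev, fun k => (cl' k).map ev,
    fun k => (yl k).map ev, ?_, fun k => ?_, fun k => ?_, fun k f j hfj => ?_⟩
  · have : Pl * Ql = 1 := by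
      apply Matrix.map_injective hi
      simp only [Matrix.map_mul, hPl, hQl, hPQ, map_zero, map_one, Matrix.map_one]
    rw [← Matrix.map_mul, this, Matrix.map_one _ (map_zero _) (map_one _)]
  · have : cl k * cl' k = 1 := by
      apply Matrix.map_injective hi
      simp only [Matrix.map_mul, hcl, hcl', hc, map_zero, map_one, Matrix.map_one]
    rw [← Matrix.map_mul, this, Matrix.map_one _ (map_zero _) (map_one _)]
  · have : Ql * cl k = wl k * yl k := by
      apply Matrix.map_injective hi
      simp only [Matrix.map_mul, hcl, hQl, hwl, hyl, hQ]
    rw [← Matrix.map_mul, this, Matrix.map_mul, hwe]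
  · have : yl k f j = 0 := by
      apply hi
      have := congrFun (congrFun (hyl k) f) j
      rw [map_zero, ← hy k f j hfj, ← this, map_apply]
    simp [this]

theorem exists_incSurj {m : Fin 3 → Fin r → ℕ} (hm : ∀ k, Monotone (m k))
    (h : ∀ (e : ℕ) (F : Fin 3 → Fin e → Fin r), (∀ k, StrictMono (F k)) → DenseInt r e F →
      ∑ k, ∑ j, m k (F k j) ≤ e * N) :
    ∃ (w w' : Fin 3 → Matrix (Fin r) (Fin r) ℂ) (p p' : Fin 3 → Matrix (Fin N) (Fin N) ℂ),
      (∀ k, w k * w' k = 1) ∧ (∀ k, p k * p' k = 1) ∧ IncSurj w p m := by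
  classical
  let K := FractionRing (MvPolynomial (IncIdx r N) ℂ)
  have hw : ∀ k, genericW r N K k * (genericW r N K k)⁻¹ = 1 := fun k =>
    mul_nonsing_inv _ (isUnit_iff_ne_zero.2 (det_generic_ne_zero (fun ij => Sum.inl (k, ij))
      fun a b hab => by simpa using hab))
  have hp : ∀ k, genericP r N K k * (genericP r N K k)⁻¹ = 1 := fun k =>
    mul_nonsing_inv _ (isUnit_iff_ne_zero.2 (det_generic_ne_zero (fun ij => Sum.inr (k, ij))
      fun a b hab => by simpa using hab))
  have hS := incSurj_of_generic_of_stable r _ _ _ _ m hw hp hm incGeneric_generic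
    (incStable_generic h)
  choose φ hφ using fun b : Fin 3 × Fin N × Fin r =>
    hS (Pi.single b.1 (Matrix.single b.2.1 b.2.2 1))
  obtain ⟨δ, hδ, hspec⟩ := exists_specialization (σ := IncIdx r N) (K := K)
    (ι := (IncIdx r N) ⊕ ((Fin 3 × Fin N × Fin r) × Fin N × Fin r))
    (Sum.elim (Sum.elim (fun x => (genericW r N K x.1)⁻¹ x.2.1 x.2.2)
      fun x => (genericP r N K x.1)⁻¹ x.2.1 x.2.2) fun x => φ x.1 x.2.1 x.2.2)
  obtain ⟨x, -, hx⟩ := exists_eval_ne_zero hδ isOpen_univ Set.univ_nonempty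
  obtain ⟨L, _, i, ev, hi, hl, hX⟩ := hspec x hx
  choose l hl using hl
  choose X' hX1 hX2 using hX
  let wl : Fin 3 → Matrix (Fin r) (Fin r) L := fun k => of fun a b => X' (X (Sum.inl (k, a, b)))
  let pl : Fin 3 → Matrix (Fin N) (Fin N) L := fun k => of fun a b => X' (X (Sum.inr (k, a, b)))
  let wl' : Fin 3 → Matrix (Fin r) (Fin r) L := fun k => of fun a b => l (.inl <| .inl (k, a, b))
  let pl' : Fin 3 → Matrix (Fin N) (Fin N) L := fun k => of fun a b => l (.inl <| .inr (k, a, b))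
  let φl : Fin 3 × Fin N × Fin r → Matrix (Fin N) (Fin r) L :=
    fun k => of fun a b => l (.inr (k, a, b))
  have hwl : ∀ k, (wl k).map i = genericW r N K k := by intro k; ext a b; simp [wl, hX1, genericW]
  have hpl : ∀ k, (pl k).map i = genericP r N K k := by intro k; ext a b; simp [pl, hX1, genericP]
  have hwl' : ∀ k, (wl' k).map i = (genericW r N K k)⁻¹ := by
    intro k; ext a b; simp [wl', hl]
  have hpl' : ∀ k, (pl' k).map i = (genericP r N K k)⁻¹ := by
    intro k; ext a b; simp [pl', hl]
  have hφl : ∀ b, (φl b).map i = φ b := by intro k; ext a b; simp [φl, hl]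
  refine ⟨fun k => (wl k).map ev, fun k => (wl' k).map ev, fun k => (pl k).map ev,
    fun k => (pl' k).map ev, fun k => ?_, fun k => ?_, fun τ => ?_⟩
  · have : wl k * wl' k = 1 := by
      apply Matrix.map_injective hi
      simp only [Matrix.map_mul, hwl, hwl', hw, map_zero, map_one, Matrix.map_one]
    rw [← Matrix.map_mul, this, Matrix.map_one _ (map_zero _) (map_one _)]
  · have : pl k * pl' k = 1 := by
      apply Matrix.map_injective hi
      simp only [Matrix.map_mul, hpl, hpl', hp, map_zero, map_one, Matrix.map_one]
    rw [← Matrix.map_mul, this, Matrix.map_one _ (map_zero _) (map_one _)]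
  · refine ⟨∑ b, τ b.1 b.2.1 b.2.2 • (φl b).map ev, fun k t j htj => ?_⟩
    have key : ∀ b, ((pl k).map ev * (φl b).map ev * (wl k).map ev) t j =
        if b = (k, t, j) then 1 else 0 := by
      intro b
      have h1 : (pl k * φl b * wl k) t j = if b = (k, t, j) then 1 else 0 := by
        apply hi
        have := hφ b k t j htj
        rw [← hwl, ← hpl, ← hφl, ← Matrix.map_mul, ← Matrix.map_mul, map_apply] at this
        rw [this]
        obtain ⟨k', t', j'⟩ := b
        by_cases hk : k' = k
        · subst hk
          rw [Pi.single_eq_same]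
          by_cases hh : t' = t ∧ j' = j
          · obtain ⟨rfl, rfl⟩ := hh; simp
          · rw [Matrix.single_apply_of_ne _ _ _ _ _ hh, if_neg, map_zero]
            simpa using hh
        · rw [Pi.single_eq_of_ne (Ne.symm hk), if_neg, map_zero]
          · rfl
          · intro hh; exact hk (congrArg Prod.fst hh)
      rw [← Matrix.map_mul, ← Matrix.map_mul, map_apply, h1]
      split_ifs <;> simp
    simp only [Matrix.mul_sum, Matrix.sum_mul, Matrix.mul_smul, Matrix.smul_mul, Matrix.sum_apply,
      Matrix.smul_apply, key]
    simp
 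
end GenericPoint

section FlagMap

open MvPolynomial

/-- Coordinates for the parametrization of triples of flags in special position. -/
abbrev FlagIdx (r N : ℕ) : Type :=
  ((Fin r ⊕ Fin N) × Fin r) ⊕ (Fin 3 × Fin r × Fin r) ⊕ (Fin 3 × (Fin r ⊕ Fin N) × Fin N) ⊕
    (Fin 3 × (Fin r ⊕ Fin N) × (Fin r ⊕ Fin N))

/-- The projection to the first `r` coordinates. -/
def projL (r N : ℕ) (R : Type*) [CommRing R] : Matrix (Fin r) (Fin r ⊕ Fin N) R := fromCols 1 0

/-- The projection to the last `N` coordinates. -/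
def projR (r N : ℕ) (R : Type*) [CommRing R] : Matrix (Fin N) (Fin r ⊕ Fin N) R := fromCols 0 1

variable {r N : ℕ} (Lo : Fin 3 → (Fin r ⊕ Fin N) → (Fin r ⊕ Fin N) → Prop)

open Classical in
/-- The matrices whose first columns, up to the triangular matrices prescribed by `Lo`, span a
common subspace. -/
noncomputable def flagMap {R : Type*} [CommRing R] (x : FlagIdx r N → R) (k : Fin 3) :
    Matrix (Fin r ⊕ Fin N) (Fin r ⊕ Fin N) R :=
  ((of fun a b => x (.inl (a, b))) * (of fun a b => x (.inr <| .inl (k, a, b))) * projL r N R +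
    (of fun a b => x (.inr <| .inr <| .inl (k, a, b))) * projR r N R) *
    of fun a b => if Lo k a b then x (.inr <| .inr <| .inr (k, a, b)) else 0

theorem flagMap_map {R S : Type*} [CommRing R] [CommRing S] (f : R →+* S) (x : FlagIdx r N → R)
    (k : Fin 3) : (flagMap Lo x k).map f = flagMap Lo (f ∘ x) k := by
  classical
  have h1 : (projL r N R).map f = projL r N S := by
    ext i (j | j)
    · simp [projL, Matrix.one_apply]
    · simp [projL]
  have h2 : (projR r N R).map f = projR r N S := by
    ext i (j | j)
    · simp [projR]
    · simp [projR, Matrix.one_apply]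
  unfold flagMap
  rw [Matrix.map_mul, Matrix.map_add _ (map_add f), Matrix.map_mul, Matrix.map_mul, Matrix.map_mul,
    h1, h2]
  congr 1
  ext a b
  simp only [map_apply, of_apply]
  split_ifs <;> simp

theorem projL_mul_transpose : projL r N ℂ * (projL r N ℂ)ᵀ = 1 := by
  simp [projL, transpose_fromCols, fromCols_mul_fromRows]

theorem projR_mul_transpose : projR r N ℂ * (projR r N ℂ)ᵀ = 1 := by
  simp [projR, transpose_fromCols, fromCols_mul_fromRows]

theorem projL_mul_projR_transpose : projL r N ℂ * (projR r N ℂ)ᵀ = 0 := by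
  simp [projL, projR, transpose_fromCols, fromCols_mul_fromRows]

theorem projR_mul_projL_transpose : projR r N ℂ * (projL r N ℂ)ᵀ = 0 := by
  simp [projL, projR, transpose_fromCols, fromCols_mul_fromRows]

theorem projL_add_projR :
    (projL r N ℂ)ᵀ * projL r N ℂ + (projR r N ℂ)ᵀ * projR r N ℂ = 1 := by
  simp only [projL, projR, transpose_fromCols, fromRows_mul_fromCols]
  ext (i | i) (j | j) <;> simp [Matrix.one_apply]

theorem flag_expansion {s r N : Type*} [Fintype s] [Fintype r] [Fintype N] [DecidableEq s]
    [DecidableEq N] {L : Matrix r s ℂ} {R : Matrix N s ℂ} {L' : Matrix s r ℂ} {R' : Matrix s N ℂ}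
    (hLR : L * R' = 0) (hRR : R * R' = 1) (h1 : L' * L + R' * R = 1) {T : Matrix s s ℂ}
    {u : Matrix r r ℂ} {q : Matrix N N ℂ} {φ β : Matrix N r ℂ} (hq : q * β = R * T * L' - φ * u)
    (t : ℂ) :
    ((L' + t • (R' * φ)) * (u + t • (L * T * L')) * L + (R' * q + t • (T * R')) * R) *
      (1 + t • (R' * β * L)) = (L' * u * L + R' * q * R) * 1 + t • T +
        t ^ 2 • (R' * φ * (L * T * L') * L +
          (R' * φ * u * L + L' * (L * T * L') * L + T * R' * R) * (R' * β * L)) +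
        t ^ 3 • (R' * φ * (L * T * L') * L * (R' * β * L)) := by
  have hT : T = (R' * φ * u * L + L' * (L * T * L') * L + T * R' * R) +
      (L' * u * L + R' * q * R) * (R' * β * L) := by
    have h2 : (L' * u * L + R' * q * R) * (R' * β * L) = R' * (q * β) * L := by
      calc _ = L' * u * (L * R') * β * L + R' * q * (R * R') * β * L := by
            simp only [Matrix.add_mul, Matrix.mul_assoc]
        _ = _ := by rw [hLR, hRR]; simp [Matrix.mul_assoc]
    have h3 : T = (L' * L + R' * R) * T * (L' * L) + T * (R' * R) := by
      rw [h1, Matrix.one_mul, ← Matrix.mul_add, h1, Matrix.mul_one]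
    rw [h2, hq]
    nth_rewrite 1 [h3]
    simp only [Matrix.add_mul, Matrix.mul_sub, Matrix.sub_mul, Matrix.mul_assoc]
    abel
  have h4 : (L' + t • (R' * φ)) * (u + t • (L * T * L')) * L + (R' * q + t • (T * R')) * R =
      (L' * u * L + R' * q * R) + t • (R' * φ * u * L + L' * (L * T * L') * L + T * R' * R) +
      t ^ 2 • (R' * φ * (L * T * L') * L) := by
    simp only [Matrix.add_mul, Matrix.mul_add, Matrix.smul_mul, Matrix.mul_smul, smul_add,
      smul_smul, pow_two]
    abel
  rw [h4]
  generalize L' * u * L + R' * q * R = M at hT ⊢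
  generalize R' * φ * u * L + L' * (L * T * L') * L + T * R' * R = P at hT ⊢
  generalize R' * β * L = b at hT ⊢
  generalize R' * φ * (L * T * L') * L = P₂
  rw [hT]
  simp only [Matrix.add_mul, Matrix.mul_add, Matrix.smul_mul, Matrix.mul_smul, smul_add,
    Matrix.mul_one, smul_smul, pow_succ, pow_zero, one_mul, mul_assoc]
  abel

theorem interior_range_nonempty {σ τ : Type*} [Finite σ] [Finite τ] (f : τ → MvPolynomial σ ℂ)
    (x₀ : σ → ℂ) (h : ∀ T : τ → ℂ, ∃ (v : σ → ℂ) (c d : τ → ℂ), ∀ (t : ℂ) i,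
      eval (x₀ + t • v) (f i) = eval x₀ (f i) + t * T i + t ^ 2 * c i + t ^ 3 * d i) :
    (interior (Set.range fun x i => eval x (f i))).Nonempty := by
  have := Fintype.ofFinite σ
  have := Fintype.ofFinite τ
  let g : (σ → ℂ) → (τ → ℂ) := fun x i => eval x (f i)
  have han : AnalyticAt ℂ g x₀ := by
    rw [analyticAt_pi_iff]
    exact fun i => AnalyticOnNhd.eval_mvPolynomial (f i) x₀ trivial
  have hst := han.hasStrictFDerivAt
  refine ⟨g x₀, ?_⟩
  rw [mem_interior_iff_mem_nhds, ← hst.map_nhds_eq_of_surj]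
  · exact Filter.range_mem_map
  rw [LinearMap.range_eq_top]
  intro T
  obtain ⟨v, c, d, hv⟩ := h T
  refine ⟨v, ?_⟩
  have h1 : HasDerivAt (fun t : ℂ => g (x₀ + t • v)) (fderiv ℂ g x₀ v) 0 := by
    have h2 : HasDerivAt (fun t : ℂ => x₀ + t • v) v 0 := by
      simpa using ((hasDerivAt_id (0 : ℂ)).smul_const v).const_add x₀
    have h3 : HasFDerivAt g (fderiv ℂ g x₀) (x₀ + (0 : ℂ) • v) := by
      simpa using hst.hasFDerivAt
    exact h3.comp_hasDerivAt 0 h2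
  have h4 : HasDerivAt (fun t : ℂ => g (x₀ + t • v)) T 0 := by
    rw [hasDerivAt_pi]
    intro i
    have h5 := ((((hasDerivAt_id' (0 : ℂ)).mul_const (T i)).const_add (eval x₀ (f i))).add
      ((hasDerivAt_pow 2 (0 : ℂ)).mul_const (c i))).add
      ((hasDerivAt_pow 3 (0 : ℂ)).mul_const (d i))
    have h6 : (1 : ℂ) * T i + ((2 : ℕ) : ℂ) * 0 ^ (2 - 1) * c i +
      ((3 : ℕ) : ℂ) * 0 ^ (3 - 1) * d i = T i := by norm_num
    rw [h6] at h5
    exact h5.congr_of_eventuallyEq (Filter.Eventually.of_forall fun t => hv t i)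
  exact h1.unique h4

theorem flagMap_dense {m : Fin 3 → Fin r → ℕ} {u : Fin 3 → Matrix (Fin r) (Fin r) ℂ}
    {p q : Fin 3 → Matrix (Fin N) (Fin N) ℂ} (hp : ∀ k, p k * q k = 1) (hS : IncSurj u p m)
    (hLo : ∀ k a, Lo k a a) (hLo' : ∀ k (t : Fin N) j, m k j ≤ t → Lo k (.inr t) (.inl j))
    {U : Set (Fin 3 → Matrix (Fin r ⊕ Fin N) (Fin r ⊕ Fin N) ℂ)} (hU : IsOpen U) (hne : U.Nonempty) :
    ∃ x, flagMap Lo x ∈ U := by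
  classical
  let f : Fin 3 × (Fin r ⊕ Fin N) × (Fin r ⊕ Fin N) → MvPolynomial (FlagIdx r N) ℂ :=
    fun i => flagMap Lo X i.1 i.2.1 i.2.2
  have hf : ∀ x i, eval x (f i) = flagMap Lo x i.1 i.2.1 i.2.2 := by
    intro x i
    have h1 := congrFun (congrFun (flagMap_map Lo (eval x) X i.1) i.2.1) i.2.2
    have h2 : (eval x : MvPolynomial (FlagIdx r N) ℂ →+* ℂ) ∘ X = x := by ext; simp
    rw [h2] at h1
    exact h1
  let e : (Fin 3 × (Fin r ⊕ Fin N) × (Fin r ⊕ Fin N) → ℂ) →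
      (Fin 3 → Matrix (Fin r ⊕ Fin N) (Fin r ⊕ Fin N) ℂ) := fun y k => of fun a b => y (k, a, b)
  have he : Continuous e := by unfold e; fun_prop
  have hinterior : (interior (Set.range fun x i => eval x (f i))).Nonempty := by
    refine interior_range_nonempty f
      (Sum.elim (fun i => (projL r N ℂ)ᵀ i.1 i.2) <| Sum.elim (fun i => u i.1 i.2.1 i.2.2) <|
        Sum.elim (fun i => ((projR r N ℂ)ᵀ * q i.1) i.2.1 i.2.2)
          fun i => if i.2.1 = i.2.2 then 1 else 0) ?_
    intro T
    let T' : Fin 3 → Matrix (Fin r ⊕ Fin N) (Fin r ⊕ Fin N) ℂ := fun k => of fun a b => T (k, a, b)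
    obtain ⟨φ, hφ⟩ := hS fun k => p k * (projR r N ℂ * T' k * (projL r N ℂ)ᵀ)
    let β : Fin 3 → Matrix (Fin N) (Fin r) ℂ :=
      fun k => p k * (projR r N ℂ * T' k * (projL r N ℂ)ᵀ - φ * u k)
    have hβ : ∀ k (t : Fin N) j, (t : ℕ) < m k j → β k t j = 0 := by
      intro k t j htj
      have := hφ k t j htj
      rw [Matrix.mul_assoc (p k) φ] at this
      simp only [β, Matrix.mul_sub, Matrix.sub_apply]
      rw [this, sub_self]
    have hq : ∀ k, q k * β k = projR r N ℂ * T' k * (projL r N ℂ)ᵀ - φ * u k := by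
      intro k
      simp only [β]
      rw [← Matrix.mul_assoc, mul_eq_one_comm.1 (hp k), Matrix.one_mul]
    let b₁ : Fin 3 → Matrix (Fin r ⊕ Fin N) (Fin r ⊕ Fin N) ℂ :=
      fun k => (projR r N ℂ)ᵀ * β k * projL r N ℂ
    have hb₁ : ∀ k a b, ¬ Lo k a b → b₁ k a b = 0 := by
      intro k a b hab
      have h1 : b₁ k = fromBlocks 0 0 (β k) 0 := by
        simp only [b₁, projL, projR, transpose_fromCols, fromRows_mul]
        ext (i | i) (j | j) <;> simp
      rw [h1]
      rcases a with a | a <;> rcases b with b | b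
      · rfl
      · rfl
      · refine hβ k a b ?_
        by_contra hcon
        exact hab (hLo' k a b (not_lt.1 hcon))
      · rfl
    let w₁ : Fin 3 → Matrix (Fin r) (Fin r) ℂ := fun k => projL r N ℂ * T' k * (projL r N ℂ)ᵀ
    let Ω₁ := (projR r N ℂ)ᵀ * φ
    let R₁ : Fin 3 → Matrix (Fin r ⊕ Fin N) (Fin N) ℂ := fun k => T' k * (projR r N ℂ)ᵀ
    let P₁ := fun k => Ω₁ * u k * projL r N ℂ + (projL r N ℂ)ᵀ * w₁ k * projL r N ℂ + R₁ k * projR r N ℂ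
    let P₂ := fun k => Ω₁ * w₁ k * projL r N ℂ
    refine ⟨Sum.elim (fun i => Ω₁ i.1 i.2) <| Sum.elim (fun i => w₁ i.1 i.2.1 i.2.2) <|
        Sum.elim (fun i => R₁ i.1 i.2.1 i.2.2) fun i => b₁ i.1 i.2.1 i.2.2,
        fun i => (P₂ i.1 + P₁ i.1 * b₁ i.1) i.2.1 i.2.2,
        fun i => (P₂ i.1 * b₁ i.1) i.2.1 i.2.2, fun t i => ?_⟩
    obtain ⟨k, a, b⟩ := i
    simp only [hf]
    have e1 : (of fun a b => if Lo k a b then (if a = b then (1 : ℂ) else 0) + t * b₁ k a b else 0) =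
        1 + t • b₁ k := by
      ext a b
      simp only [of_apply, Matrix.add_apply, Matrix.one_apply, Matrix.smul_apply, smul_eq_mul]
      by_cases hab : Lo k a b
      · rw [if_pos hab]
      · rw [if_neg hab, hb₁ k a b hab, if_neg, mul_zero, add_zero]
        rintro rfl; exact hab (hLo k _)
    have e0 : (of fun a b => if Lo k a b then (if a = b then (1 : ℂ) else 0) else 0) =
        (1 : Matrix (Fin r ⊕ Fin N) (Fin r ⊕ Fin N) ℂ) := by
      ext a b
      simp only [of_apply, Matrix.one_apply]
      by_cases hab : a = b
      · subst hab; simp [hLo]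
      · simp [hab]
    have e2 : (of fun a b => (projL r N ℂ)ᵀ a b + t * Ω₁ a b) = (projL r N ℂ)ᵀ + t • Ω₁ := rfl
    have e3 : (of fun a b => u k a b + t * w₁ k a b) = u k + t • w₁ k := rfl
    have e4 : (of fun a b => ((projR r N ℂ)ᵀ * q k) a b + t * R₁ k a b) =
      (projR r N ℂ)ᵀ * q k + t • R₁ k := rfl
    have key := flag_expansion projL_mul_projR_transpose projR_mul_transpose projL_add_projR
      (T := T' k) (hq k) t
    have key' := congrFun (congrFun key a) b
    simp only [Matrix.add_apply, Matrix.smul_apply, smul_eq_mul] at key'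
    simp only [flagMap, Pi.add_apply, Pi.smul_apply, Sum.elim_inl, Sum.elim_inr, smul_eq_mul]
    rw [e1, e0, e2, e3, e4]
    exact key'
  obtain ⟨x, hx⟩ := dense_range_eval f hinterior (hU.preimage he) (by
      obtain ⟨g, hg⟩ := hne
      exact ⟨fun i => g i.1 i.2.1 i.2.2, hg⟩)
  refine ⟨x, ?_⟩
  have : e (fun i => eval x (f i)) = flagMap Lo x := by
    ext k a b
    simp [e, hf]
  rw [← this]
  exact hx

end FlagMap

section DenseInt

theorem val_le_of_strictMono {r n : ℕ} {I : Fin r → Fin n} (hI : StrictMono I) (j : Fin r) :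
    (j : ℕ) ≤ I j := by
  have h := Finset.card_le_card_of_injOn (s := Finset.Iio j) (t := Finset.Iio (I j)) I
    (fun x hx => by simpa using hI (by simpa using hx)) hI.injective.injOn
  simpa using h

theorem monotone_sub_of_strictMono {r n : ℕ} {I : Fin r → Fin n} (hI : StrictMono I) :
    Monotone fun j : Fin r => (I j : ℕ) - j := by
  rcases r with _ | r
  · exact fun a => a.elim0
  · refine Fin.monotone_iff_le_succ.2 fun i => ?_
    have h := hI (Fin.castSucc_lt_succ (i := i))
    have : ((I i.castSucc : Fin n) : ℕ) < I i.succ := h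
    simp only [Fin.val_castSucc, Fin.val_succ]
    omega

theorem exists_equiv_extend {r N n : ℕ} (hn : r + N = n) {I : Fin r → Fin n} (hI : StrictMono I) :
    ∃ e : Fin r ⊕ Fin N ≃ Fin n, (∀ j, e (.inl j) = I j) ∧
      ∀ t j, e (.inr t) < I j → (t : ℕ) + j < I j := by
  classical
  let s : Finset (Fin n) := Finset.univ.map ⟨I, hI.injective⟩
  have hs : s.card = r := by simp [s]
  have hs' : sᶜ.card = N := by rw [Finset.card_compl, hs, Fintype.card_fin]; omega
  have h1 : ∀ j, finSumEquivOfFinset hs hs' (.inl j) = I j := by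
    intro j
    rw [finSumEquivOfFinset_inl, ← Finset.orderEmbOfFin_unique hs (f := I) (by simp [s]) hI]
  refine ⟨finSumEquivOfFinset hs hs', h1, fun t j htj => ?_⟩
  have h := Finset.card_le_card_of_injOn (s := (Finset.Iio j).disjSum (Finset.Iic t))
    (t := Finset.Iio (I j)) (finSumEquivOfFinset hs hs') (fun x hx => ?_)
    (Equiv.injective _).injOn
  · simp at h
    omega
  · rcases x with x | x
    · have hx : x < j := by simpa using hx
      simpa [h1] using hI hx
    · have hx : x ≤ t := by simpa using hx
      have : finSumEquivOfFinset hs hs' (.inr x) ≤ finSumEquivOfFinset hs hs' (.inr t) := by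
        simpa [finSumEquivOfFinset_inr] using hx
      simpa using this.trans_lt htj

theorem exists_mem_det_ne_zero {s : Type*} [Fintype s] [DecidableEq s]
    {U : Set (Fin 3 → Matrix s s ℂ)} (hU : IsOpen U) (hne : U.Nonempty) :
    ∃ g ∈ U, ∀ k, (g k).det ≠ 0 := by
  let Q : MvPolynomial (Fin 3 × s × s) ℂ :=
    ∏ k, (of fun a b => MvPolynomial.X (k, a, b) : Matrix s s (MvPolynomial _ ℂ)).det
  have hev : ∀ x, MvPolynomial.eval x Q = ∏ k, (of fun a b => x (k, a, b) : Matrix s s ℂ).det := by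
    intro x
    simp only [Q, map_prod]
    refine Finset.prod_congr rfl fun k _ => ?_
    rw [RingHom.map_det]
    congr 1
    ext a b
    simp
  have hQ : Q ≠ 0 := by
    intro h0
    have := hev fun i => if i.2.1 = i.2.2 then 1 else 0
    rw [h0, map_zero] at this
    have h1 : (of fun a b => if a = b then 1 else 0 : Matrix s s ℂ) = 1 := by
      ext a b; simp [Matrix.one_apply]
    simp only [h1, det_one] at this
    simp at this
  let e : (Fin 3 × s × s → ℂ) → (Fin 3 → Matrix s s ℂ) := fun y k => of fun a b => y (k, a, b)
  have he : Continuous e := by unfold e; fun_prop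
  obtain ⟨x, hx, hx'⟩ := exists_eval_ne_zero hQ (hU.preimage he) (by
    obtain ⟨g, hg⟩ := hne
    exact ⟨fun i => g i.1 i.2.1 i.2.2, hg⟩)
  refine ⟨e x, hx, fun k hk => hx' ?_⟩
  rw [hev]
  exact Finset.prod_eq_zero (Finset.mem_univ k) hk

theorem denseInt_of_incSurj {r N n : ℕ} (hn : r + N = n) {I : Fin 3 → Fin r → Fin n}
    (hI : ∀ k, StrictMono (I k)) {u : Fin 3 → Matrix (Fin r) (Fin r) ℂ}
    {p q : Fin 3 → Matrix (Fin N) (Fin N) ℂ} (hp : ∀ k, p k * q k = 1)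
    (hS : IncSurj u p fun k j => (I k j : ℕ) - j) : DenseInt n r I := by
  intro U hU hne
  choose e he1 he2 using fun k => exists_equiv_extend hn (hI k)
  let Φ : (Fin 3 → Matrix (Fin r ⊕ Fin N) (Fin r ⊕ Fin N) ℂ) → (Fin 3 → Matrix (Fin n) (Fin n) ℂ) :=
    fun h k => (h k).submatrix (e 0).symm (e k).symm
  have hΦ : Continuous Φ := by unfold Φ; fun_prop
  let U' := Φ ⁻¹' U ∩ {h | ∀ k, (h k).det ≠ 0}
  have hU' : IsOpen U' := by
    refine (hU.preimage hΦ).inter ?_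
    simp only [Set.ofPred_forall]
    refine isOpen_iInter_of_finite fun k => ?_
    exact isOpen_ne_fun (Continuous.matrix_det (continuous_apply k)) continuous_const
  have hne' : U'.Nonempty := by
    obtain ⟨g, hg⟩ := hne
    obtain ⟨h, h1, h2⟩ := exists_mem_det_ne_zero (hU.preimage hΦ)
      ⟨fun k => (g k).submatrix (e 0) (e k), by
        have : Φ (fun k => (g k).submatrix (e 0) (e k)) = g := by
          ext k a b; simp [Φ]
        rwa [Set.mem_preimage, this]⟩
    exact ⟨h, h1, h2⟩
  let Lo : Fin 3 → (Fin r ⊕ Fin N) → (Fin r ⊕ Fin N) → Prop := fun k a b => e k b ≤ e k a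
  obtain ⟨x, hx, hdet⟩ := flagMap_dense Lo hp hS (fun k a => le_refl _)
    (fun k t j h => by
      by_contra hcon
      have h2 := he2 k t j (by rw [← he1]; exact not_le.1 hcon)
      omega) hU' hne'
  let b : Fin 3 → Matrix (Fin r ⊕ Fin N) (Fin r ⊕ Fin N) ℂ :=
    fun k => of fun a c => if Lo k a c then x (.inr <| .inr <| .inr (k, a, c)) else 0
  let Ω : Matrix (Fin r ⊕ Fin N) (Fin r) ℂ := of fun a c => x (.inl (a, c))
  let w : Fin 3 → Matrix (Fin r) (Fin r) ℂ := fun k => of fun a c => x (.inr <| .inl (k, a, c))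
  let R : Fin 3 → Matrix (Fin r ⊕ Fin N) (Fin N) ℂ :=
    fun k => of fun a c => x (.inr <| .inr <| .inl (k, a, c))
  let M := fun k => Ω * w k * projL r N ℂ + R k * projR r N ℂ
  have hMb : ∀ k, flagMap Lo x k = M k * b k := by
    intro k
    simp only [flagMap, M, b, Ω, w, R]
    congr!
  have hdet' : ∀ k, (M k).det * (b k).det ≠ 0 := fun k => by
    rw [← det_mul, ← hMb]; exact hdet k
  have hM : ∀ k, IsUnit (M k).det := fun k => (left_ne_zero_of_mul (hdet' k)).isUnit
  have hb : ∀ k, IsUnit (b k).det := fun k => (right_ne_zero_of_mul (hdet' k)).isUnit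
  have hMΩ : ∀ k, M k * (projL r N ℂ)ᵀ = Ω * w k := by
    intro k
    simp only [M, Matrix.add_mul, Matrix.mul_assoc, projL_mul_transpose,
      projR_mul_projL_transpose, Matrix.mul_one, Matrix.mul_zero, add_zero]
  have hw : ∀ k, projL r N ℂ * (M k)⁻¹ * Ω * w k = 1 := by
    intro k
    rw [Matrix.mul_assoc, ← hMΩ, Matrix.mul_assoc, nonsing_inv_mul_cancel_left _ _ (hM k),
      projL_mul_transpose]
  refine ⟨Φ (flagMap Lo x), hx, Ω.submatrix (e 0).symm id,
    (w 0 * (projL r N ℂ * (M 0)⁻¹)).submatrix id (e 0).symm, w,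
    fun k => projL r N ℂ * (M k)⁻¹ * Ω,
    fun k => ((b k)⁻¹ * (projL r N ℂ)ᵀ).submatrix (e k).symm id, ?_, ?_, ?_, ?_⟩
  · rw [submatrix_mul_equiv, Matrix.mul_assoc, mul_eq_one_comm.1 (hw 0), submatrix_id_id]
  · exact fun k => mul_eq_one_comm.1 (hw k)
  · intro k
    simp only [Φ]
    rw [submatrix_mul_equiv, hMb, Matrix.mul_assoc, mul_nonsing_inv_cancel_left _ _ (hb k), hMΩ,
      submatrix_mul _ _ _ id _ Function.bijective_id, submatrix_id_id]
  · intro k f j hfj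
    have h1 : ((b k)⁻¹ * (projL r N ℂ)ᵀ) ((e k).symm f) j = (b k)⁻¹ ((e k).symm f) (.inl j) := by
      simp [projL, transpose_fromCols, mul_apply, Fintype.sum_sum_type, Matrix.one_apply]
    refine h1.trans ?_
    have hbt : BlockTriangular (b k) (fun a => OrderDual.toDual (e k a)) := by
      intro a c hac
      simp only [b, of_apply, Lo]
      rw [if_neg]
      exact not_le.2 (by simpa using hac)
    let := invertibleOfIsUnitDet _ (hb k)
    refine blockTriangular_inv_of_blockTriangular hbt ?_
    simpa [he1] using hfj

theorem denseInt_of_sum_eq {r N n : ℕ} (hn : r + N = n) {I : Fin 3 → Fin r → Fin n}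
    (hI : ∀ k, StrictMono (I k)) {A U : Fin 3 → Matrix (Fin r) (Fin r) ℂ}
    (hU : ∀ k, (U k)ᴴ * U k = 1)
    (hA : ∀ k, A k = U k * diagonal (fun j => (((I k j : ℕ) - (j : ℕ) : ℝ) : ℂ)) * (U k)ᴴ)
    (hc : ∑ k, A k = ((N : ℝ) : ℂ) • 1) : DenseInt n r I := by
  have hm := fun k => monotone_sub_of_strictMono (hI k)
  have hinc : ∀ (e : ℕ) (F : Fin 3 → Fin e → Fin r), (∀ k, StrictMono (F k)) → DenseInt r e F →
      ∑ k, ∑ j, ((I k (F k j) : ℕ) - (F k j : ℕ)) ≤ e * N := ?_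
  · obtain ⟨u, -, p, q, -, hp, hS⟩ := exists_incSurj hm hinc
    exact denseInt_of_incSurj hn hI hp hS
  intro e F hF hD
  have h := hD.sum_le (fun k => (hF k).monotone) (A := fun k => -A k)
    (a := fun k j => -(((I k j : ℕ) - (j : ℕ) : ℕ) : ℝ)) (c := -N) hU
    (fun k i j hij => neg_le_neg (Nat.cast_le.2 (hm k hij))) (fun k => ?_) ?_
  · simp only [Finset.sum_neg_distrib] at h
    have h' : (∑ k, ∑ j, (((I k (F k j) : ℕ) - (F k j : ℕ) : ℕ) : ℝ)) ≤ e * N := by linarith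
    exact_mod_cast h'
  · rw [hA, ← Matrix.neg_mul, ← Matrix.mul_neg, diagonal_neg]
    congr 3
    funext j
    rw [Nat.cast_sub (val_le_of_strictMono (hI k) j)]
    push_cast
    rfl
  · rw [Finset.sum_neg_distrib, hc, ← neg_smul]
    congr 1
    push_cast
    rfl

end DenseInt

section Svd

theorem exists_unitary_of_orthonormal_cols {ι κ : Type*} [Fintype ι] [Fintype κ] [DecidableEq ι]
    [DecidableEq κ]
    (hcard : Fintype.card ι = Fintype.card κ) (M : Matrix ι κ ℂ) (s : Set κ)
    (hM : ∀ j ∈ s, ∀ k ∈ s, (Mᴴ * M) j k = (1 : Matrix κ κ ℂ) j k) :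
    ∃ W : Matrix ι κ ℂ, Wᴴ * W = 1 ∧ W * Wᴴ = 1 ∧ ∀ j ∈ s, ∀ i, W i j = M i j := by
  let v : κ → EuclideanSpace ℂ ι := fun j => WithLp.toLp 2 fun i => M i j
  have hin : ∀ (f g : κ → EuclideanSpace ℂ ι) j k,
      inner ℂ (f j) (g k) = ∑ i, star (f j i) * g k i := by
    intro f g j k
    rw [PiLp.inner_apply]
    refine Finset.sum_congr rfl fun i _ => ?_
    simp [mul_comm]
  have hv : Orthonormal ℂ (s.domRestrict v) := by
    rw [orthonormal_iff_ite]
    rintro ⟨j, hj⟩ ⟨k, hk⟩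
    have h1 := hM j hj k hk
    rw [mul_apply] at h1
    simp only [Set.domRestrict_apply]
    rw [hin v v]
    simp only [v]
    simp only [conjTranspose_apply, Matrix.one_apply] at h1
    simp only [Subtype.mk.injEq]
    exact h1
  obtain ⟨b, hb⟩ := hv.exists_orthonormalBasis_extension_of_card_eq
    (by rw [finrank_euclideanSpace, hcard])
  let W : Matrix ι κ ℂ := of fun i j => b j i
  have hW : Wᴴ * W = 1 := by
    ext j k
    have h2 := orthonormal_iff_ite.1 b.orthonormal j k
    rw [hin] at h2
    rw [mul_apply, Matrix.one_apply, ← h2]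
    rfl
  refine ⟨W, hW, (mul_eq_one_comm_of_card_eq _ _ _ hcard).2 hW, fun j hj i => ?_⟩
  simp [W, hb j hj, v]

theorem exists_unitary_extension {ι κ τ : Type*} [Fintype ι] [Fintype κ] [Fintype τ]
    [DecidableEq ι] [DecidableEq κ] [DecidableEq τ]
    (hcard : Fintype.card ι = Fintype.card κ + Fintype.card τ) {M : Matrix ι κ ℂ}
    (hM : Mᴴ * M = 1) : ∃ Q : Matrix ι τ ℂ, (fromCols M Q)ᴴ * fromCols M Q = 1 ∧
      fromCols M Q * (fromCols M Q)ᴴ = 1 := by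
  obtain ⟨W, h1, h2, h3⟩ := exists_unitary_of_orthonormal_cols (κ := κ ⊕ τ) (by simp [hcard])
    (fromCols M 0) (Set.range Sum.inl) (by
      rintro _ ⟨j, rfl⟩ _ ⟨k, rfl⟩
      have h := congrFun (congrFun hM j) k
      rw [mul_apply] at h ⊢
      simpa [Matrix.one_apply] using h)
  have hW : fromCols M W.toCols₂ = W := by
    ext i (j | j)
    · simp [h3 (.inl j) ⟨j, rfl⟩]
    · simp
  exact ⟨W.toCols₂, by rw [hW]; exact h1, by rw [hW]; exact h2⟩

/-- The rectangular diagonal matrix with diagonal `s`. -/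
noncomputable def rectDiag (p : ℕ) {q : ℕ} (s : Fin q → ℝ) : Matrix (Fin p) (Fin q) ℂ :=
  of fun i j => if (i : ℕ) = j then (s j : ℂ) else 0

theorem exists_svd {p q : ℕ} (hpq : q ≤ p) (Y : Matrix (Fin p) (Fin q) ℂ) :
    ∃ (W₁ : Matrix (Fin p) (Fin p) ℂ) (W₂ : Matrix (Fin q) (Fin q) ℂ) (s : Fin q → ℝ),
      Antitone s ∧ (∀ i, 0 ≤ s i) ∧ W₁ᴴ * W₁ = 1 ∧ W₁ * W₁ᴴ = 1 ∧ W₂ᴴ * W₂ = 1 ∧ W₂ * W₂ᴴ = 1 ∧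
      Y = W₁ * rectDiag p s * W₂ᴴ := by
  obtain ⟨W₂, d, hd, h1, h2, h3⟩ := exists_diag_antitone (isHermitian_conjTranspose_mul_self Y)
    (Fintype.card_fin q)
  have h4 : (Y * W₂)ᴴ * (Y * W₂) = diagonal (fun k => (d k : ℂ)) := by
    rw [conjTranspose_mul, Matrix.mul_assoc, ← Matrix.mul_assoc _ Y, h3]
    simp only [Matrix.mul_assoc, h2, Matrix.mul_one]
    rw [← Matrix.mul_assoc, h2, Matrix.one_mul]
  have h5 : ∀ j, ((∑ i, ‖(Y * W₂) i j‖ ^ 2 : ℝ) : ℂ) = d j := by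
    intro j
    have h := congrFun (congrFun h4 j) j
    rw [mul_apply, diagonal_apply_eq] at h
    rw [← h]
    push_cast
    refine Finset.sum_congr rfl fun i _ => ?_
    rw [conjTranspose_apply, Complex.star_def, Complex.conj_mul']
  have h5' : ∀ j, ∑ i, ‖(Y * W₂) i j‖ ^ 2 = d j := fun j => by exact_mod_cast h5 j
  have hd0 : ∀ j, 0 ≤ d j := fun j => by
    rw [← h5']; positivity
  let M : Matrix (Fin p) (Fin p) ℂ :=
    of fun i j => if h : (j : ℕ) < q then (Y * W₂) i ⟨j, h⟩ / (√(d ⟨j, h⟩) : ℝ) else 0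
  obtain ⟨W₁, e1, e2, e3⟩ := exists_unitary_of_orthonormal_cols rfl M
    {j | ∃ h : (j : ℕ) < q, 0 < d ⟨j, h⟩} (by
      rintro j ⟨hj, hj'⟩ k ⟨hk, hk'⟩
      have h := congrFun (congrFun h4 ⟨j, hj⟩) ⟨k, hk⟩
      rw [mul_apply] at h ⊢
      have : ∀ i, Mᴴ j i * M i k = (Y * W₂)ᴴ ⟨j, hj⟩ i * (Y * W₂) i ⟨k, hk⟩ *
          ((√(d ⟨j, hj⟩) : ℝ) * (√(d ⟨k, hk⟩) : ℝ) : ℂ)⁻¹ := by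
        intro i
        simp only [M, conjTranspose_apply, of_apply, dif_pos hj, dif_pos hk, star_div₀,
          Complex.star_def, Complex.conj_ofReal]
        rw [div_mul_div_comm, div_eq_mul_inv]
      simp_rw [this]
      rw [← Finset.sum_mul, h]
      by_cases hjk : j = k
      · subst hjk
        rw [diagonal_apply_eq, Matrix.one_apply_eq]
        have hne : (d ⟨j, hj⟩ : ℂ) ≠ 0 := by exact_mod_cast hj'.ne'
        rw [← Complex.ofReal_mul, Real.mul_self_sqrt hj'.le, mul_inv_cancel₀ hne]
      · rw [diagonal_apply_ne _ (by simpa [Fin.ext_iff] using hjk), Matrix.one_apply_ne hjk,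
          zero_mul])
  refine ⟨W₁, W₂, fun j => √(d j), fun i j hij => Real.sqrt_le_sqrt (hd hij),
    fun i => Real.sqrt_nonneg _, e1, e2, h2, h1, ?_⟩
  have h6 : Y * W₂ = W₁ * rectDiag p fun j => √(d j) := by
    ext i j
    have hjp : (j : ℕ) < p := j.2.trans_le hpq
    have h7 : (W₁ * rectDiag p fun j => √(d j)) i j = W₁ i ⟨j, hjp⟩ * (√(d j) : ℝ) := by
      rw [mul_apply, Finset.sum_eq_single ⟨j, hjp⟩]
      · simp [rectDiag]
      · intro b _ hb
        have : (b : ℕ) ≠ j := fun h => hb (Fin.ext h)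
        simp [rectDiag, this]
      · simp
    rw [h7]
    rcases (hd0 j).eq_or_lt with h0 | h0
    · have h8 := h5' j
      rw [← h0, Finset.sum_eq_zero_iff_of_nonneg fun i _ => by positivity] at h8
      have h9 : (Y * W₂) i j = 0 := by simpa using h8 i (Finset.mem_univ _)
      rw [h9, ← h0]; simp
    · rw [e3 ⟨j, hjp⟩ ⟨j.2, h0⟩ i]
      have hne : ((√(d j) : ℝ) : ℂ) ≠ 0 := by exact_mod_cast (Real.sqrt_pos.2 h0).ne'
      simp only [M, of_apply, j.2, dif_pos, Fin.eta]
      field_simp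
  rw [← h6, Matrix.mul_assoc, h1, Matrix.mul_one]

theorem sval_eq {p q : ℕ} (hpq : q ≤ p) {Y : Matrix (Fin p) (Fin q) ℂ}
    {W₁ : Matrix (Fin p) (Fin p) ℂ} {W₂ : Matrix (Fin q) (Fin q) ℂ} {s : Fin q → ℝ}
    (hs : Antitone s) (hs0 : ∀ i, 0 ≤ s i) (h1 : W₁ᴴ * W₁ = 1) (h2 : W₁ * W₁ᴴ = 1)
    (h3 : W₂ᴴ * W₂ = 1) (hY : Y = W₁ * rectDiag p s * W₂ᴴ) (i : Fin q) :
    sval Y i = s i := by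
  let v : Fin p → ℝ := fun i => if h : (i : ℕ) < q then s ⟨i, h⟩ ^ 2 else 0
  have hv : Antitone v := by
    intro i j hij
    simp only [v]
    split_ifs with ha hb
    · exact pow_le_pow_left₀ (hs0 _) (hs hij) 2
    · exact absurd (lt_of_le_of_lt (show (i : ℕ) ≤ j from hij) (by assumption)) hb
    · positivity
    · rfl
  have hd : rectDiag p s * (rectDiag p s)ᴴ = diagonal (fun i => (v i : ℂ)) := by
    ext a b
    rw [mul_apply, diagonal_apply]
    by_cases ha : (a : ℕ) < q
    · rw [Finset.sum_eq_single ⟨a, ha⟩]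
      · by_cases hab : a = b
        · subst hab
          simp [rectDiag, v, ha, pow_two]
        · have : (b : ℕ) ≠ a := fun h => hab (Fin.ext h.symm)
          simp [rectDiag, hab, this]
      · intro j _ hj
        have : (a : ℕ) ≠ j := fun h => hj (Fin.ext h.symm)
        simp [rectDiag, this]
      · simp
    · rw [Finset.sum_eq_zero]
      · simp [v, ha]
      · intro j _
        have : (a : ℕ) ≠ j := fun h => ha (by omega)
        simp [rectDiag, this]
  have hsp : HasSpec (Y * Yᴴ) v := by
    refine hasSpec_of_eq h2 h1 ?_
    rw [← hd, hY]
    simp only [conjTranspose_mul, conjTranspose_conjTranspose, Matrix.mul_assoc]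
    rw [← Matrix.mul_assoc W₂ᴴ, h3, Matrix.one_mul]
  rw [sval, dif_pos (i.2.trans_le hpq), eigVec_eq _ hv hsp]
  simp [v, Real.sqrt_sq (hs0 i)]

theorem hatPQ_antitone {p q : ℕ} {s : Fin q → ℝ} (hs : Antitone s)
    (hs0 : ∀ i, 0 ≤ s i) : Antitone (hatPQ p q s) := by
  intro i j hij
  have hij' : (i : ℕ) ≤ j := hij
  have hi := i.2
  have hj := j.2
  unfold hatPQ
  by_cases h1 : (j : ℕ) < q
  · rw [dif_pos h1, dif_pos (hij'.trans_lt h1)]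
    exact hs hij
  rw [dif_neg h1]
  by_cases h2 : (i : ℕ) < q
  · rw [dif_pos h2]
    split_ifs
    · exact hs0 _
    · exact (neg_nonpos.2 (hs0 _)).trans (hs0 _)
  rw [dif_neg h2]
  split_ifs
  · rfl
  · omega
  · exact neg_nonpos.2 (hs0 _)
  · exact neg_le_neg (hs (by simp only [Fin.mk_le_mk]; omega))

theorem hasSpec_hat {p q : ℕ} (hpq : q ≤ p) (s : Fin q → ℝ) :
    HasSpec (fromBlocks 0 (rectDiag p s) (rectDiag p s)ᴴ 0) (hatPQ p q s) := by
  obtain ⟨m, rfl⟩ := Nat.exists_eq_add_of_le hpq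
  let D : Matrix (Fin q) (Fin q) ℂ := diagonal fun k => (s k : ℂ)
  let e₀ : (Fin q ⊕ Fin q) ⊕ Fin m ≃ (Fin q ⊕ Fin m) ⊕ Fin q :=
    (Equiv.sumAssoc _ _ _).trans <| ((Equiv.refl _).sumCongr (Equiv.sumComm _ _)).trans
      (Equiv.sumAssoc _ _ _).symm
  let e : (Fin q ⊕ Fin q) ⊕ Fin m ≃ Fin (q + m) ⊕ Fin q :=
    e₀.trans (finSumFinEquiv.sumCongr (Equiv.refl _))
  let e' : (Fin q ⊕ Fin q) ⊕ Fin m ≃ Fin (q + m + q) :=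
    e₀.trans ((finSumFinEquiv.sumCongr Fin.revPerm).trans finSumFinEquiv)
  have h1 : HasSpec (fromBlocks 0 D D 0) (Sum.elim s fun k => -s k) := by
    have h2 : HasSpec (fromBlocks D 0 0 (-D)) (Sum.elim s fun k => -s k) := by
      refine (hasSpec_diagonal s).fromBlocks ?_
      convert hasSpec_diagonal fun k => -s k using 1
      simp only [D, diagonal_neg, Complex.ofReal_neg]
    have hU : (fromBlocks 1 1 1 (-1) : Matrix (Fin q ⊕ Fin q) (Fin q ⊕ Fin q) ℂ) *
        ((1 / 2 : ℂ) • fromBlocks 1 1 1 (-1)) = 1 := by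
      simp only [Matrix.mul_smul, fromBlocks_multiply]
      ext (i | i) (j | j) <;> simp [Matrix.one_apply] <;> split_ifs <;> norm_num
    have h3 := h2.conj (mul_eq_one_comm.1 hU) hU
    convert h3 using 1
    simp only [fromBlocks_multiply, Matrix.mul_smul]
    ext (i | i) (j | j) <;> simp [D, diagonal_apply] <;>
      split_ifs <;> ring
  have h0 : HasSpec (0 : Matrix (Fin m) (Fin m) ℂ) (0 : Fin m → ℝ) := by
    convert hasSpec_diagonal (0 : Fin m → ℝ) using 1
    ext i j
    simp
  have h4 := h1.fromBlocks h0
  have h5 : (fromBlocks 0 (rectDiag (q + m) s) (rectDiag (q + m) s)ᴴ 0).submatrix e e =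
      fromBlocks (fromBlocks 0 D D 0) 0 0 0 := by
    have hne : ∀ (i : Fin m) (j : Fin q), q + (i : ℕ) ≠ j := fun i j => by omega
    ext ((i | i) | i) ((j | j) | j) <;>
      simp [e, e₀, D, rectDiag, diagonal_apply, Fin.ext_iff, hne]
    · split_ifs with h
      · rw [Fin.ext h]
      · rfl
    · simp only [eq_comm (a := (i : ℕ))]
      split_ifs <;> simp
  rw [← h5] at h4
  have h6 := (h4.reindex e.symm).comp_equiv e'.symm
  convert h6 using 1
  · simp
  · ext x
    obtain ⟨y, rfl⟩ := e'.surjective x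
    rw [Function.comp_apply, Equiv.symm_apply_apply]
    rcases y with (y | y) | y
    · simp [e', e₀, hatPQ]
    · have h7 : ¬ (q + m + (q - (y + 1)) < q) := by omega
      have h8 : q + m + q - 1 - (q + m + (q - (y + 1))) = y := by omega
      simp [e', e₀, hatPQ, h7, h8]
    · simp [e', e₀, hatPQ]

end Svd

section Necessity

/-- The three increasing sequences in `[n]` attached to a triple of subsets of `[q]`. -/
def lrIdx {q n r : ℕ} (hqn : q ≤ n) {I J K : Finset (Fin q)} (hI : I.card = r) (hJ : J.card = r)
    (hK : K.card = r) : Fin 3 → Fin r → Fin n :=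
  ![fun f => Fin.castLE hqn (I.orderEmbOfFin hI f), fun f => Fin.castLE hqn (J.orderEmbOfFin hJ f),
    fun f => (Fin.castLE hqn (K.orderEmbOfFin hK f.rev)).rev]

theorem sum_orderEmbOfFin {q r : ℕ} {I : Finset (Fin q)} (hI : I.card = r) (f : Fin q → ℝ) :
    ∑ j, f (I.orderEmbOfFin hI j) = ∑ i ∈ I, f i := by
  conv_rhs => rw [← Finset.map_orderEmbOfFin_univ I hI, Finset.sum_map]
  rfl

theorem lrIdx_strictMono {q n r : ℕ} (hqn : q ≤ n) {I J K : Finset (Fin q)} (hI : I.card = r)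
    (hJ : J.card = r) (hK : K.card = r) (k : Fin 3) : StrictMono (lrIdx hqn hI hJ hK k) := by
  fin_cases k
  · exact (Fin.strictMono_castLE hqn).comp (I.orderEmbOfFin hI).strictMono
  · exact (Fin.strictMono_castLE hqn).comp (J.orderEmbOfFin hJ).strictMono
  · intro i j hij
    exact Fin.rev_lt_rev.2 (Fin.strictMono_castLE hqn ((K.orderEmbOfFin hK).strictMono
      (Fin.rev_lt_rev.2 hij)))

theorem sum_lrIdx {q n r : ℕ} (hqn : q ≤ n) {I J K : Finset (Fin q)} (hI : I.card = r)
    (hJ : J.card = r) (hK : K.card = r) (a : Fin 3 → Fin n → ℝ) :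
    ∑ k, ∑ j, a k (lrIdx hqn hI hJ hK k j) = ∑ i ∈ I, a 0 (Fin.castLE hqn i) +
      ∑ i ∈ J, a 1 (Fin.castLE hqn i) + ∑ i ∈ K, a 2 (Fin.castLE hqn i).rev := by
  rw [Fin.sum_univ_three, ← sum_orderEmbOfFin hI fun i => a 0 (Fin.castLE hqn i),
    ← sum_orderEmbOfFin hJ fun i => a 1 (Fin.castLE hqn i),
    ← sum_orderEmbOfFin hK fun i => a 2 (Fin.castLE hqn i).rev]
  congr 1
  exact Equiv.sum_comp Fin.revPerm fun j => a 2 (Fin.castLE hqn (K.orderEmbOfFin hK j)).rev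

theorem exists_diag_rev {r : ℕ} {X : Matrix (Fin r) (Fin r) ℂ} (hX : X.IsHermitian) :
    ∃ U : Matrix (Fin r) (Fin r) ℂ, Uᴴ * U = 1 ∧
      X = U * diagonal (fun k => (eigVec X hX k.rev : ℂ)) * Uᴴ := by
  obtain ⟨U, h1, h2, h3⟩ := exists_diag_of_hasSpec hX (eigVec_antitone X hX) (hasSpec_eigVec X hX)
  refine ⟨U.submatrix id Fin.revPerm, ?_, ?_⟩
  · rw [conjTranspose_submatrix, ← submatrix_mul _ _ _ id _ Function.bijective_id, h2,
      submatrix_one_equiv]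
  · have : diagonal (fun k => (eigVec X hX k.rev : ℂ)) =
        (diagonal fun k => (eigVec X hX k : ℂ)).submatrix Fin.revPerm Fin.revPerm := by
      rw [submatrix_diagonal_equiv]; rfl
    rw [this, conjTranspose_submatrix, submatrix_mul_equiv, submatrix_mul_equiv, submatrix_id_id]
    exact h3

theorem denseInt_of_horn {q n r : ℕ} (hqn : q ≤ n) {I J K : Finset (Fin q)} (hI : I.card = r)
    (hJ : J.card = r) (hK : K.card = r) (h : (muVec I hI, muVec J hJ, muVec K hK) ∈ Horn r) :
    DenseInt n r (lrIdx hqn hI hJ hK) := by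
  obtain ⟨X, Y, hX, hY, h1, h2, h3⟩ := h
  simp only at h1 h2 h3
  obtain ⟨U₁, u1, d1⟩ := exists_diag_rev hX
  obtain ⟨U₂, u2, d2⟩ := exists_diag_rev hY
  obtain ⟨U₃, u3', u3, d3⟩ := exists_diag_of_hasSpec (hX.add hY) (eigVec_antitone _ _)
    (hasSpec_eigVec _ (hX.add hY))
  rw [← h1] at d1
  rw [← h2] at d2
  rw [← h3] at d3
  have hrq : r ≤ q := by
    have := Finset.card_le_univ I
    rwa [hI, Fintype.card_fin] at this
  refine denseInt_of_sum_eq (N := n - r) (by omega) (lrIdx_strictMono hqn hI hJ hK)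
    (A := ![X, Y, (((n - r : ℕ) : ℝ) : ℂ) • 1 - (X + Y)]) (U := ![U₁, U₂, U₃]) ?_ ?_ ?_
  · intro k; fin_cases k <;> assumption
  · intro k
    fin_cases k
    · refine d1.trans ?_
      congr 3
      funext j
      simp [muVec, lrIdx]
    · refine d2.trans ?_
      congr 3
      funext j
      simp [muVec, lrIdx]
    · change _ - (X + Y) = U₃ * (diagonal fun j : Fin r =>
        (((lrIdx hqn hI hJ hK 2 j : ℕ) - (j : ℕ) : ℝ) : ℂ)) * U₃ᴴ
      have : (diagonal fun j : Fin r => (((lrIdx hqn hI hJ hK 2 j : ℕ) - (j : ℕ) : ℝ) : ℂ)) =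
          (((n - r : ℕ) : ℝ) : ℂ) • 1 - diagonal fun j => (muVec K hK j : ℂ) := by
        rw [← diagonal_one, ← diagonal_smul, diagonal_sub]
        congr 1
        funext j
        have hj := j.2
        have hk := (K.orderEmbOfFin hK j.rev).2
        have h5 : ((lrIdx hqn hI hJ hK 2 j : ℕ) : ℝ) + (K.orderEmbOfFin hK j.rev : ℕ) + 1 = n := by
          have : (lrIdx hqn hI hJ hK 2 j : ℕ) + (K.orderEmbOfFin hK j.rev : ℕ) + 1 = n := by
            simp only [lrIdx, Matrix.cons_val, Fin.val_rev, Fin.val_castLE]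
            omega
          exact_mod_cast this
        have h6 : ((j.rev : ℕ) : ℝ) + j + 1 = r := by
          have : (j.rev : ℕ) + j + 1 = r := by simp only [Fin.val_rev]; omega
          exact_mod_cast this
        have h7 : ((n - r : ℕ) : ℝ) = n - r := by
          rw [Nat.cast_sub (hrq.trans hqn)]
        have h8 : ((lrIdx hqn hI hJ hK 2 j : ℕ) - (j : ℕ) : ℝ) =
            ((n - r : ℕ) : ℝ) - muVec K hK j := by
          simp only [muVec, Finset.coe_orderIsoOfFin_apply]
          rw [h7]
          linarith
        rw [h8]
        simp
      rw [this, d3, Matrix.mul_sub, Matrix.sub_mul, Matrix.mul_smul, Matrix.smul_mul,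
        Matrix.mul_one, u3']
  · rw [Fin.sum_univ_three]
    simp

theorem DenseInt.sum_nonneg {n r : ℕ} {F : Fin 3 → Fin r → Fin n} (h : DenseInt n r F)
    (hF : ∀ k, Monotone (F k)) {ι : Type*} [Fintype ι] [DecidableEq ι] (e : ι ≃ Fin n)
    {X : Fin 3 → Matrix ι ι ℂ} (hX : ∀ k, (X k).IsHermitian) {a : Fin 3 → Fin n → ℝ}
    (ha : ∀ k, Antitone (a k)) (hs : ∀ k, HasSpec (X k) (a k)) (h0 : ∑ k, X k = 0) :
    0 ≤ ∑ k, ∑ j, a k (F k j) := by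
  have hX' : ∀ k, ((X k).submatrix e.symm e.symm).IsHermitian := fun k => (hX k).submatrix _
  choose U h1 h2 h3 using fun k => exists_diag_of_hasSpec (hX' k) (ha k) ((hs k).reindex e.symm)
  have := h.sum_le hF (A := fun k => (X k).submatrix e.symm e.symm) h2 ha h3 (c := 0) ?_
  · simpa using this
  · ext i j
    have h4 := congrFun (congrFun h0 (e.symm i)) (e.symm j)
    simpa [Matrix.sum_apply] using h4

theorem HasSpec.neg_rev {ι : Type*} [Fintype ι] [DecidableEq ι] {n : ℕ} (e : ι ≃ Fin n)
    {X : Matrix ι ι ℂ} (hX : X.IsHermitian) {v : Fin n → ℝ} (hv : Antitone v) (h : HasSpec X v) :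
    HasSpec (-X) fun k : Fin n => -v k.rev := by
  obtain ⟨U, h1, h2, h3⟩ := exists_diag_of_hasSpec (hX.submatrix e.symm) hv (h.reindex e.symm)
  have h4 := ((HasSpec.neg h1 h2 h3).reindex e).comp_equiv Fin.revPerm
  have h5 : (-X.submatrix e.symm e.symm).submatrix e e = -X := by
    ext i j
    simp
  rw [h5] at h4
  exact h4

theorem lr_inequality_of_mem_coneA {p q : ℕ} (hpq : q ≤ p) {lam : Fin (p + q) → ℝ}
    {s : Fin q → ℝ} (hs : Antitone s) (hs0 : ∀ i, 0 ≤ s i) (h : (lam, s) ∈ coneA p q) {r : ℕ}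
    {I J K : Finset (Fin q)} (hI : I.card = r) (hJ : J.card = r) (hK : K.card = r)
    (hLR : (muVec I hI, muVec J hJ, muVec K hK) ∈ Horn r) :
    2 * ∑ k ∈ K, s k ≤ ∑ i ∈ I, lam (Fin.castLE (Nat.le_add_left q p) i) -
      ∑ j ∈ J, lam (Fin.castLE (Nat.le_add_left q p) j).rev := by
  obtain ⟨X, hX, h1, h2⟩ := h
  simp only at h1 h2
  obtain ⟨W₁, W₂, s', hs', hs0', u1, u2, u3, u4, hY⟩ := exists_svd hpq (blockTR p q X)
  have hss : s' = s := funext fun i => by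
    rw [h2, sval_eq hpq hs' hs0' u1 u2 u3 hY]
  subst hss
  let e : Fin p ⊕ Fin q ≃ Fin (p + q) := finSumFinEquiv
  let Y := blockTR p q X
  let Z := X.submatrix e e
  have hZ : Z.IsHermitian := hX.submatrix e
  let Jm : Matrix (Fin p ⊕ Fin q) (Fin p ⊕ Fin q) ℂ := fromBlocks 1 0 0 (-1)
  have hJJ : Jm * Jm = 1 := by simp [Jm, fromBlocks_multiply]
  have hJH : Jmᴴ = Jm := by simp [Jm, fromBlocks_conjTranspose]
  have hlam : Antitone lam := h1 ▸ eigVec_antitone X hX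
  have hsZ : HasSpec Z lam := h1 ▸ (hasSpec_eigVec X hX).reindex e
  let t : Fin q → ℝ := fun i => 2 * s' i
  have ht : Antitone t := fun i j hij => mul_le_mul_of_nonneg_left (hs hij) zero_le_two
  have ht0 : ∀ i, 0 ≤ t i := fun i => mul_nonneg zero_le_two (hs0 i)
  have hrt : rectDiag p t = (2 : ℂ) • rectDiag p s' := by
    ext i j
    simp [rectDiag, t]
  have hC : HasSpec (fromBlocks 0 (-(2 : ℂ) • Y) (-(2 : ℂ) • Yᴴ) 0) (hatPQ p q t) := by
    have h3 := (hasSpec_hat hpq t).conj (U := fromBlocks W₁ᴴ 0 0 (-W₂ᴴ))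
      (V := fromBlocks W₁ 0 0 (-W₂)) (by simp [fromBlocks_multiply, u1, u3])
      (by simp [fromBlocks_multiply, u2, u4])
    convert h3 using 1
    simp only [Y, hY, hrt, fromBlocks_multiply]
    simp [conjTranspose_mul, Matrix.mul_assoc]
  have key := (denseInt_of_horn (Nat.le_add_left q p) hI hJ hK hLR).sum_nonneg
    (fun k => (lrIdx_strictMono _ hI hJ hK k).monotone) e
    (X := ![Z, -(Jm * Z * Jm), fromBlocks 0 (-(2 : ℂ) • Y) (-(2 : ℂ) • Yᴴ) 0])
    (a := ![lam, fun k => -lam k.rev, hatPQ p q t]) ?_ ?_ ?_ ?_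
  · rw [sum_lrIdx] at key
    simp only [Matrix.cons_val, Finset.sum_neg_distrib] at key
    have h4 : ∀ i : Fin q, hatPQ p q t (Fin.castLE (Nat.le_add_left q p) i).rev = -(2 * s' i) := by
      intro i
      have hi := i.2
      unfold hatPQ
      rw [dif_neg, dif_neg]
      · simp only [t, Fin.val_rev, Fin.val_castLE]
        congr 3
        ext
        simp only
        omega
      · simp only [Fin.val_rev, Fin.val_castLE]; omega
      · simp only [Fin.val_rev, Fin.val_castLE]; omega
    simp only [h4, Finset.sum_neg_distrib, ← Finset.mul_sum] at key
    linarith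
  · intro k
    fin_cases k
    · exact hZ
    · have := isHermitian_mul_mul_conjTranspose Jm hZ
      rw [hJH] at this
      exact this.neg
    · simp [IsHermitian, fromBlocks_conjTranspose]
  · intro k
    fin_cases k
    · exact hlam
    · exact fun i j hij => neg_le_neg (hlam (Fin.rev_le_rev.2 hij))
    · exact hatPQ_antitone ht ht0
  · intro k
    fin_cases k
    · exact hsZ
    · have h5 := (hsZ.neg_rev e hZ hlam).conj hJJ hJJ
      simpa using h5
    · exact hC
  · rw [Fin.sum_univ_three]
    have hZb : Z = fromBlocks Z.toBlocks₁₁ Y Yᴴ Z.toBlocks₂₂ := by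
      conv_lhs => rw [← fromBlocks_toBlocks Z]
      congr 1
      ext i j
      exact (hZ.apply _ _).symm
    simp only [Matrix.cons_val]
    rw [hZb]
    simp only [Jm, fromBlocks_multiply, fromBlocks_neg, fromBlocks_add, ← fromBlocks_zero]
    congr 1 <;> simp [two_smul]

end Necessity

section Variation

variable {ι : Type*} [Fintype ι] [DecidableEq ι]

theorem exists_minimizer {J L H : Matrix ι ι ℂ} :
    ∃ X C U W : Matrix ι ι ℂ, U * Uᴴ = 1 ∧ Uᴴ * U = 1 ∧ W * Wᴴ = 1 ∧ Wᴴ * W = 1 ∧ J * W = W * J ∧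
      X = U * L * Uᴴ ∧ C = W * H * Wᴴ ∧ ∀ P Q : Matrix ι ι ℂ, Pᴴ * P = 1 → Qᴴ * Q = 1 →
      J * Q = Q * J → ((X - J * X * J - C) * (X - J * X * J - C)).trace.re ≤
        ((P * X * Pᴴ - J * (P * X * Pᴴ) * J - Q * C * Qᴴ) *
          (P * X * Pᴴ - J * (P * X * Pᴴ) * J - Q * C * Qᴴ)).trace.re := by
  let K : Set (Matrix ι ι ℂ × Matrix ι ι ℂ) :=
    {U | Uᴴ * U = 1} ×ˢ ({W | Wᴴ * W = 1} ∩ {W | J * W = W * J})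
  have hK : IsCompact K := isCompact_orthonormal.prod
    (isCompact_orthonormal.inter_right (isClosed_eq (by fun_prop) (by fun_prop)))
  let D : Matrix ι ι ℂ × Matrix ι ι ℂ → Matrix ι ι ℂ := fun u =>
    u.1 * L * u.1ᴴ - J * (u.1 * L * u.1ᴴ) * J - u.2 * H * u.2ᴴ
  have hD : Continuous D := by
    have h1 : Continuous fun u : Matrix ι ι ℂ × Matrix ι ι ℂ => u.1ᴴ :=
      continuous_fst.matrix_conjTranspose
    have h2 : Continuous fun u : Matrix ι ι ℂ × Matrix ι ι ℂ => u.2ᴴ :=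
      continuous_snd.matrix_conjTranspose
    fun_prop
  obtain ⟨⟨U, W⟩, ⟨hU, hW, hJ⟩, hmin⟩ := hK.exists_isMinOn
    ⟨(1, 1), by simp [K]⟩ (f := fun u => (D u * D u).trace.re)
    (Complex.continuous_re.comp (hD.matrix_mul hD).matrix_trace).continuousOn
  simp only [Set.mem_ofPred_eq] at hU hW hJ
  refine ⟨_, _, U, W, mul_eq_one_comm.1 hU, hU, mul_eq_one_comm.1 hW, hW, hJ, rfl, rfl,
    fun P Q hP hQ hQJ => ?_⟩
  have h := hmin (show (P * U, Q * W) ∈ K from ⟨?_, ?_, ?_⟩)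
  · simpa only [Set.mem_ofPred_eq, D, conjTranspose_mul, Matrix.mul_assoc] using h
  · simp only [Set.mem_ofPred_eq, conjTranspose_mul]
    rw [Matrix.mul_assoc, ← Matrix.mul_assoc Pᴴ, hP, Matrix.one_mul, hU]
  · simp only [Set.mem_ofPred_eq, conjTranspose_mul]
    rw [Matrix.mul_assoc, ← Matrix.mul_assoc Qᴴ, hQ, Matrix.one_mul, hW]
  · simp only [Set.mem_ofPred_eq]
    rw [← Matrix.mul_assoc, hQJ, Matrix.mul_assoc, hJ, Matrix.mul_assoc]

theorem second_derivative_nonneg {f g : ℝ → ℝ} {c : ℝ} (hf : ∀ t, HasDerivAt f (g t) t)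
    (hg : HasDerivAt g c 0) (hmin : ∀ t, f 0 ≤ f t) : g 0 = 0 ∧ 0 ≤ c := by
  have h0 : g 0 = 0 := by
    have : IsLocalMin f 0 := Filter.Eventually.of_forall hmin
    exact this.hasDerivAt_eq_zero (hf 0)
  refine ⟨h0, ?_⟩
  by_contra! hc
  have hd : deriv f = g := funext fun t => (hf t).deriv
  have h1 : IsLocalMax f 0 := isLocalMax_of_deriv_deriv_neg (by rw [hd, hg.deriv]; exact hc)
    (by rw [hd, h0]) (hf 0).continuousAt
  have h2 : f =ᶠ[nhds 0] fun _ => f 0 := h1.mono fun t ht => le_antisymm ht (hmin t)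
  have h3 : g =ᶠ[nhds 0] fun _ => 0 := by
    have := h2.deriv
    rw [hd] at this
    simpa using this
  have h4 := h3.deriv_eq
  rw [hg.deriv] at h4
  simp at h4
  exact hc.ne h4

open scoped Matrix.Norms.Operator

/-- The one-parameter conjugation `t ↦ exp (tA) Y exp (-tA)`. -/
noncomputable def conjPath (A Y : Matrix ι ι ℂ) (t : ℝ) : Matrix ι ι ℂ :=
  NormedSpace.exp (t • A) * Y * NormedSpace.exp (t • -A)

theorem conjPath_zero (A Y : Matrix ι ι ℂ) : conjPath A Y 0 = Y := by
  simp [conjPath]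

theorem hasDerivAt_conjPath (A Y : Matrix ι ι ℂ) (t : ℝ) :
    HasDerivAt (conjPath A Y) (conjPath A (A * Y - Y * A) t) t := by
  have h1 := hasDerivAt_exp_smul_const (𝕂 := ℝ) A t
  have h2 := hasDerivAt_exp_smul_const' (𝕂 := ℝ) (-A) t
  refine ((h1.mul_const Y).mul h2).congr_deriv ?_
  simp only [conjPath]
  noncomm_ring

theorem exp_smul_skew {A : Matrix ι ι ℂ} (hA : Aᴴ = -A) (t : ℝ) :
    (NormedSpace.exp (t • A))ᴴ = NormedSpace.exp (t • -A) ∧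
      (NormedSpace.exp (t • A))ᴴ * NormedSpace.exp (t • A) = 1 := by
  have h1 : (NormedSpace.exp (t • A))ᴴ = NormedSpace.exp (t • -A) := by
    rw [← Matrix.exp_conjTranspose, conjTranspose_smul, hA, star_trivial]
  refine ⟨h1, ?_⟩
  have h2 : Commute (-(t • A)) (t • A) := (Commute.refl (t • A)).neg_left
  rw [h1, smul_neg, ← Matrix.exp_add_of_commute _ _ h2, neg_add_cancel, NormedSpace.exp_zero]

theorem variation {J X C : Matrix ι ι ℂ}
    (hmin : ∀ P Q : Matrix ι ι ℂ, Pᴴ * P = 1 → Qᴴ * Q = 1 →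
      J * Q = Q * J → ((X - J * X * J - C) * (X - J * X * J - C)).trace.re ≤
        ((P * X * Pᴴ - J * (P * X * Pᴴ) * J - Q * C * Qᴴ) *
          (P * X * Pᴴ - J * (P * X * Pᴴ) * J - Q * C * Qᴴ)).trace.re)
    {A B : Matrix ι ι ℂ} (hA : Aᴴ = -A) (hB : Bᴴ = -B) (hJB : J * B = B * J) :
    let D := X - J * X * J - C
    let D1 := (A * X - X * A) - J * (A * X - X * A) * J - (B * C - C * B)
    let D2 := (A * (A * X - X * A) - (A * X - X * A) * A) -
      J * (A * (A * X - X * A) - (A * X - X * A) * A) * J -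
      (B * (B * C - C * B) - (B * C - C * B) * B)
    (D * D1).trace.re = 0 ∧ 0 ≤ (D1 * D1).trace.re + (D * D2).trace.re := by
  intro D D1 D2
  let p : Matrix ι ι ℂ → Matrix ι ι ℂ → ℝ → Matrix ι ι ℂ := fun Y Z t =>
    conjPath A Y t - J * conjPath A Y t * J - conjPath B Z t
  have hp : ∀ Y Z t, HasDerivAt (p Y Z) (p (A * Y - Y * A) (B * Z - Z * B) t) t := by
    intro Y Z t
    exact ((hasDerivAt_conjPath A Y t).sub
      (((hasDerivAt_conjPath A Y t).const_mul J).mul_const J)).sub (hasDerivAt_conjPath B Z t)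
  have hp0 : ∀ Y Z, p Y Z 0 = Y - J * Y * J - Z := fun Y Z => by simp [p, conjPath_zero]
  have htr : ∀ {F G : ℝ → Matrix ι ι ℂ} {F' G' : Matrix ι ι ℂ} {t : ℝ}, HasDerivAt F F' t →
      HasDerivAt G G' t → HasDerivAt (fun t => (F t * G t).trace.re)
        ((F' * G t).trace.re + (F t * G').trace.re) t := by
    intro F G F' G' t hF hG
    let T : Matrix ι ι ℂ →L[ℝ] ℝ := LinearMap.toContinuousLinearMap
      (Complex.reLm ∘ₗ (Matrix.traceLinearMap ι ℝ ℂ))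
    exact (T.hasFDerivAt.comp_hasDerivAt t (hF.mul hG)).congr_deriv (map_add T _ _)
  have key := second_derivative_nonneg
    (f := fun t => (p X C t * p X C t).trace.re)
    (g := fun t => (p (A * X - X * A) (B * C - C * B) t * p X C t).trace.re +
      (p X C t * p (A * X - X * A) (B * C - C * B) t).trace.re)
    (fun t => htr (hp X C t) (hp X C t))
    ((htr (hp _ _ 0) (hp X C 0)).add (htr (hp X C 0) (hp _ _ 0))) ?_
  · simp only [hp0] at key
    have c1 := Matrix.trace_mul_comm D D1
    have c2 := Matrix.trace_mul_comm D D2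
    obtain ⟨k1, k2⟩ := key
    change (D1 * D).trace.re + (D * D1).trace.re = 0 at k1
    change 0 ≤ ((D2 * D).trace.re + (D1 * D1).trace.re) +
      ((D1 * D1).trace.re + (D * D2).trace.re) at k2
    rw [← c1] at k1
    rw [← c2] at k2
    constructor <;> linarith
  · intro t
    obtain ⟨a1, a2⟩ := exp_smul_skew hA t
    obtain ⟨b1, b2⟩ := exp_smul_skew hB t
    have h := hmin _ _ a2 b2
      ((Commute.smul_right (show Commute J B from hJB) t).exp_right).eq
    rw [a1, b1] at h
    change (p X C 0 * p X C 0).trace.re ≤ _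
    rw [hp0]
    exact h

end Variation

section Critical

variable {ι : Type*} [Fintype ι]

/-- The second-order condition at a minimizer. -/
def SecondOrder (J X C D : Matrix ι ι ℂ) : Prop :=
  ∀ A B : Matrix ι ι ℂ, Aᴴ = -A → Bᴴ = -B → J * B = B * J →
    (A * X - X * A) - J * (A * X - X * A) * J = B * C - C * B →
    2 * ((A * D - D * A) * (A * X - X * A)).trace.re ≤
      ((B * D - D * B) * (B * C - C * B)).trace.re

theorem trace_comm_mul (D A Y : Matrix ι ι ℂ) :
    (D * (A * Y - Y * A)).trace = (A * (Y * D - D * Y)).trace := by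
  rw [Matrix.mul_sub, Matrix.mul_sub, trace_sub, trace_sub, trace_mul_comm D (A * Y),
    ← Matrix.mul_assoc D Y A, trace_mul_comm (D * Y) A, Matrix.mul_assoc A Y D]

theorem trace_comm_mul' (D A Y : Matrix ι ι ℂ) :
    (D * (A * Y - Y * A)).trace = -((A * D - D * A) * Y).trace := by
  rw [trace_comm_mul, ← trace_neg, ← neg_mul, neg_sub, Matrix.mul_sub, Matrix.sub_mul, trace_sub,
    trace_sub, ← Matrix.mul_assoc A Y D, trace_mul_comm (A * Y) D, Matrix.mul_assoc D A Y,
    Matrix.mul_assoc A D Y]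

theorem trace_odd {J D : Matrix ι ι ℂ} (hJD : J * D * J = -D) (Y : Matrix ι ι ℂ) :
    (D * (J * Y * J)).trace = -(D * Y).trace := by
  rw [show D * (J * Y * J) = D * J * Y * J by simp only [Matrix.mul_assoc],
    trace_mul_cycle (D * J) Y J, ← Matrix.mul_assoc J D J, hJD, Matrix.neg_mul, trace_neg]

open scoped ComplexOrder in
theorem eq_zero_of_skew {A : Matrix ι ι ℂ} (hA : Aᴴ = -A) (h : (A * A).trace.re = 0) : A = 0 := by
  have h1 : (Aᴴ * A).trace = 0 := by
    rw [hA, Matrix.neg_mul, trace_neg, neg_eq_zero]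
    apply Complex.ext h
    have h2 : star (A * A).trace = (A * A).trace := by
      rw [← trace_conjTranspose, conjTranspose_mul, hA]
      simp
    have := congrArg Complex.im h2
    simp only [Complex.star_def, Complex.conj_im] at this
    simp only [Complex.zero_im]
    linarith
  exact trace_conjTranspose_mul_self_eq_zero_iff.1 h1

variable [DecidableEq ι]

theorem exists_critical {J L H : Matrix ι ι ℂ} (hJ : Jᴴ = J) (hJJ : J * J = 1)
    (hL : L.IsHermitian) (hH : H.IsHermitian) (hJH : J * H * J = -H) :
    ∃ X C U W D : Matrix ι ι ℂ, U * Uᴴ = 1 ∧ Uᴴ * U = 1 ∧ W * Wᴴ = 1 ∧ Wᴴ * W = 1 ∧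
      J * W = W * J ∧ X = U * L * Uᴴ ∧ C = W * H * Wᴴ ∧ D = X - J * X * J - C ∧
      X.IsHermitian ∧ C.IsHermitian ∧ D.IsHermitian ∧ J * C * J = -C ∧ J * D * J = -D ∧
      X * D = D * X ∧ C * D = D * C ∧ SecondOrder J X C D := by
  obtain ⟨X, C, U, W, hU, hU', hW, hW', hJW, hX, hC, hmin⟩ := exists_minimizer (J := J) (L := L)
    (H := H)
  let D := X - J * X * J - C
  have hXh : X.IsHermitian := hX ▸ isHermitian_mul_mul_conjTranspose U hL
  have hCh : C.IsHermitian := hC ▸ isHermitian_mul_mul_conjTranspose W hH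
  have hJXJ : (J * X * J).IsHermitian := by
    have := isHermitian_mul_mul_conjTranspose J hXh
    rwa [hJ] at this
  have hDh : D.IsHermitian := (hXh.sub hJXJ).sub hCh
  have hJW' : Wᴴ * J = J * Wᴴ := by
    have := congrArg conjTranspose hJW
    rwa [conjTranspose_mul, conjTranspose_mul, hJ] at this
  have hJC : J * C * J = -C := by
    have : J * C * J = W * (J * H * J) * Wᴴ := by
      rw [hC]
      simp only [Matrix.mul_assoc]
      rw [hJW', ← Matrix.mul_assoc J W, hJW, Matrix.mul_assoc W]
    rw [this, hJH, hC, Matrix.mul_neg, Matrix.neg_mul]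
  have hJD : J * D * J = -D := by
    have : J * (J * X * J) * J = X := by
      rw [show J * (J * X * J) * J = (J * J) * X * (J * J) by noncomm_ring, hJJ, Matrix.one_mul,
        Matrix.mul_one]
    simp only [D, Matrix.mul_sub, Matrix.sub_mul, this, hJC]
    abel
  have hXD : X * D - D * X = 0 := by
    have hs : (X * D - D * X)ᴴ = -(X * D - D * X) := by
      rw [conjTranspose_sub, conjTranspose_mul, conjTranspose_mul, hXh.eq, hDh.eq, neg_sub]
    have h := (variation hmin hs (B := 0) (by simp) (by simp)).1
    simp only [Matrix.zero_mul, Matrix.mul_zero, sub_zero] at h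
    rw [Matrix.mul_sub D, trace_sub, trace_odd hJD, trace_comm_mul] at h
    apply eq_zero_of_skew hs
    simp only [sub_neg_eq_add, Complex.add_re] at h
    linarith
  have hCD : C * D - D * C = 0 := by
    have hs : (C * D - D * C)ᴴ = -(C * D - D * C) := by
      rw [conjTranspose_sub, conjTranspose_mul, conjTranspose_mul, hCh.eq, hDh.eq, neg_sub]
    have hc : J * (C * D - D * C) = (C * D - D * C) * J := by
      have : J * (C * D - D * C) * J = C * D - D * C := by
        have e : J * (C * D - D * C) * J = (J * C * J) * (J * D * J) - (J * D * J) * (J * C * J) := by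
          rw [show (J * C * J) * (J * D * J) - (J * D * J) * (J * C * J) =
            J * C * (J * J) * D * J - J * D * (J * J) * C * J by noncomm_ring, hJJ]
          noncomm_ring
        rw [e, hJC, hJD]
        noncomm_ring
      rw [← congrArg (· * J) this, Matrix.mul_assoc _ J J, hJJ, Matrix.mul_one]
    have h := (variation hmin (A := 0) (by simp) hs hc).1
    simp only [Matrix.zero_mul, Matrix.mul_zero, sub_zero, zero_sub] at h
    rw [Matrix.mul_neg, trace_neg, trace_comm_mul] at h
    apply eq_zero_of_skew hs
    simpa using h
  refine ⟨X, C, U, W, D, hU, hU', hW, hW', hJW, hX, hC, rfl, hXh, hCh, hDh, hJC, hJD,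
    sub_eq_zero.1 hXD, sub_eq_zero.1 hCD, ?_⟩
  intro A B hA hB hJB h0
  have h := (variation hmin hA hB hJB).2
  rw [h0, sub_self, Matrix.mul_sub, Matrix.mul_sub, trace_sub, trace_sub, trace_odd hJD,
    trace_comm_mul' _ A (A * X - X * A), trace_comm_mul' _ B (B * C - C * B)] at h
  simp only [Matrix.mul_zero, trace_zero, Complex.zero_re, Complex.sub_re, Complex.neg_re] at h
  linarith

theorem SecondOrder.conj {κ : Type*} [Fintype κ] [DecidableEq κ] {J X C D : Matrix ι ι ℂ}
    {V : Matrix ι κ ℂ} (h1 : V * Vᴴ = 1) (h2 : Vᴴ * V = 1) (h : SecondOrder J X C D) :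
    SecondOrder (Vᴴ * J * V) (Vᴴ * X * V) (Vᴴ * C * V) (Vᴴ * D * V) := by
  have hc : ∀ Y : Matrix ι ι ℂ, V * (Vᴴ * Y * V) * Vᴴ = Y := fun Y => by
    rw [show V * (Vᴴ * Y * V) * Vᴴ = (V * Vᴴ) * Y * (V * Vᴴ) by simp only [Matrix.mul_assoc], h1,
      Matrix.one_mul, Matrix.mul_one]
  have hm : ∀ Y Z : Matrix κ κ ℂ, V * Y * Vᴴ * (V * Z * Vᴴ) = V * (Y * Z) * Vᴴ := fun Y Z => by
    rw [show V * Y * Vᴴ * (V * Z * Vᴴ) = V * Y * (Vᴴ * V) * Z * Vᴴ by simp only [Matrix.mul_assoc],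
      h2, Matrix.mul_one, Matrix.mul_assoc V Y Z]
  have hs : ∀ Y Z : Matrix κ κ ℂ, V * Y * Vᴴ - V * Z * Vᴴ = V * (Y - Z) * Vᴴ := fun Y Z => by
    rw [Matrix.mul_sub, Matrix.sub_mul]
  have ht : ∀ Y : Matrix κ κ ℂ, (V * Y * Vᴴ).trace = Y.trace := fun Y => by
    rw [trace_mul_comm, ← Matrix.mul_assoc, h2, Matrix.one_mul]
  intro A B hA hB hJB h0
  have eX := hc X
  have eC := hc C
  have eD := hc D
  have eJ := hc J
  have := h (V * A * Vᴴ) (V * B * Vᴴ) ?_ ?_ ?_ ?_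
  · generalize Vᴴ * X * V = X' at *
    generalize Vᴴ * C * V = C' at *
    generalize Vᴴ * D * V = D' at *
    rw [← eX, ← eC, ← eD] at this
    simpa only [hm, hs, ht] using this
  · simp [conjTranspose_mul, hA, Matrix.mul_assoc]
  · simp [conjTranspose_mul, hB, Matrix.mul_assoc]
  · generalize Vᴴ * J * V = J' at *
    rw [← eJ, hm, hm, hJB]
  · generalize Vᴴ * X * V = X' at *
    generalize Vᴴ * C * V = C' at *
    generalize Vᴴ * J * V = J' at *
    rw [← eX, ← eC, ← eJ]
    simp only [hm, hs, h0]

end Critical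

section BlockConditions

variable {κ τ : Type*} [Fintype κ] [Fintype τ]

theorem fromBlocks_sub_fromBlocks {l m n o : Type*} (A A' : Matrix n l ℂ) (B B' : Matrix n m ℂ)
    (C C' : Matrix o l ℂ) (D D' : Matrix o m ℂ) : fromBlocks A B C D - fromBlocks A' B' C' D' =
      fromBlocks (A - A') (B - B') (C - C') (D - D') := by
  simp only [sub_eq_add_neg, fromBlocks_neg, fromBlocks_add]

theorem trace_fromBlocks_eq (A : Matrix κ κ ℂ) (B : Matrix κ τ ℂ) (C : Matrix τ κ ℂ)
    (D : Matrix τ τ ℂ) : (fromBlocks A B C D).trace = A.trace + D.trace := by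
  simp [trace, Fintype.sum_sum_type]

theorem re_trace_mul_conjTranspose (U M : Matrix τ κ ℂ) :
    (U * Mᴴ).trace.re = (Uᴴ * M).trace.re := by
  have := congrArg Complex.re (trace_conjTranspose (U * Mᴴ))
  rw [conjTranspose_mul, conjTranspose_conjTranspose, trace_mul_comm] at this
  simpa using this.symm

theorem trace_fromCols_conjTranspose_mul (A A' B B' : Matrix τ κ ℂ) :
    ((fromCols A B)ᴴ * fromCols A' B').trace = (Aᴴ * A').trace + (Bᴴ * B').trace := by
  rw [conjTranspose_fromCols_eq_fromRows_conjTranspose, fromRows_mul_fromCols,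
    trace_fromBlocks_eq]

theorem fromCols_sub_fromCols {l m n : Type*} (A A' : Matrix l m ℂ) (B B' : Matrix l n ℂ) :
    fromCols A B - fromCols A' B' = fromCols (A - A') (B - B') := by
  ext i (j | j) <;> rfl

theorem SecondOrder.of_fromBlocks {J X C D : Matrix κ κ ℂ} {J' X' C' D' : Matrix τ τ ℂ}
    (h : SecondOrder (fromBlocks J 0 0 J') (fromBlocks X 0 0 X') (fromBlocks C 0 0 C')
      (fromBlocks D 0 0 D')) : SecondOrder J X C D := by
  intro A B hA hB hJB h0
  have := h (fromBlocks A 0 0 0) (fromBlocks B 0 0 0)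
    (by simp [fromBlocks_conjTranspose, fromBlocks_neg, hA])
    (by simp [fromBlocks_conjTranspose, fromBlocks_neg, hB])
    (by simp [fromBlocks_multiply, hJB])
    (by simpa [fromBlocks_multiply, fromBlocks_sub_fromBlocks] using h0)
  simpa [fromBlocks_multiply, fromBlocks_sub_fromBlocks, trace_fromBlocks_eq] using this

theorem SecondOrder.offDiag {J X C D : Matrix κ κ ℂ} {J' X' C' D' : Matrix τ τ ℂ}
    (hX : X.IsHermitian) (hX' : X'.IsHermitian) (hC : C.IsHermitian) (hC' : C'.IsHermitian)
    (hD : D.IsHermitian) (hD' : D'.IsHermitian) (hJ : J.IsHermitian) (hJ' : J'.IsHermitian)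
    (h : SecondOrder (fromBlocks J 0 0 J') (fromBlocks X 0 0 X') (fromBlocks C 0 0 C')
      (fromBlocks D 0 0 D')) {A B : Matrix τ κ ℂ} (hB : J' * B = B * J)
    (hAB : (A * X - X' * A) - J' * (A * X - X' * A) * J = B * C - C' * B) :
    2 * ((A * D - D' * A)ᴴ * (A * X - X' * A)).trace.re ≤
      ((B * D - D' * B)ᴴ * (B * C - C' * B)).trace.re := by
  have hc : ∀ {Y : Matrix κ κ ℂ} {Y' : Matrix τ τ ℂ} {Z : Matrix τ κ ℂ}, Y.IsHermitian →
      Y'.IsHermitian → fromBlocks 0 (-Zᴴ) Z 0 * fromBlocks Y 0 0 Y' -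
        fromBlocks Y 0 0 Y' * fromBlocks 0 (-Zᴴ) Z 0 =
          fromBlocks 0 (Z * Y - Y' * Z)ᴴ (Z * Y - Y' * Z) 0 := by
    intro Y Y' Z hY hY'
    rw [conjTranspose_sub, conjTranspose_mul, conjTranspose_mul, hY.eq, hY'.eq]
    simp only [fromBlocks_multiply, fromBlocks_sub_fromBlocks]
    congr 1 <;> simp
    abel
  have key := h (fromBlocks 0 (-Aᴴ) A 0) (fromBlocks 0 (-Bᴴ) B 0)
    (by simp [fromBlocks_conjTranspose, fromBlocks_neg])
    (by simp [fromBlocks_conjTranspose, fromBlocks_neg]) ?_ ?_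
  · rw [hc hD hD', hc hD hD', hc hX hX', hc hC hC'] at key
    simp only [fromBlocks_multiply, trace_fromBlocks_eq, Matrix.zero_mul, zero_add, add_zero,
      Complex.add_re, re_trace_mul_conjTranspose] at key
    linarith
  · have h1 : Bᴴ * J' = J * Bᴴ := by
      have := congrArg conjTranspose hB
      rwa [conjTranspose_mul, conjTranspose_mul, hJ.eq, hJ'.eq] at this
    simp [fromBlocks_multiply, hB, h1]
  · rw [hc hX hX', hc hC hC']
    have h1 := congrArg conjTranspose hAB
    rw [conjTranspose_sub, conjTranspose_mul, conjTranspose_mul, hJ.eq, hJ'.eq] at h1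
    rw [← h1, ← hAB]
    simp only [fromBlocks_multiply, fromBlocks_sub_fromBlocks]
    congr 1 <;> simp only [Matrix.mul_zero, Matrix.zero_mul, add_zero, zero_add, sub_self,
      Matrix.mul_assoc]

variable [DecidableEq κ]

theorem SecondOrder.frame {x y c : Matrix κ κ ℂ} (hx : x.IsHermitian) (hy : y.IsHermitian) {e : ℝ} (he : 0 < e)
    (h : SecondOrder (fromBlocks 0 1 1 0) (fromBlocks x 0 0 y) (fromBlocks c 0 0 (-c))
      (fromBlocks (-(2 * e : ℂ) • (1 : Matrix κ κ ℂ)) 0 0 ((2 * e : ℂ) • (1 : Matrix κ κ ℂ))))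
    {U H : Matrix κ κ ℂ} (hH : Hᴴ = -H)
    (hUH : (U * y - x * U) - (U * y - x * U)ᴴ = H * c + c * H) :
    2 * (Uᴴ * (U * y - x * U)).trace.re ≤ -(Hᴴ * (H * c + c * H)).trace.re := by
  have e1 : (U * y - x * U)ᴴ = y * Uᴴ - Uᴴ * x := by
    rw [conjTranspose_sub, conjTranspose_mul, conjTranspose_mul, hx.eq, hy.eq]
  generalize hM : U * y - x * U = M at *
  generalize hK : H * c + c * H = K at *
  have hAX : fromBlocks 0 U (-Uᴴ) 0 * fromBlocks x 0 0 y - fromBlocks x 0 0 y *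
      fromBlocks 0 U (-Uᴴ) 0 = fromBlocks 0 M Mᴴ 0 := by
    simp only [fromBlocks_multiply, fromBlocks_sub_fromBlocks]
    rw [e1, ← hM]
    congr 1 <;> simp
    abel
  have hBC : fromBlocks 0 (-H) (-H) 0 * fromBlocks c 0 0 (-c) - fromBlocks c 0 0 (-c) *
      fromBlocks 0 (-H) (-H) 0 = fromBlocks 0 K (-K) 0 := by
    simp only [fromBlocks_multiply, fromBlocks_sub_fromBlocks]
    congr 1 <;> simp [← hK]
    abel
  have hAD : fromBlocks 0 U (-Uᴴ) 0 * fromBlocks (-(2 * e : ℂ) • (1 : Matrix κ κ ℂ)) 0 0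
      ((2 * e : ℂ) • (1 : Matrix κ κ ℂ)) - fromBlocks (-(2 * e : ℂ) • (1 : Matrix κ κ ℂ)) 0 0
      ((2 * e : ℂ) • (1 : Matrix κ κ ℂ)) * fromBlocks 0 U (-Uᴴ) 0 =
      (4 * e : ℂ) • fromBlocks 0 U Uᴴ 0 := by
    simp only [fromBlocks_multiply, fromBlocks_sub_fromBlocks, fromBlocks_smul]
    congr 1 <;> simp <;> module
  have hBD : fromBlocks 0 (-H) (-H) 0 * fromBlocks (-(2 * e : ℂ) • (1 : Matrix κ κ ℂ)) 0 0
      ((2 * e : ℂ) • (1 : Matrix κ κ ℂ)) - fromBlocks (-(2 * e : ℂ) • (1 : Matrix κ κ ℂ)) 0 0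
      ((2 * e : ℂ) • (1 : Matrix κ κ ℂ)) * fromBlocks 0 (-H) (-H) 0 =
      (4 * e : ℂ) • fromBlocks 0 (-H) H 0 := by
    simp only [fromBlocks_multiply, fromBlocks_sub_fromBlocks, fromBlocks_smul]
    congr 1 <;> simp <;> module
  have key := h (fromBlocks 0 U (-Uᴴ) 0) (fromBlocks 0 (-H) (-H) 0)
    (by simp [fromBlocks_conjTranspose, fromBlocks_neg])
    (by simp [fromBlocks_conjTranspose, fromBlocks_neg, hH])
    (by simp [fromBlocks_multiply]) ?_
  · rw [hAX, hBC, hAD, hBD] at key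
    have t3 : (4 * e : ℂ) = ((4 * e : ℝ) : ℂ) := by push_cast; rfl
    have key2 : 2 * (4 * e * (2 * (Uᴴ * M).trace.re)) ≤ 4 * e * (2 * (H * K).trace.re) := by
      rw [t3] at key
      simp only [Matrix.smul_mul, trace_smul, smul_eq_mul, Complex.re_ofReal_mul,
        fromBlocks_multiply, trace_fromBlocks_eq, Matrix.zero_mul, zero_add, add_zero, Complex.add_re,
        re_trace_mul_conjTranspose, Matrix.neg_mul, Matrix.mul_neg, neg_neg] at key
      linarith
    rw [hH, Matrix.neg_mul, trace_neg, Complex.neg_re, neg_neg]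
    have : 0 < 4 * e * 2 := by positivity
    refine le_of_mul_le_mul_left ?_ this
    linarith
  · rw [hAX, hBC]
    have : fromBlocks 0 1 1 0 * fromBlocks 0 M Mᴴ 0 * fromBlocks 0 1 1 0 =
        fromBlocks 0 Mᴴ M (0 : Matrix κ κ ℂ) := by simp [fromBlocks_multiply]
    rw [this, fromBlocks_sub_fromBlocks, sub_self, hUH, ← neg_sub, hUH]

variable [DecidableEq τ]

theorem SecondOrder.cross {x y c : Matrix κ κ ℂ} {J X C D G : Matrix τ τ ℂ} {e : ℝ}
    (hx : x.IsHermitian) (hy : y.IsHermitian) (hc : c.IsHermitian) (hX : X.IsHermitian)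
    (hC : C.IsHermitian) (hD : D.IsHermitian) (hJ : J.IsHermitian) (hJJ : J * J = 1)
    (hJD : J * D = -(D * J)) (hJC : J * C = -(C * J))
    (hG : D + (2 * e : ℂ) • (1 : Matrix τ τ ℂ) = (2 : ℂ) • G)
    (h : SecondOrder (fromBlocks (fromBlocks 0 1 1 0) 0 0 J) (fromBlocks (fromBlocks x 0 0 y) 0 0 X)
      (fromBlocks (fromBlocks c 0 0 (-c)) 0 0 C)
      (fromBlocks (fromBlocks (-(2 * e : ℂ) • (1 : Matrix κ κ ℂ)) 0 0
        ((2 * e : ℂ) • (1 : Matrix κ κ ℂ))) 0 0 D)) {Z₁ Z₂ Z₃ : Matrix τ κ ℂ}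
    (h0 : (X * Z₁ - Z₁ * x) + (-(J * X * J) * Z₂ - Z₂ * (-y)) + (-C * Z₃ - Z₃ * (-c)) = 0) :
    ((G * Z₁)ᴴ * (X * Z₁ - Z₁ * x)).trace.re + ((G * Z₂)ᴴ * (-(J * X * J) * Z₂ - Z₂ * (-y))).trace.re
      + ((G * Z₃)ᴴ * (-C * Z₃ - Z₃ * (-c))).trace.re ≤ 0 := by
  have jj : ∀ Z : Matrix τ κ ℂ, J * (J * Z) = Z := fun Z => by
    rw [← Matrix.mul_assoc, hJJ, Matrix.one_mul]
  have jd : ∀ Z : Matrix τ κ ℂ, D * (J * Z) = -(J * (D * Z)) := fun Z => by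
    rw [← Matrix.mul_assoc, ← Matrix.mul_assoc, hJD, Matrix.neg_mul, neg_neg]
  have jc : ∀ Z : Matrix τ κ ℂ, C * (J * Z) = -(J * (C * Z)) := fun Z => by
    rw [← Matrix.mul_assoc, ← Matrix.mul_assoc, hJC, Matrix.neg_mul, neg_neg]
  have hG' : ∀ Z : Matrix τ κ ℂ, (2 * e : ℂ) • Z = (2 : ℂ) • (G * Z) - D * Z := fun Z => by
    rw [← Matrix.smul_mul, ← hG, Matrix.add_mul, Matrix.smul_mul, Matrix.one_mul, add_sub_cancel_left]
  generalize hL₁ : X * Z₁ - Z₁ * x = L₁ at *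
  generalize hL₂ : -(J * X * J) * Z₂ - Z₂ * (-y) = L₂ at *
  generalize hL₃ : -C * Z₃ - Z₃ * (-c) = L₃ at *
  have e1 : fromCols Z₁ (J * Z₂) * fromBlocks x 0 0 y - X * fromCols Z₁ (J * Z₂) =
      fromCols (-L₁) (J * L₂) := by
    rw [fromCols_mul_fromBlocks, mul_fromCols, fromCols_sub_fromCols, ← hL₁, ← hL₂]
    congr 1
    · simp
    · simp only [Matrix.mul_sub, Matrix.neg_mul, Matrix.mul_neg, Matrix.mul_assoc, jj,
        Matrix.mul_zero, zero_add]
      abel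
  have e2 : fromCols Z₃ (J * Z₃) * fromBlocks c 0 0 (-c) - C * fromCols Z₃ (J * Z₃) =
      fromCols L₃ (-(J * L₃)) := by
    rw [fromCols_mul_fromBlocks, mul_fromCols, fromCols_sub_fromCols, ← hL₃]
    congr 1
    · simp
      abel
    · simp only [Matrix.mul_sub, Matrix.neg_mul, Matrix.mul_neg, Matrix.mul_assoc, jc,
        Matrix.mul_zero, zero_add]
      abel
  have e3 : ∀ Z Z' : Matrix τ κ ℂ, fromCols Z (J * Z') * fromBlocks (-(2 * e : ℂ) •
      (1 : Matrix κ κ ℂ)) 0 0 ((2 * e : ℂ) • (1 : Matrix κ κ ℂ)) - D * fromCols Z (J * Z') =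
      (2 : ℂ) • fromCols (-(G * Z)) (J * (G * Z')) := by
    intro Z Z'
    rw [fromCols_mul_fromBlocks, mul_fromCols, fromCols_sub_fromCols]
    have : (2 : ℂ) • fromCols (-(G * Z)) (J * (G * Z')) =
        fromCols ((2 : ℂ) • -(G * Z)) ((2 : ℂ) • (J * (G * Z'))) := by
      ext i (j | j) <;> rfl
    rw [this]
    congr 1
    · simp only [Matrix.mul_smul, Matrix.mul_one, Matrix.mul_zero, add_zero, neg_smul,
        Matrix.mul_neg, hG', smul_neg]
      abel
    · simp only [Matrix.mul_smul, Matrix.mul_one, Matrix.mul_zero, zero_add, jd]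
      rw [← Matrix.mul_smul J (2 * e : ℂ), hG', Matrix.mul_sub, Matrix.mul_smul]
      abel
  have herm : ∀ {u v : Matrix κ κ ℂ}, u.IsHermitian → v.IsHermitian →
      (fromBlocks u 0 0 v).IsHermitian := fun hu hv => by
    simp [IsHermitian, fromBlocks_conjTranspose, hu.eq, hv.eq]
  have hr : ∀ t : ℝ, ((2 * t : ℂ) • (1 : Matrix κ κ ℂ)).IsHermitian := fun t => by
    simp [IsHermitian, conjTranspose_smul]
  have key := h.offDiag (A := fromCols Z₁ (J * Z₂)) (B := fromCols Z₃ (J * Z₃)) (herm hx hy) hX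
    (herm hc hc.neg) hC (herm (by rw [neg_smul]; exact (hr e).neg) (hr e)) hD
    (by simp [IsHermitian, fromBlocks_conjTranspose]) hJ ?_ ?_
  · rw [e1, e2, e3, e3, conjTranspose_smul, conjTranspose_smul, Matrix.smul_mul, Matrix.smul_mul,
      trace_smul, trace_smul, trace_fromCols_conjTranspose_mul,
      trace_fromCols_conjTranspose_mul] at key
    have hJ2 : ∀ P Q : Matrix τ κ ℂ, (J * P)ᴴ * (J * Q) = Pᴴ * Q := fun P Q => by
      rw [conjTranspose_mul, hJ.eq, Matrix.mul_assoc, jj]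
    simp only [hJ2, conjTranspose_neg, Matrix.neg_mul, Matrix.mul_neg, neg_neg, trace_neg,
      star_ofNat, smul_eq_mul, Complex.mul_re, Complex.add_re, Complex.neg_re, Complex.re_ofNat,
      Complex.im_ofNat, zero_mul, sub_zero] at key
    linarith
  · rw [mul_fromCols, fromCols_mul_fromBlocks, jj]
    simp
  · rw [e1, e2, mul_fromCols, fromCols_mul_fromBlocks, fromCols_sub_fromCols, jj]
    have h3 : L₃ = -L₁ - L₂ := by rw [← sub_eq_zero, ← h0]; abel
    rw [h3]
    simp only [Matrix.mul_zero, Matrix.mul_one, zero_add, add_zero, Matrix.mul_sub, Matrix.mul_neg]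
    congr 1
    abel

end BlockConditions

section SpectralForm

variable {ι κ : Type*} [Fintype ι] [Fintype κ] [DecidableEq ι] [DecidableEq κ]

theorem spectral_comm_eq {A T : Matrix ι ι ℂ} {B R : Matrix κ κ ℂ} {α : ι → ℝ} {β : κ → ℝ}
    (hT : T * Tᴴ = 1) (hA : A = T * diagonal (fun i => (α i : ℂ)) * Tᴴ)
    (hR : R * Rᴴ = 1) (hB : B = R * diagonal (fun i => (β i : ℂ)) * Rᴴ) (φ : Matrix ι κ ℂ) :
    A * φ - φ * B = T * (of fun i j => ((α i - β j : ℝ) : ℂ) * (Tᴴ * φ * R) i j) * Rᴴ := by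
  have h : (of fun i j => ((α i - β j : ℝ) : ℂ) * (Tᴴ * φ * R) i j) =
      diagonal (fun i => (α i : ℂ)) * (Tᴴ * φ * R) - (Tᴴ * φ * R) * diagonal fun i => (β i : ℂ) := by
    ext i j
    rw [Matrix.sub_apply, diagonal_mul, mul_diagonal, of_apply]
    push_cast
    ring
  have h1 : φ * R * Rᴴ = φ := by rw [Matrix.mul_assoc, hR, Matrix.mul_one]
  have h2 : T * (Tᴴ * (φ * B)) = φ * B := by rw [← Matrix.mul_assoc, hT, Matrix.one_mul]
  rw [h, Matrix.mul_sub, Matrix.sub_mul, ← h2, hB, hA]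
  conv_lhs => rw [← h1]
  simp only [Matrix.mul_assoc]
  rw [← Matrix.mul_assoc Rᴴ R, mul_eq_one_comm.1 hR, Matrix.one_mul]

theorem isHermitian_of_spectral {A T : Matrix ι ι ℂ} {α : ι → ℝ}
    (hA : A = T * diagonal (fun i => (α i : ℂ)) * Tᴴ) : A.IsHermitian := by
  rw [hA]
  refine isHermitian_mul_mul_conjTranspose T (isHermitian_diagonal_of_self_adjoint _ ?_)
  ext i
  simp

theorem spectral_form {A T : Matrix ι ι ℂ} {B R : Matrix κ κ ℂ} {α : ι → ℝ} {β : κ → ℝ}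
    (hT : T * Tᴴ = 1) (hA : A = T * diagonal (fun i => (α i : ℂ)) * Tᴴ)
    (hR : R * Rᴴ = 1) (hB : B = R * diagonal (fun i => (β i : ℂ)) * Rᴴ) (φ : Matrix ι κ ℂ) :
    (φᴴ * (A * φ - φ * B)).trace.re =
      ∑ i, ∑ j, (α i - β j) * Complex.normSq ((Tᴴ * φ * R) i j) := by
  rw [spectral_comm_eq hT hA hR hB]
  have : (φᴴ * (T * (of fun i j => ((α i - β j : ℝ) : ℂ) * (Tᴴ * φ * R) i j) * Rᴴ)).trace =
      ((Tᴴ * φ * R)ᴴ * of fun i j => ((α i - β j : ℝ) : ℂ) * (Tᴴ * φ * R) i j).trace := by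
    rw [← Matrix.mul_assoc, trace_mul_comm, conjTranspose_mul, conjTranspose_mul,
      conjTranspose_conjTranspose]
    simp only [Matrix.mul_assoc]
  rw [this]
  generalize Tᴴ * φ * R = Z
  rw [trace, Complex.re_sum, Finset.sum_comm]
  refine Finset.sum_congr rfl fun j _ => ?_
  rw [diag_apply, Matrix.mul_apply, Complex.re_sum]
  refine Finset.sum_congr rfl fun i _ => ?_
  rw [of_apply, conjTranspose_apply, Complex.normSq_apply]
  simp
  ring

theorem spectral_transpose {B R : Matrix κ κ ℂ} {β : κ → ℝ}
    (hR : R * Rᴴ = 1) (hB : B = R * diagonal (fun i => (β i : ℂ)) * Rᴴ) :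
    Rᴴᵀ * Rᴴᵀᴴ = 1 ∧ Bᵀ = Rᴴᵀ * diagonal (fun i => (β i : ℂ)) * Rᴴᵀᴴ := by
  have h : Rᴴᵀᴴ = Rᵀ := by
    ext i j
    simp
  rw [h]
  constructor
  · rw [← transpose_mul, hR, transpose_one]
  · rw [hB, transpose_mul, transpose_mul, diagonal_transpose, Matrix.mul_assoc]

end SpectralForm

section DiagonalPair

variable {r : ℕ} {x y Tx Ty : Matrix (Fin r) (Fin r) ℂ} {c α β : Fin r → ℝ} {e : ℝ}

theorem skew_card_le (hTx : Tx * Txᴴ = 1) (hx : x = Tx * diagonal (fun i => (α i : ℂ)) * Txᴴ)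
    (hTy : Ty * Tyᴴ = 1) (hy : y = Ty * diagonal (fun i => (β i : ℂ)) * Tyᴴ)
    (h : ∀ U H : Matrix (Fin r) (Fin r) ℂ, Hᴴ = -H →
      (U * y - x * U) - (U * y - x * U)ᴴ = H * diagonal (fun i => (c i : ℂ)) +
        diagonal (fun i => (c i : ℂ)) * H → 2 * (Uᴴ * (U * y - x * U)).trace.re ≤
          -(Hᴴ * (H * diagonal (fun i => (c i : ℂ)) +
            diagonal (fun i => (c i : ℂ)) * H)).trace.re) :
    2 * (Finset.univ.filter fun p : Fin r × Fin r => α p.1 < β p.2).card ≤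
      (Finset.univ.filter fun p : Fin r × Fin r => c p.1 + c p.2 ≤ 0).card := by
  classical
  by_contra! hlt
  set P := Finset.univ.filter fun p : Fin r × Fin r => α p.1 < β p.2 with hP
  set S := Finset.univ.filter fun p : Fin r × Fin r => c p.1 + c p.2 ≤ 0 with hS
  let E : (P → ℂ) →ₗ[ℝ] Matrix (Fin r) (Fin r) ℂ :=
    { toFun := fun f => of fun i j => if h : (i, j) ∈ P then f ⟨(i, j), h⟩ else 0
      map_add' := fun f g => by
        ext i j
        simp only [of_apply, Matrix.add_apply]
        split_ifs <;> simp
      map_smul' := fun a f => by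
        ext i j
        simp only [of_apply, Matrix.smul_apply, RingHom.id_apply]
        split_ifs <;> simp }
  let M : (P → ℂ) → Matrix (Fin r) (Fin r) ℂ := fun f =>
    (Tx * E f * Tyᴴ) * y - x * (Tx * E f * Tyᴴ)
  let Φ : (P → ℂ) →ₗ[ℝ] (S → ℝ) :=
    { toFun := fun f p => ((M f - (M f)ᴴ) p.1.1 p.1.2).re + ((M f - (M f)ᴴ) p.1.1 p.1.2).im
      map_add' := fun f g => by
        have : M (f + g) = M f + M g := by
          simp only [M, map_add, Matrix.mul_add, Matrix.add_mul]
          abel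
        ext p
        simp [this]
        ring
      map_smul' := fun a f => by
        have : M (a • f) = a • M f := by
          simp only [M, map_smul, Matrix.mul_smul, Matrix.smul_mul, smul_sub]
        ext p
        simp [this]
        ring }
  have hker : LinearMap.ker Φ ≠ ⊥ := by
    apply LinearMap.ker_ne_bot_of_finrank_lt
    rw [Module.finrank_fintype_fun_eq_card, Module.finrank_pi_fintype]
    simpa [mul_comm] using hlt
  obtain ⟨f, hf, hf0⟩ := Submodule.exists_mem_ne_zero_of_ne_bot hker
  have hf' : ∀ p : S, ((M f - (M f)ᴴ) p.1.1 p.1.2).re + ((M f - (M f)ᴴ) p.1.1 p.1.2).im = 0 :=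
    fun p => congrFun (LinearMap.mem_ker.1 hf) p
  set W := M f - (M f)ᴴ with hW
  have hskew : ∀ k l, W l k = -star (W k l) := fun k l => by
    simp [hW, conjTranspose_apply]
  have hW0 : ∀ k l, c k + c l ≤ 0 → W k l = 0 := fun k l hkl => by
    have h1 := hf' ⟨(k, l), by simpa [hS] using hkl⟩
    have h2 := hf' ⟨(l, k), by simpa [hS, add_comm] using hkl⟩
    simp only [hskew k l] at h1 h2
    simp only [Complex.neg_re, Complex.neg_im, Complex.star_def, Complex.conj_re,
      Complex.conj_im] at h2
    apply Complex.ext <;> simp only [Complex.zero_re, Complex.zero_im] <;> linarith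
  let H : Matrix (Fin r) (Fin r) ℂ := of fun k l =>
    if c k + c l ≤ 0 then 0 else W k l / ((c k + c l : ℝ) : ℂ)
  have hH : Hᴴ = -H := by
    ext k l
    simp only [conjTranspose_apply, H, of_apply, Matrix.neg_apply, add_comm (c l) (c k)]
    split_ifs
    · simp
    · rw [hskew l k, star_div₀]
      simp [neg_div]
  have hHc : W = H * diagonal (fun i => (c i : ℂ)) + diagonal (fun i => (c i : ℂ)) * H := by
    ext k l
    rw [Matrix.add_apply, mul_diagonal, diagonal_mul]
    simp only [H, of_apply]
    split_ifs with hkl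
    · rw [hW0 k l hkl]
      simp
    · have : ((c k + c l : ℝ) : ℂ) ≠ 0 := by
        exact_mod_cast (not_le.1 hkl).ne'
      rw [mul_comm _ (c l : ℂ), ← add_mul, mul_div_assoc', eq_div_iff this]
      push_cast
      ring
  have key := h (Tx * E f * Tyᴴ) H hH hHc
  have t1 : (H * diagonal (fun i => (c i : ℂ)) + diagonal (fun i => (c i : ℂ)) * H) =
      diagonal (fun i => (c i : ℂ)) * H - H * diagonal (fun i => ((-c i : ℝ) : ℂ)) := by
    ext k l
    simp [add_comm]
  rw [t1, spectral_form (T := 1) (R := 1) (α := c) (β := fun i => -c i) (by simp) (by simp)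
    (by simp) (by simp), ← neg_sub, Matrix.mul_neg, trace_neg, Complex.neg_re,
    spectral_form hTx hx hTy hy] at key
  have t2 : Txᴴ * (Tx * E f * Tyᴴ) * Ty = E f := by
    rw [show Txᴴ * (Tx * E f * Tyᴴ) * Ty = (Txᴴ * Tx) * E f * (Tyᴴ * Ty) by
      simp only [Matrix.mul_assoc], mul_eq_one_comm.1 hTx, mul_eq_one_comm.1 hTy, Matrix.one_mul,
      Matrix.mul_one]
  rw [t2] at key
  simp only [conjTranspose_one, Matrix.one_mul, Matrix.mul_one, sub_neg_eq_add] at key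
  have hpos : 0 ≤ ∑ i, ∑ j, (c i + c j) * Complex.normSq (H i j) := by
    refine Finset.sum_nonneg fun i _ => Finset.sum_nonneg fun j _ => ?_
    by_cases hij : c i + c j ≤ 0
    · simp [H, hij]
    · exact mul_nonneg (by linarith) (Complex.normSq_nonneg _)
  obtain ⟨p, hp⟩ := Function.ne_iff.1 hf0
  have hterm : ∀ i j, (α i - β j) * Complex.normSq (E f i j) ≤ 0 := fun i j => by
    by_cases hij : α i < β j
    · exact mul_nonpos_of_nonpos_of_nonneg (by linarith) (Complex.normSq_nonneg _)
    · have : E f i j = 0 := dif_neg (by simpa [hP] using hij)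
      simp [this]
  have hneg : ∑ i, ∑ j, (α i - β j) * Complex.normSq (E f i j) < 0 := by
    have hp2 : α p.1.1 < β p.1.2 := (Finset.mem_filter.1 p.2).2
    have hEp : E f p.1.1 p.1.2 = f p := dif_pos p.2
    refine Finset.sum_neg' (fun i _ => Finset.sum_nonpos fun j _ => hterm i j)
      ⟨p.1.1, Finset.mem_univ _, Finset.sum_neg' (fun j _ => hterm _ j)
        ⟨p.1.2, Finset.mem_univ _, ?_⟩⟩
    rw [hEp]
    exact mul_neg_of_neg_of_pos (by linarith) (Complex.normSq_pos.2 hp)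
  linarith

theorem symm_card_le (he : 0 < e) (hTx : Tx * Txᴴ = 1)
    (hx : x = Tx * diagonal (fun i => (α i : ℂ)) * Txᴴ)
    (hTy : Ty * Tyᴴ = 1) (hy : y = Ty * diagonal (fun i => (β i : ℂ)) * Tyᴴ)
    (hxy : x - y = diagonal (fun i => ((c i - 2 * e : ℝ) : ℂ))) :
    (Finset.univ.filter fun p : Fin r × Fin r => c p.1 + c p.2 ≤ 0 ∧ p.1 ≤ p.2).card ≤
      (Finset.univ.filter fun p : Fin r × Fin r => α p.1 < β p.2).card := by
  classical
  by_contra! hlt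
  set P := Finset.univ.filter fun p : Fin r × Fin r => α p.1 < β p.2 with hP
  set S := Finset.univ.filter fun p : Fin r × Fin r => c p.1 + c p.2 ≤ 0 ∧ p.1 ≤ p.2 with hS
  let E : (S → ℂ) →ₗ[ℂ] Matrix (Fin r) (Fin r) ℂ :=
    { toFun := fun f => of fun i j => if h : (i, j) ∈ S then f ⟨(i, j), h⟩ else 0
      map_add' := fun f g => by
        ext i j
        simp only [of_apply, Matrix.add_apply]
        split_ifs <;> simp
      map_smul' := fun a f => by
        ext i j
        simp only [of_apply, Matrix.smul_apply, RingHom.id_apply]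
        split_ifs <;> simp }
  let Φ : (S → ℂ) →ₗ[ℂ] (P → ℂ) :=
    { toFun := fun f p => (Txᴴ * (E f + (E f)ᵀ) * Tyᴴᵀ) p.1.1 p.1.2
      map_add' := fun f g => by
        ext p
        simp only [map_add, Matrix.mul_add, Matrix.add_mul, Matrix.add_apply, Pi.add_apply,
          transpose_add]
        ring
      map_smul' := fun a f => by
        ext p
        simp [Matrix.mul_add, Matrix.add_mul]
        ring }
  have hker : LinearMap.ker Φ ≠ ⊥ := by
    apply LinearMap.ker_ne_bot_of_finrank_lt
    simpa using hlt
  obtain ⟨f, hf, hf0⟩ := Submodule.exists_mem_ne_zero_of_ne_bot hker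
  have hf' : ∀ p : P, (Txᴴ * (E f + (E f)ᵀ) * Tyᴴᵀ) p.1.1 p.1.2 = 0 :=
    fun p => congrFun (LinearMap.mem_ker.1 hf) p
  obtain ⟨p, hp⟩ := Function.ne_iff.1 hf0
  have hB0 : (E f + (E f)ᵀ) p.1.1 p.1.2 ≠ 0 := by
    have h1 : E f p.1.1 p.1.2 = f p := dif_pos p.2
    rw [Matrix.add_apply, transpose_apply, h1]
    rcases eq_or_ne p.1.1 p.1.2 with h2 | h2
    · rw [← h2] at h1 ⊢
      rw [h1, ← two_mul]
      exact mul_ne_zero two_ne_zero hp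
    · have h3 : E f p.1.2 p.1.1 = 0 := dif_neg fun h4 =>
        h2 (le_antisymm (Finset.mem_filter.1 p.2).2.2 (Finset.mem_filter.1 h4).2.2)
      rw [h3, add_zero]
      exact hp
  have hBS : ∀ k l, 0 < c k + c l → (E f + (E f)ᵀ) k l = 0 := fun k l hkl => by
    have h1 : E f k l = 0 := dif_neg fun h => absurd (Finset.mem_filter.1 h).2.1 (not_le.2 hkl)
    have h2 : E f l k = 0 := dif_neg fun h =>
      absurd (Finset.mem_filter.1 h).2.1 (not_le.2 (by rw [add_comm]; exact hkl))
    rw [Matrix.add_apply, transpose_apply, h1, h2, add_zero]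
  have hBT : (E f + (E f)ᵀ)ᵀ = E f + (E f)ᵀ := by
    rw [transpose_add, transpose_transpose, add_comm]
  have hpS := (Finset.mem_filter.1 p.2).2.1
  generalize E f + (E f)ᵀ = B at hf' hB0 hBS hBT
  obtain ⟨hR, hyR⟩ := spectral_transpose hTy hy
  have h1 := spectral_form hTx hx hR hyR B
  have h2 : 0 ≤ (Bᴴ * (x * B - B * yᵀ)).trace.re := by
    rw [h1]
    refine Finset.sum_nonneg fun i _ => Finset.sum_nonneg fun j _ => ?_
    by_cases hij : α i < β j
    · have := hf' ⟨(i, j), by simpa [hP] using hij⟩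
      simp only at this
      simp [this]
    · exact mul_nonneg (by linarith) (Complex.normSq_nonneg _)
  have h3 : (Bᴴ * (B * yᵀ)).trace = (Bᴴ * (y * B)).trace := by
    have hBs : Bᴴᵀ = Bᴴ := by
      ext i j
      rw [transpose_apply, conjTranspose_apply, conjTranspose_apply]
      exact congrArg star (congrFun (congrFun hBT j) i)
    rw [← trace_transpose, transpose_mul, transpose_mul, transpose_transpose, hBT, hBs,
      trace_mul_comm]
  have h4 : (Bᴴ * (x * B - B * yᵀ)).trace.re =
      ∑ i, ∑ j, (c i - 2 * e) * Complex.normSq (B i j) := by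
    rw [Matrix.mul_sub, trace_sub, h3, ← trace_sub, ← Matrix.mul_sub, ← Matrix.sub_mul, hxy]
    have := spectral_form (T := (1 : Matrix (Fin r) (Fin r) ℂ))
      (R := (1 : Matrix (Fin r) (Fin r) ℂ)) (A := diagonal fun i => ((c i - 2 * e : ℝ) : ℂ))
      (B := 0) (α := fun i => c i - 2 * e) (β := fun _ => 0) (by simp) (by simp) (by simp)
      (by simp) B
    simpa using this
  have hBT' : ∀ i j, B j i = B i j := fun i j => congrFun (congrFun hBT i) j
  have h5 : ∑ i, ∑ j, (c i - 2 * e) * Complex.normSq (B i j) =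
      ∑ i, ∑ j, (c j - 2 * e) * Complex.normSq (B i j) := by
    rw [Finset.sum_comm]
    simp only [hBT']
  have h6 : ∑ i, ∑ j, (c i + c j - 4 * e) * Complex.normSq (B i j) < 0 := by
    have ht : ∀ i j, (c i + c j - 4 * e) * Complex.normSq (B i j) ≤ 0 := fun i j => by
      by_cases hij : 0 < c i + c j
      · simp [hBS i j hij]
      · exact mul_nonpos_of_nonpos_of_nonneg (by linarith) (Complex.normSq_nonneg _)
    refine Finset.sum_neg' (fun i _ => Finset.sum_nonpos fun j _ => ht i j)
      ⟨p.1.1, Finset.mem_univ _, Finset.sum_neg' (fun j _ => ht _ j)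
        ⟨p.1.2, Finset.mem_univ _, ?_⟩⟩
    exact mul_neg_of_neg_of_pos (by linarith) (Complex.normSq_pos.2 hB0)
  have h7 : ∑ i, ∑ j, (c i + c j - 4 * e) * Complex.normSq (B i j) =
      ∑ i, ∑ j, (c i - 2 * e) * Complex.normSq (B i j) +
        ∑ i, ∑ j, (c j - 2 * e) * Complex.normSq (B i j) := by
    simp only [← Finset.sum_add_distrib]
    refine Finset.sum_congr rfl fun i _ => Finset.sum_congr rfl fun j _ => ?_
    ring
  linarith

theorem pos_and_le_of_secondOrder (he : 0 < e) (hTx : Tx * Txᴴ = 1)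
    (hx : x = Tx * diagonal (fun i => (α i : ℂ)) * Txᴴ)
    (hTy : Ty * Tyᴴ = 1) (hy : y = Ty * diagonal (fun i => (β i : ℂ)) * Tyᴴ)
    (hxy : x - y = diagonal (fun i => ((c i - 2 * e : ℝ) : ℂ)))
    (h : SecondOrder (fromBlocks 0 1 1 0) (fromBlocks x 0 0 y)
      (fromBlocks (diagonal fun i => (c i : ℂ)) 0 0 (-diagonal fun i => (c i : ℂ)))
      (fromBlocks (-(2 * e : ℂ) • (1 : Matrix (Fin r) (Fin r) ℂ)) 0 0
        ((2 * e : ℂ) • (1 : Matrix (Fin r) (Fin r) ℂ)))) :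
    (∀ k, 0 < c k) ∧ ∀ i j, β j ≤ α i := by
  have hxH : x.IsHermitian := isHermitian_of_spectral hx
  have hyH : y.IsHermitian := isHermitian_of_spectral hy
  have h1 := skew_card_le (c := c) hTx hx hTy hy fun U H hH hUH => h.frame hxH hyH he hH hUH
  have h2 := symm_card_le he hTx hx hTy hy hxy
  set P := Finset.univ.filter fun p : Fin r × Fin r => α p.1 < β p.2 with hP
  set S := Finset.univ.filter fun p : Fin r × Fin r => c p.1 + c p.2 ≤ 0 with hS
  set T := Finset.univ.filter fun p : Fin r × Fin r => c p.1 + c p.2 ≤ 0 ∧ p.1 ≤ p.2 with hT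
  have hST : S = T ∪ T.map (Equiv.prodComm _ _).toEmbedding := by
    ext ⟨k, l⟩
    simp only [hS, hT, Finset.mem_filter, Finset.mem_univ, true_and, Finset.mem_union,
      Finset.mem_map_equiv, Equiv.prodComm_symm, Equiv.prodComm_apply, Prod.swap_prod_mk]
    rw [add_comm (c l), ← and_or_left]
    exact ⟨fun h => ⟨h, le_total k l⟩, fun h => h.1⟩
  have hcard := Finset.card_union_add_card_inter T (T.map (Equiv.prodComm _ _).toEmbedding)
  rw [← hST, Finset.card_map] at hcard
  have hc : ∀ k, 0 < c k := fun k => by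
    by_contra! hk
    have : 0 < (T ∩ T.map (Equiv.prodComm _ _).toEmbedding).card :=
      Finset.card_pos.2 ⟨(k, k), by
        simp only [hT, Finset.mem_inter, Finset.mem_filter, Finset.mem_univ, true_and,
          Finset.mem_map_equiv, Equiv.prodComm_symm, Equiv.prodComm_apply, Prod.swap_prod_mk,
          le_refl, and_true, and_self]
        linarith⟩
    omega
  refine ⟨hc, fun i j => ?_⟩
  have hS0 : S = ∅ := Finset.filter_eq_empty_iff.2 fun p _ => by
    have := hc p.1
    have := hc p.2
    linarith
  have hP0 : P.card = 0 := by
    rw [hS0, Finset.card_empty] at h1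
    omega
  by_contra! hij
  exact Finset.notMem_empty (i, j) (Finset.card_eq_zero.1 hP0 ▸ by simpa [hP] using hij)

end DiagonalPair

section WeightedForm

variable {ι κ : Type*} [Fintype ι] [Fintype κ]

theorem trace_conjTranspose_mul_mul (G : Matrix ι ι ℂ) (U : Matrix ι κ ℂ) :
    (Uᴴ * (G * U)).trace.re = ∑ j, (star (Uᵀ j) ⬝ᵥ G *ᵥ (Uᵀ j)).re := by
  rw [trace, Complex.re_sum]
  refine Finset.sum_congr rfl fun j _ => congrArg Complex.re ?_
  rw [diag_apply, Matrix.mul_apply]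
  rfl

theorem form_nonneg {G : Matrix ι ι ℂ} (hG : ∀ ψ : ι → ℂ, ψ ≠ 0 → 0 < (star ψ ⬝ᵥ G *ᵥ ψ).re) (ψ : ι → ℂ) :
    0 ≤ (star ψ ⬝ᵥ G *ᵥ ψ).re := by
  rcases eq_or_ne ψ 0 with rfl | h
  · simp
  · exact (hG ψ h).le

theorem trace_form_nonneg {G : Matrix ι ι ℂ} (hG : ∀ ψ : ι → ℂ, ψ ≠ 0 → 0 < (star ψ ⬝ᵥ G *ᵥ ψ).re)
    (U : Matrix ι κ ℂ) : 0 ≤ (Uᴴ * (G * U)).trace.re := by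
  rw [trace_conjTranspose_mul_mul]
  exact Finset.sum_nonneg fun j _ => form_nonneg hG _

theorem eq_zero_of_trace_form {G : Matrix ι ι ℂ} (hG : ∀ ψ : ι → ℂ, ψ ≠ 0 → 0 < (star ψ ⬝ᵥ G *ᵥ ψ).re)
    {U : Matrix ι κ ℂ} (h : (Uᴴ * (G * U)).trace.re = 0) : U = 0 := by
  rw [trace_conjTranspose_mul_mul] at h
  have h1 := (Finset.sum_eq_zero_iff_of_nonneg fun j _ => form_nonneg hG _).1 h
  ext i j
  by_contra hij
  have : Uᵀ j ≠ 0 := fun h0 => hij (congrFun h0 i)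
  exact (hG _ this).ne' (h1 j (Finset.mem_univ _))

variable [DecidableEq ι] [DecidableEq κ]

theorem re_trace_conjTranspose_mul_self (φ : Matrix ι κ ℂ) :
    (φᴴ * φ).trace.re = ∑ i, ∑ j, Complex.normSq (φ i j) := by
  have := spectral_form (T := (1 : Matrix ι ι ℂ)) (R := (1 : Matrix κ κ ℂ)) (A := 1) (B := 0)
    (α := 1) (β := 0) (by simp) (by simp) (by simp) (by simp) φ
  simpa using this

theorem eq_zero_of_re_trace_nonpos {φ : Matrix ι κ ℂ} (h : (φᴴ * φ).trace.re ≤ 0) : φ = 0 := by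
  rw [re_trace_conjTranspose_mul_self] at h
  have h1 := le_antisymm h (Finset.sum_nonneg fun i _ => Finset.sum_nonneg fun j _ =>
    Complex.normSq_nonneg (φ i j))
  ext i j
  have h2 := (Finset.sum_eq_zero_iff_of_nonneg fun i _ => Finset.sum_nonneg fun j _ =>
    Complex.normSq_nonneg (φ i j)).1 h1 i (Finset.mem_univ _)
  exact Complex.normSq_eq_zero.1 ((Finset.sum_eq_zero_iff_of_nonneg fun j _ =>
    Complex.normSq_nonneg (φ i j)).1 h2 j (Finset.mem_univ _))

variable {G : Matrix ι ι ℂ}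

theorem weighted_form {A T : Matrix ι ι ℂ} {B R : Matrix κ κ ℂ} {α : ι → ℝ} {β : κ → ℝ}
    (hT : T * Tᴴ = 1) (hA : A = T * diagonal (fun i => (α i : ℂ)) * Tᴴ)
    (hR : R * Rᴴ = 1) (hB : B = R * diagonal (fun i => (β i : ℂ)) * Rᴴ)
    (hGh : G.IsHermitian) (hGA : G * A = A * G) {φ : Matrix ι κ ℂ} {σ : ℝ}
    (hφ : ∀ i j, σ * (α i - β j) < 0 → (Tᴴ * φ * R) i j = 0) :
    σ * ((G * φ)ᴴ * (A * φ - φ * B)).trace.re =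
      ((T * of fun i j => (√(σ * (α i - β j)) : ℂ) * (Tᴴ * φ * R) i j)ᴴ *
        (G * (T * of fun i j => (√(σ * (α i - β j)) : ℂ) * (Tᴴ * φ * R) i j))).trace.re := by
  have hTT := mul_eq_one_comm.1 hT
  have hφ' : φ = T * (Tᴴ * φ * R) * Rᴴ := by
    rw [show T * (Tᴴ * φ * R) * Rᴴ = (T * Tᴴ) * φ * (R * Rᴴ) by simp only [Matrix.mul_assoc],
      hT, hR, Matrix.one_mul, Matrix.mul_one]
  rw [spectral_comm_eq hT hA hR hB]
  have hcomm : ∀ i j, α i ≠ α j → (Tᴴ * G * T) i j = 0 := by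
    intro i j hij
    have h1 : (Tᴴ * G * T) * diagonal (fun i => (α i : ℂ)) =
        diagonal (fun i => (α i : ℂ)) * (Tᴴ * G * T) := by
      have h2 : diagonal (fun i => (α i : ℂ)) = Tᴴ * A * T := by
        rw [hA, show Tᴴ * (T * diagonal (fun i => (α i : ℂ)) * Tᴴ) * T = (Tᴴ * T) *
          diagonal (fun i => (α i : ℂ)) * (Tᴴ * T) by simp only [Matrix.mul_assoc], hTT,
          Matrix.one_mul, Matrix.mul_one]
      rw [h2, show Tᴴ * G * T * (Tᴴ * A * T) = Tᴴ * G * (T * Tᴴ) * A * T by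
        simp only [Matrix.mul_assoc], show Tᴴ * A * T * (Tᴴ * G * T) = Tᴴ * A * (T * Tᴴ) * G * T by
        simp only [Matrix.mul_assoc], hT, Matrix.mul_one, Matrix.mul_one, Matrix.mul_assoc Tᴴ, hGA]
      simp only [Matrix.mul_assoc]
    have h3 := congrFun (congrFun h1 i) j
    rw [mul_diagonal, diagonal_mul, mul_comm, ← sub_eq_zero, ← sub_mul, mul_eq_zero] at h3
    refine h3.resolve_left (sub_ne_zero.2 ?_)
    exact_mod_cast Ne.symm hij
  generalize hZ : Tᴴ * φ * R = Z at *
  have e1 : ((G * φ)ᴴ * (T * (of fun i j => ((α i - β j : ℝ) : ℂ) * Z i j) * Rᴴ)).trace =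
      (Zᴴ * ((Tᴴ * G * T) * of fun i j => ((α i - β j : ℝ) : ℂ) * Z i j)).trace := by
    rw [← Matrix.mul_assoc, trace_mul_comm, conjTranspose_mul, hGh.eq]
    conv_lhs => rw [hφ']
    generalize (of fun i j => ((α i - β j : ℝ) : ℂ) * Z i j) = Y
    rw [conjTranspose_mul, conjTranspose_mul, conjTranspose_conjTranspose,
      show Rᴴ * (R * (Zᴴ * Tᴴ) * G * (T * Y)) = (Rᴴ * R) * (Zᴴ * (Tᴴ * G * T * Y)) by
        simp only [Matrix.mul_assoc], mul_eq_one_comm.1 hR, Matrix.one_mul]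
  have e2 : ∀ Y : Matrix ι κ ℂ, ((T * Y)ᴴ * (G * (T * Y))).trace =
      (Yᴴ * ((Tᴴ * G * T) * Y)).trace := fun Y => by
    rw [conjTranspose_mul]
    simp only [Matrix.mul_assoc]
  rw [e1, e2, ← Complex.re_ofReal_mul]
  congr 1
  generalize Tᴴ * G * T = K at *
  simp only [trace, diag_apply, Matrix.mul_apply, Finset.mul_sum, conjTranspose_apply, of_apply]
  refine Finset.sum_congr rfl fun j _ => Finset.sum_congr rfl fun i _ =>
    Finset.sum_congr rfl fun t _ => ?_
  rcases ne_or_eq (α i) (α t) with hit | hit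
  · rw [hcomm i t hit]
    ring
  · rcases lt_or_ge (σ * (α i - β j)) 0 with h | h
    · rw [hφ i j h]
      simp
    · rw [hit] at h ⊢
      have h4 : ((√(σ * (α t - β j)) : ℝ) : ℂ) * ((√(σ * (α t - β j)) : ℝ) : ℂ) =
          (σ : ℂ) * ((α t - β j : ℝ) : ℂ) := by
        rw [← Complex.ofReal_mul, Real.mul_self_sqrt h, Complex.ofReal_mul]
      simp only [star_mul', Complex.star_def, Complex.conj_ofReal]
      linear_combination ((starRingEnd ℂ) (Z i j) * K i t * Z t j) * (-h4)

theorem weighted_form_nonneg {A T : Matrix ι ι ℂ} {B R : Matrix κ κ ℂ} {α : ι → ℝ} {β : κ → ℝ}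
    (hT : T * Tᴴ = 1) (hA : A = T * diagonal (fun i => (α i : ℂ)) * Tᴴ)
    (hR : R * Rᴴ = 1) (hB : B = R * diagonal (fun i => (β i : ℂ)) * Rᴴ)
    (hGh : G.IsHermitian) (hG : ∀ ψ : ι → ℂ, ψ ≠ 0 → 0 < (star ψ ⬝ᵥ G *ᵥ ψ).re)
    (hGA : G * A = A * G) {φ : Matrix ι κ ℂ} {σ : ℝ}
    (hφ : ∀ i j, σ * (α i - β j) < 0 → (Tᴴ * φ * R) i j = 0) :
    0 ≤ σ * ((G * φ)ᴴ * (A * φ - φ * B)).trace.re := by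
  rw [weighted_form hT hA hR hB hGh hGA hφ]
  exact trace_form_nonneg hG _

theorem eq_zero_of_weighted_form {A T : Matrix ι ι ℂ} {B R : Matrix κ κ ℂ} {α : ι → ℝ}
    {β : κ → ℝ} (hT : T * Tᴴ = 1) (hA : A = T * diagonal (fun i => (α i : ℂ)) * Tᴴ)
    (hR : R * Rᴴ = 1) (hB : B = R * diagonal (fun i => (β i : ℂ)) * Rᴴ)
    (hGh : G.IsHermitian) (hG : ∀ ψ : ι → ℂ, ψ ≠ 0 → 0 < (star ψ ⬝ᵥ G *ᵥ ψ).re)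
    (hGA : G * A = A * G) {φ : Matrix ι κ ℂ} {σ : ℝ}
    (hφ : ∀ i j, σ * (α i - β j) < 0 → (Tᴴ * φ * R) i j = 0)
    (h0 : ((G * φ)ᴴ * (A * φ - φ * B)).trace.re = 0) {i : ι} {j : κ}
    (hij : 0 < σ * (α i - β j)) : (Tᴴ * φ * R) i j = 0 := by
  have h := weighted_form hT hA hR hB hGh hGA hφ
  rw [h0, mul_zero] at h
  have h1 := eq_zero_of_trace_form hG h.symm
  have h2 : (of fun i j => (√(σ * (α i - β j)) : ℂ) * (Tᴴ * φ * R) i j) = 0 := by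
    rw [← Matrix.one_mul (of _), ← mul_eq_one_comm.1 hT, Matrix.mul_assoc, h1, Matrix.mul_zero]
  have h3 := congrFun (congrFun h2 i) j
  rw [of_apply, Matrix.zero_apply, mul_eq_zero] at h3
  refine h3.resolve_left ?_
  exact_mod_cast (Real.sqrt_pos.2 hij).ne'

end WeightedForm

theorem isOpen_forall_masked {τ : Type*} [Fintype τ] {r : ℕ} (T : Fin 3 → Matrix τ τ ℂ) (α : Fin 3 → τ → ℝ)
    (β : Fin 3 → Fin r → ℝ) : IsOpen {u : Fin 3 → Matrix (Fin r) (Fin r) ℂ |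
      ∀ φ : Matrix τ (Fin r) ℂ, (∀ k i j, β k j < α k i → ((T k)ᴴ * φ * u k) i j = 0) → φ = 0} := by
  obtain ⟨S, hS⟩ : ∃ S : Set (τ → Fin r → ℂ), S = Metric.sphere 0 1 := ⟨_, rfl⟩
  have : CompactSpace S := isCompact_iff_compactSpace.1 (hS ▸ isCompact_sphere _ _)
  have hcl : IsClosed {p : S × (Fin 3 → Matrix (Fin r) (Fin r) ℂ) |
      ∀ k i j, β k j < α k i → ((T k)ᴴ * (of p.1.1) * p.2 k) i j = 0} := by
    simp only [Set.ofPred_forall]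
    refine isClosed_iInter fun k => isClosed_iInter fun i => isClosed_iInter fun j =>
      isClosed_iInter fun _ => isClosed_eq ?_ continuous_const
    have hv : Continuous fun p : S × (Fin 3 → Matrix (Fin r) (Fin r) ℂ) =>
        (p.1.1 : τ → Fin r → ℂ) := by fun_prop
    have hc : Continuous fun p : S × (Fin 3 → Matrix (Fin r) (Fin r) ℂ) =>
        (T k)ᴴ * (of p.1.1) * p.2 k :=
      (continuous_const.matrix_mul (B := fun p : S × (Fin 3 → Matrix (Fin r) (Fin r) ℂ) =>
        of p.1.1) hv).matrix_mul ((continuous_apply k).comp continuous_snd)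
    exact hc.matrix_elem i j
  have := (isClosedMap_snd_of_compactSpace _ hcl).isOpen_compl
  convert this using 1
  ext u
  simp only [Set.mem_ofPred_eq, Set.mem_compl_iff, Set.mem_image, Prod.exists, not_exists, not_and]
  constructor
  · intro hu φ v hφ hv
    subst hv
    have h0 := hu _ hφ
    have h1 : φ.1 ∈ Metric.sphere 0 1 := hS ▸ φ.2
    rw [mem_sphere_zero_iff_norm, show (φ.1 : τ → Fin r → ℂ) = 0 from h0] at h1
    simp at h1
  · intro hu φ hφ
    by_contra hne
    let f : τ → Fin r → ℂ := φ
    have hf : ‖f‖ ≠ 0 := norm_ne_zero_iff.2 hne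
    refine hu ⟨((‖f‖⁻¹ : ℝ) : ℂ) • f, ?_⟩ u (fun k i j hij => ?_) rfl
    · rw [hS, mem_sphere_zero_iff_norm, norm_smul, Complex.norm_real, norm_inv, norm_norm,
        inv_mul_cancel₀ hf]
    · have h1 : of (((‖f‖⁻¹ : ℝ) : ℂ) • f) = ((‖f‖⁻¹ : ℝ) : ℂ) • φ := rfl
      rw [h1, Matrix.mul_smul, Matrix.smul_mul, Matrix.smul_apply, hφ k i j hij, smul_zero]

section CrossSystem

variable {τ : Type*} [Fintype τ] [DecidableEq τ] {r : ℕ}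

structure IsCrossSystem (G : Matrix τ τ ℂ) (A T : Fin 3 → Matrix τ τ ℂ)
    (B R : Fin 3 → Matrix (Fin r) (Fin r) ℂ) (α : Fin 3 → τ → ℝ) (β : Fin 3 → Fin r → ℝ) :
    Prop where
  isHermitian : G.IsHermitian
  pos : ∀ ψ : τ → ℂ, ψ ≠ 0 → 0 < (star ψ ⬝ᵥ G *ᵥ ψ).re
  comm : ∀ k, G * A k = A k * G
  unitary_left : ∀ k, T k * (T k)ᴴ = 1
  spec_left : ∀ k, A k = T k * diagonal (fun i => (α k i : ℂ)) * (T k)ᴴ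
  unitary_right : ∀ k, R k * (R k)ᴴ = 1
  spec_right : ∀ k, B k = R k * diagonal (fun i => (β k i : ℂ)) * (R k)ᴴ
  sum_eq : ∀ φ : Matrix τ (Fin r) ℂ, ∑ k, (A k * φ - φ * B k) = (2 : ℂ) • (G * φ)
  cross : ∀ Z : Fin 3 → Matrix τ (Fin r) ℂ, ∑ k, (A k * Z k - Z k * B k) = 0 →
    ∑ k, ((G * Z k)ᴴ * (A k * Z k - Z k * B k)).trace.re ≤ 0

variable {G : Matrix τ τ ℂ} {A T : Fin 3 → Matrix τ τ ℂ}
  {B R : Fin 3 → Matrix (Fin r) (Fin r) ℂ} {α : Fin 3 → τ → ℝ} {β : Fin 3 → Fin r → ℝ}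

theorem IsCrossSystem.sum_card_le (h : IsCrossSystem G A T B R α β) :
    ∑ k, ∑ f, (Finset.univ.filter fun t => β k f < α k t).card ≤ Fintype.card τ * r := by
  classical
  by_contra! hlt
  set P := Finset.univ.filter fun p : Fin 3 × Fin r × τ => β p.1 p.2.1 < α p.1 p.2.2 with hP
  have hcard : P.card = ∑ k, ∑ f, (Finset.univ.filter fun t => β k f < α k t).card := by
    rw [hP, Finset.card_filter, Fintype.sum_prod_type]
    refine Finset.sum_congr rfl fun k _ => ?_
    rw [Fintype.sum_prod_type]
    exact Finset.sum_congr rfl fun f _ => (Finset.card_filter _ _).symm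
  let E : Fin 3 → (P → ℂ) →ₗ[ℂ] Matrix τ (Fin r) ℂ := fun k =>
    { toFun := fun u => of fun t f => if h : (k, f, t) ∈ P then u ⟨(k, f, t), h⟩ else 0
      map_add' := fun u v => by
        ext i j
        simp only [of_apply, Matrix.add_apply]
        split_ifs <;> simp
      map_smul' := fun a u => by
        ext i j
        simp only [of_apply, Matrix.smul_apply, RingHom.id_apply]
        split_ifs <;> simp }
  let Z : (P → ℂ) → Fin 3 → Matrix τ (Fin r) ℂ := fun u k => T k * E k u * (R k)ᴴ
  let Φ : (P → ℂ) →ₗ[ℂ] Matrix τ (Fin r) ℂ :=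
    { toFun := fun u => ∑ k, (A k * Z u k - Z u k * B k)
      map_add' := fun u v => by
        rw [← Finset.sum_add_distrib]
        refine Finset.sum_congr rfl fun k _ => ?_
        simp only [Z, map_add, Matrix.mul_add, Matrix.add_mul]
        abel
      map_smul' := fun a u => by
        rw [RingHom.id_apply, Finset.smul_sum]
        refine Finset.sum_congr rfl fun k _ => ?_
        simp only [Z, map_smul, Matrix.mul_smul, Matrix.smul_mul, smul_sub] }
  have hker : LinearMap.ker Φ ≠ ⊥ := by
    apply LinearMap.ker_ne_bot_of_finrank_lt
    simpa [Module.finrank_matrix, hcard] using hlt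
  obtain ⟨u, hu, hu0⟩ := Submodule.exists_mem_ne_zero_of_ne_bot hker
  have hZ : ∀ k, (T k)ᴴ * Z u k * R k = E k u := fun k => by
    rw [show (T k)ᴴ * Z u k * R k = ((T k)ᴴ * T k) * E k u * ((R k)ᴴ * R k) by
      simp only [Z, Matrix.mul_assoc], mul_eq_one_comm.1 (h.unitary_left k),
      mul_eq_one_comm.1 (h.unitary_right k), Matrix.one_mul, Matrix.mul_one]
  have hsupp : ∀ k i j, 1 * (α k i - β k j) < 0 → ((T k)ᴴ * Z u k * R k) i j = 0 := by
    intro k i j hij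
    rw [hZ]
    exact dif_neg fun hm => by
      have := (Finset.mem_filter.1 hm).2
      simp only at this
      linarith
  have hnn : ∀ k, 0 ≤ ((G * Z u k)ᴴ * (A k * Z u k - Z u k * B k)).trace.re := fun k => by
    have := weighted_form_nonneg (h.unitary_left k) (h.spec_left k) (h.unitary_right k)
      (h.spec_right k) h.isHermitian h.pos (h.comm k) (hsupp k)
    rwa [one_mul] at this
  have hle := h.cross (Z u) (LinearMap.mem_ker.1 hu)
  have hz := (Finset.sum_eq_zero_iff_of_nonneg fun k _ => hnn k).1
    (le_antisymm hle (Finset.sum_nonneg fun k _ => hnn k))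
  obtain ⟨p, hp⟩ := Function.ne_iff.1 hu0
  have hp2 := (Finset.mem_filter.1 p.2).2
  have := eq_zero_of_weighted_form (h.unitary_left p.1.1) (h.spec_left p.1.1)
    (h.unitary_right p.1.1) (h.spec_right p.1.1) h.isHermitian h.pos (h.comm p.1.1) (hsupp p.1.1)
    (hz p.1.1 (Finset.mem_univ _)) (i := p.1.2.2) (j := p.1.2.1) (by linarith)
  rw [hZ] at this
  exact hp ((dif_pos p.2).symm.trans this)

theorem IsCrossSystem.eq_zero (h : IsCrossSystem G A T B R α β) {φ : Matrix τ (Fin r) ℂ}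
    (hφ : ∀ k i j, β k j < α k i → ((T k)ᴴ * φ * R k) i j = 0) : φ = 0 := by
  have h1 : ∀ k, ((G * φ)ᴴ * (A k * φ - φ * B k)).trace.re ≤ 0 := fun k => by
    have := weighted_form_nonneg (σ := -1) (h.unitary_left k) (h.spec_left k) (h.unitary_right k)
      (h.spec_right k) h.isHermitian h.pos (h.comm k) fun i j hij => hφ k i j (by linarith)
    linarith
  have h2 : ∑ k, ((G * φ)ᴴ * (A k * φ - φ * B k)).trace.re =
      2 * ((G * φ)ᴴ * (G * φ)).trace.re := by
    rw [← Complex.re_sum, ← trace_sum, ← Matrix.mul_sum, h.sum_eq, Matrix.mul_smul, trace_smul,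
      smul_eq_mul]
    simp
  have h3 : G * φ = 0 := eq_zero_of_re_trace_nonpos (by
    have := Finset.sum_nonpos fun k (_ : k ∈ Finset.univ) => h1 k
    linarith)
  exact eq_zero_of_trace_form h.pos (by rw [h3, Matrix.mul_zero, trace_zero, Complex.zero_re])

theorem IsCrossSystem.le_sum_card (h : IsCrossSystem G A T B R α β) (hβ : ∀ k, Antitone (β k))
    {d : ℕ} {F : Fin 3 → Fin d → Fin r} (hF : DenseInt r d F) :
    Fintype.card τ * d ≤
      ∑ k, ∑ j, (Finset.univ.filter fun t => β k (F k j).rev < α k t).card := by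
  classical
  by_contra! hlt
  let p : Matrix (Fin r) (Fin r) ℂ := (1 : Matrix (Fin r) (Fin r) ℂ).submatrix Fin.rev id
  have hp : ∀ (v : Fin r → ℂ) f, ∑ b, v b * p b f = v f.rev := fun v f => by
    rw [Finset.sum_eq_single f.rev]
    · simp [p, Matrix.one_apply]
    · intro b _ hb
      have : b.rev ≠ f := fun hbf => hb (by rw [← hbf, Fin.rev_rev])
      simp [p, this]
    · simp
  have hpp : p * p = 1 := by
    ext i j
    rw [Matrix.mul_apply, hp]
    simp [p, Matrix.one_apply]
  let u : (Fin 3 → Matrix (Fin r) (Fin r) ℂ) → Fin 3 → Matrix (Fin r) (Fin r) ℂ :=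
    fun g k => ((g k)ᵀ).adjugate * p
  have hu : Continuous u := continuous_pi fun k =>
    ((continuous_apply k).matrix_transpose.matrix_adjugate).matrix_mul continuous_const
  have hopen := (isOpen_forall_masked T α β).preimage hu
  have hne : (u ⁻¹' {u : Fin 3 → Matrix (Fin r) (Fin r) ℂ | ∀ φ : Matrix τ (Fin r) ℂ,
      (∀ k i j, β k j < α k i → ((T k)ᴴ * φ * u k) i j = 0) → φ = 0}).Nonempty := by
    refine ⟨fun k => (p * (R k)ᴴ)ᵀ, fun φ hφ => h.eq_zero fun k i j hij => ?_⟩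
    have h1 : u (fun k => (p * (R k)ᴴ)ᵀ) k = (p * (R k)ᴴ).det • R k := by
      simp only [u, transpose_transpose]
      have h2 : p * (R k)ᴴ * R k = p := by
        rw [Matrix.mul_assoc, mul_eq_one_comm.1 (h.unitary_right k), Matrix.mul_one]
      calc (p * (R k)ᴴ).adjugate * p = (p * (R k)ᴴ).adjugate * (p * (R k)ᴴ * R k) := by rw [h2]
        _ = _ := by rw [← Matrix.mul_assoc, adjugate_mul, Matrix.smul_mul, Matrix.one_mul]
    have h3 : (p * (R k)ᴴ).det ≠ 0 := by
      have : (p * (R k)ᴴ) * (R k * p) = 1 := by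
        rw [show (p * (R k)ᴴ) * (R k * p) = p * ((R k)ᴴ * R k) * p by
          simp only [Matrix.mul_assoc], mul_eq_one_comm.1 (h.unitary_right k), Matrix.mul_one, hpp]
      intro h0
      have h4 := congrArg det this
      rw [det_mul, h0, zero_mul, det_one] at h4
      exact zero_ne_one h4
    have h5 := hφ k i j hij
    rw [h1, Matrix.mul_smul, Matrix.smul_apply, smul_eq_mul] at h5
    exact (mul_eq_zero.1 h5).resolve_left h3
  obtain ⟨g, hg, Ω, L, w, w', y, hL, hw, hΩ, hy⟩ := hF _ hopen hne
  set P := Finset.univ.filter fun q : Fin 3 × Fin d × τ =>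
    β q.1 (F q.1 q.2.1).rev < α q.1 q.2.2 with hP
  have hcard : P.card =
      ∑ k, ∑ j, (Finset.univ.filter fun t => β k (F k j).rev < α k t).card := by
    rw [hP, Finset.card_filter, Fintype.sum_prod_type]
    refine Finset.sum_congr rfl fun k _ => ?_
    rw [Fintype.sum_prod_type]
    exact Finset.sum_congr rfl fun f _ => (Finset.card_filter _ _).symm
  let Φ : Matrix τ (Fin d) ℂ →ₗ[ℂ] (P → ℂ) :=
    { toFun := fun ψ q => ((T q.1.1)ᴴ * ψ * (w' q.1.1)ᵀ) q.1.2.2 q.1.2.1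
      map_add' := fun ψ χ => by
        ext q
        simp [Matrix.mul_add, Matrix.add_mul]
      map_smul' := fun a ψ => by
        ext q
        simp }
  have hker : LinearMap.ker Φ ≠ ⊥ := by
    apply LinearMap.ker_ne_bot_of_finrank_lt
    simpa [Module.finrank_matrix, hcard] using hlt
  obtain ⟨ψ, hψ, hψ0⟩ := Submodule.exists_mem_ne_zero_of_ne_bot hker
  refine hψ0 ?_
  have hz : ψ * Ωᵀ = 0 := by
    refine hg _ fun k i f hif => ?_
    have h1 : Ω = g k * y k * w' k := by
      rw [← hΩ, Matrix.mul_assoc, hw, Matrix.mul_one]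
    have h2 : (T k)ᴴ * (ψ * Ωᵀ) * u g k =
        (g k)ᵀ.det • ((T k)ᴴ * ψ * (w' k)ᵀ * ((y k)ᵀ * p)) := by
      rw [h1, transpose_mul, transpose_mul]
      simp only [u]
      rw [show (T k)ᴴ * (ψ * ((w' k)ᵀ * ((y k)ᵀ * (g k)ᵀ))) * ((g k)ᵀ.adjugate * p) =
        (T k)ᴴ * ψ * (w' k)ᵀ * ((y k)ᵀ * (((g k)ᵀ * (g k)ᵀ.adjugate) * p)) by
          simp only [Matrix.mul_assoc], mul_adjugate, Matrix.smul_mul, Matrix.one_mul,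
        Matrix.mul_smul, Matrix.mul_smul]
    rw [h2, Matrix.smul_apply, Matrix.mul_apply, Finset.sum_eq_zero, smul_zero]
    intro j _
    have h3 : ((y k)ᵀ * p) j f = y k f.rev j := by
      rw [Matrix.mul_apply, hp, transpose_apply]
    rw [h3]
    rcases lt_or_ge f.rev (F k j) with hlt' | hge
    · rw [hy k _ _ hlt', mul_zero]
    · have h4 : β k (F k j).rev ≤ β k f := hβ k (by rw [← Fin.rev_le_rev, Fin.rev_rev]; exact hge)
      have h5 := congrFun (LinearMap.mem_ker.1 hψ) ⟨(k, j, i), by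
        simpa [hP] using h4.trans_lt hif⟩
      rw [show ((T k)ᴴ * ψ * (w' k)ᵀ) i j = 0 from h5, zero_mul]
  calc ψ = ψ * (L * Ω)ᵀ := by rw [hL, transpose_one, Matrix.mul_one]
    _ = ψ * Ωᵀ * Lᵀ := by rw [transpose_mul, Matrix.mul_assoc]
    _ = 0 := by rw [hz, Matrix.zero_mul]

end CrossSystem

def HornSufficient (r : ℕ) : Prop :=
  ∀ a b c : Fin r → ℝ, Antitone a → Antitone b → Antitone c → ∑ i, a i + ∑ i, b i = ∑ i, c i →
    (∀ (d : ℕ), 1 ≤ d → d ≤ r → ∀ (I J K : Finset (Fin r)) (hI : I.card = d) (hJ : J.card = d)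
      (hK : K.card = d), (muVec I hI, muVec J hJ, muVec K hK) ∈ Horn d →
        ∑ i ∈ K, c i ≤ ∑ i ∈ I, a i + ∑ i ∈ J, b i) →
    (a, b, c) ∈ Horn r

theorem zero_mem_horn (r : ℕ) : ((0, 0, 0) : (Fin r → ℝ) × (Fin r → ℝ) × (Fin r → ℝ)) ∈ Horn r := by
  have h0 : HasSpec (0 : Matrix (Fin r) (Fin r) ℂ) (0 : Fin r → ℝ) := by
    have := hasSpec_diagonal (0 : Fin r → ℝ)
    simpa using this
  have hv : Antitone (0 : Fin r → ℝ) := fun _ _ _ => le_rfl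
  refine ⟨0, 0, isHermitian_zero, isHermitian_zero, (eigVec_eq _ hv h0).symm,
    (eigVec_eq _ hv h0).symm, (eigVec_eq _ hv ?_).symm⟩
  rwa [add_zero]

theorem muVec_eq_of_strictMono {n r : ℕ} {A : Finset (Fin n)} (hA : A.card = r) {F : Fin r → Fin n}
    (hF : StrictMono F) (h : A = Finset.univ.image F) (k : Fin r) :
    muVec A hA k = ((F k.rev : ℕ) : ℝ) - (k.rev : ℕ) := by
  subst h
  have h1 := Finset.orderEmbOfFin_unique hA
    (fun x => Finset.mem_image_of_mem F (Finset.mem_univ x)) hF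
  have h2 : F k.rev = (Finset.univ.image F).orderEmbOfFin hA k.rev := congrFun h1 k.rev
  rw [muVec, h2]
  rfl

theorem card_image_of_strictMono {n r : ℕ} {F : Fin r → Fin n} (hF : StrictMono F) :
    (Finset.univ.image F).card = r := by
  rw [Finset.card_image_of_injective _ hF.injective, Finset.card_univ, Fintype.card_fin]

theorem re_diag_conj_spectral {ι : Type*} [Fintype ι] [DecidableEq ι] {Y V : Matrix ι ι ℂ}
    {v : ι → ℝ} (hY : Y = V * diagonal (fun i => (v i : ℂ)) * Vᴴ) (U : Matrix ι ι ℂ) (i : ι) :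
    ((Uᴴ * Y * U) i i).re = ∑ j, v j * Complex.normSq ((Uᴴ * V) i j) := by
  have h1 : Uᴴ * Y * U = (Uᴴ * V) * diagonal (fun i => (v i : ℂ)) * (Uᴴ * V)ᴴ := by
    rw [hY, conjTranspose_mul, conjTranspose_conjTranspose]
    simp only [Matrix.mul_assoc]
  rw [h1, Matrix.mul_apply, Complex.re_sum]
  refine Finset.sum_congr rfl fun j _ => ?_
  rw [mul_diagonal, conjTranspose_apply, mul_right_comm, Complex.star_def, Complex.mul_conj]
  rw [← Complex.ofReal_mul, Complex.ofReal_re, mul_comm]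

theorem le_of_mem_horn {r : ℕ} {a b c : Fin r → ℝ} (h : (a, b, c) ∈ Horn r) (hb : ∀ i, 0 ≤ b i)
    {M : ℝ} (hc : ∀ i, c i ≤ M) (i : Fin r) : a i ≤ M := by
  obtain ⟨X, Y, hX, hY, h1, h2, h3⟩ := h
  simp only at h1 h2 h3
  obtain ⟨U, u1, u2, d1⟩ := exists_diag_of_hasSpec hX (eigVec_antitone _ _) (hasSpec_eigVec _ hX)
  obtain ⟨V, v1, v2, d2⟩ := exists_diag_of_hasSpec hY (eigVec_antitone _ _) (hasSpec_eigVec _ hY)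
  obtain ⟨W, w1, w2, d3⟩ := exists_diag_of_hasSpec (hX.add hY) (eigVec_antitone _ _)
    (hasSpec_eigVec _ (hX.add hY))
  rw [← h1] at d1
  rw [← h2] at d2
  rw [← h3] at d3
  have e1 : ((Uᴴ * X * U) i i).re = a i := by
    have : Uᴴ * X * U = diagonal (fun i => (a i : ℂ)) := by
      rw [d1]
      calc _ = (Uᴴ * U) * diagonal (fun i => (a i : ℂ)) * (Uᴴ * U) := by
            simp only [Matrix.mul_assoc]
        _ = _ := by rw [u2, Matrix.one_mul, Matrix.mul_one]
    rw [this, diagonal_apply_eq, Complex.ofReal_re]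
  have e2 : 0 ≤ ((Uᴴ * Y * U) i i).re := by
    rw [re_diag_conj_spectral d2]
    exact Finset.sum_nonneg fun j _ => mul_nonneg (hb j) (Complex.normSq_nonneg _)
  have e3 : ((Uᴴ * (X + Y) * U) i i).re ≤ M := by
    rw [re_diag_conj_spectral d3]
    have e4 := re_diag_conj_spectral (Y := (1 : Matrix (Fin r) (Fin r) ℂ)) (V := W)
      (v := fun _ => 1) (by simp [w1]) U i
    rw [Matrix.mul_one, u2, one_apply_eq, Complex.one_re] at e4
    calc _ ≤ ∑ j, M * Complex.normSq ((Uᴴ * W) i j) := Finset.sum_le_sum fun j _ =>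
          mul_le_mul_of_nonneg_right (hc j) (Complex.normSq_nonneg _)
      _ = M := by
        rw [← Finset.mul_sum]
        simp only [one_mul] at e4
        rw [← e4, mul_one]
  rw [Matrix.mul_add, Matrix.add_mul, Matrix.add_apply, Complex.add_re, e1] at e3
  linarith

theorem horn_comm {r : ℕ} {a b c : Fin r → ℝ} (h : (a, b, c) ∈ Horn r) : (b, a, c) ∈ Horn r := by
  obtain ⟨X, Y, hX, hY, h1, h2, h3⟩ := h
  have h4 : ∀ Z (hZ : Z.IsHermitian), Z = X + Y → eigVec (X + Y) (hX.add hY) = eigVec Z hZ := by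
    rintro _ _ rfl
    rfl
  exact ⟨Y, X, hY, hX, h2, h1, h3.trans (h4 _ _ (add_comm Y X))⟩

section CrossSystem

variable {τ : Type*} [Fintype τ] [DecidableEq τ] {r : ℕ} {G : Matrix τ τ ℂ}
  {A T : Fin 3 → Matrix τ τ ℂ} {B R : Fin 3 → Matrix (Fin r) (Fin r) ℂ} {α : Fin 3 → τ → ℝ}
  {β : Fin 3 → Fin r → ℝ}

theorem IsCrossSystem.mem_horn (h : IsCrossSystem G A T B R α β) (hβ : ∀ k, Antitone (β k))
    (hS : HornSufficient r) :
    ((fun f => ((Finset.univ.filter fun t => β 0 f.rev < α 0 t).card : ℝ)),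
      (fun f => ((Finset.univ.filter fun t => β 1 f.rev < α 1 t).card : ℝ)),
      fun f => ((Finset.univ.filter fun t => α 2 t ≤ β 2 f).card : ℝ)) ∈ Horn r := by
  have hcompl : ∀ f, ((Finset.univ.filter fun t => α 2 t ≤ β 2 f).card : ℝ) =
      Fintype.card τ - ((Finset.univ.filter fun t => β 2 f < α 2 t).card : ℝ) := fun f => by
    have := Finset.card_filter_add_card_filter_not (s := (Finset.univ : Finset τ))
      (fun t => β 2 f < α 2 t)
    simp only [not_lt, Finset.card_univ] at this
    rw [← this]
    push_cast
    ring
  have key : ∀ (d : ℕ) (I J K : Finset (Fin r)) (hI : I.card = d) (hJ : J.card = d)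
      (hK : K.card = d), (muVec I hI, muVec J hJ, muVec K hK) ∈ Horn d →
        ∑ f ∈ K, ((Finset.univ.filter fun t => α 2 t ≤ β 2 f).card : ℝ) ≤
          ∑ f ∈ I, ((Finset.univ.filter fun t => β 0 f.rev < α 0 t).card : ℝ) +
            ∑ f ∈ J, ((Finset.univ.filter fun t => β 1 f.rev < α 1 t).card : ℝ) := by
    intro d I J K hI hJ hK hLR
    have h1 := h.le_sum_card hβ (denseInt_of_horn le_rfl hI hJ hK hLR)
    have h2 := sum_lrIdx le_rfl hI hJ hK fun k f =>
      ((Finset.univ.filter fun t => β k f.rev < α k t).card : ℝ)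
    simp only [Fin.castLE_rfl, id, Fin.rev_rev] at h2
    have h3 : ((Fintype.card τ * d : ℕ) : ℝ) ≤ _ := Nat.cast_le.2 h1
    push_cast at h3
    rw [h2] at h3
    simp only [hcompl, Finset.sum_sub_distrib, Finset.sum_const, hK, nsmul_eq_mul]
    linarith
  refine hS _ _ _ ?_ ?_ ?_ ?_ fun d _ _ => key d
  · intro i j hij
    exact Nat.cast_le.2 (Finset.card_le_card fun t => by
      simpa using fun h => (hβ 0 (Fin.rev_le_rev.2 hij)).trans_lt h)
  · intro i j hij
    exact Nat.cast_le.2 (Finset.card_le_card fun t => by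
      simpa using fun h => (hβ 1 (Fin.rev_le_rev.2 hij)).trans_lt h)
  · intro i j hij
    exact Nat.cast_le.2 (Finset.card_le_card fun t => by
      simpa using fun h => h.trans (hβ 2 hij))
  · apply le_antisymm
    · have h1 := h.sum_card_le
      rw [Fin.sum_univ_three] at h1
      have h2 : ((_ : ℕ) : ℝ) ≤ _ := Nat.cast_le.2 h1
      push_cast at h2
      simp only [hcompl, Finset.sum_sub_distrib, Finset.sum_const, nsmul_eq_mul, Finset.card_univ,
        Fintype.card_fin]
      have h3 := fun k => Equiv.sum_comp Fin.revPerm fun f =>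
        ((Finset.univ.filter fun t => β k f < α k t).card : ℝ)
      simp only [Fin.revPerm_apply] at h3
      rw [h3 0, h3 1]
      linarith
    · have hid : StrictMono (id : Fin r → Fin r) := strictMono_id
      have hu : (Finset.univ : Finset (Fin r)).card = r := by simp
      have h0 : muVec (Finset.univ : Finset (Fin r)) hu = 0 := funext fun k => by
        rw [muVec_eq_of_strictMono hu hid (by simp)]
        simp
      refine key r Finset.univ Finset.univ Finset.univ hu hu hu ?_
      rw [h0]
      exact zero_mem_horn r

end CrossSystem

theorem card_filter_sum_elim {τ : Type*} [Fintype τ] {r : ℕ} (a b : Fin r → ℝ) (g : τ → ℝ)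
    (P : ℝ → Prop) [DecidablePred P] :
    (Finset.univ.filter fun k => P (Sum.elim (Sum.elim a b) g k)).card =
      (Finset.univ.filter fun k => P (a k)).card + (Finset.univ.filter fun k => P (b k)).card +
        (Finset.univ.filter fun k => P (g k)).card := by
  simp only [Finset.card_filter, Fintype.sum_sum_type, Sum.elim_inl, Sum.elim_inr]
  rfl

theorem antitone_eq_of_interlaced {τ : Type*} [Fintype τ] {n r : ℕ} {v : Fin n → ℝ}
    (hv : Antitone v) {b η : Fin r → ℝ} {g : τ → ℝ} (hb : Antitone b) (hη : ∀ i j, η j ≤ b i)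
    (hP : ∀ (P : ℝ → Prop) [DecidablePred P], (Finset.univ.filter fun k => P (v k)).card =
      (Finset.univ.filter fun k => P (b k)).card + (Finset.univ.filter fun k => P (η k)).card +
        (Finset.univ.filter fun k => P (g k)).card)
    {i : Fin n} {f : Fin r} (h1 : (f : ℕ) + (Finset.univ.filter fun t => b f < g t).card ≤ i)
    (h2 : (i : ℕ) ≤ f + (Finset.univ.filter fun t => b f ≤ g t).card) : v i = b f := by
  refine antitone_eq_of_card hv i (b f) ?_ ?_
  · rw [hP fun x => b f < x]
    have h3 : (Finset.univ.filter fun k => b f < b k).card ≤ f := by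
      refine (Finset.card_le_card fun k hk => ?_).trans (Fin.card_Iio f).le
      rw [Finset.mem_filter] at hk
      rw [Finset.mem_Iio]
      by_contra! hle
      exact absurd hk.2 (not_lt.2 (hb hle))
    have h4 : (Finset.univ.filter fun k => b f < η k).card = 0 := by
      rw [Finset.card_eq_zero, Finset.filter_eq_empty_iff]
      exact fun k _ => not_lt.2 (hη f k)
    omega
  · rw [hP fun x => b f ≤ x]
    have h3 : (f : ℕ) + 1 ≤ (Finset.univ.filter fun k => b f ≤ b k).card := by
      rw [← Fin.card_Iic f]
      refine Finset.card_le_card fun k hk => ?_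
      simpa using hb (Finset.mem_Iic.1 hk)
    omega

theorem card_hatPQ_pos_le {p q : ℕ} {s : Fin q → ℝ} (hs0 : ∀ i, 0 ≤ s i) :
    (Finset.univ.filter fun k => 0 < hatPQ p q s k).card ≤ q := by
  refine (Finset.card_le_card (t := (Finset.univ : Finset (Fin q)).image
    (Fin.castLE (Nat.le_add_left q p))) fun k hk => ?_).trans
    (Finset.card_image_le.trans (by simp))
  have hk' : 0 < hatPQ p q s k := by simpa using hk
  rw [Finset.mem_image]
  unfold hatPQ at hk'
  split_ifs at hk' with h h'
  · exact ⟨⟨k, h⟩, Finset.mem_univ _, rfl⟩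
  · exact absurd hk' (lt_irrefl _)
  · exact absurd hk' (not_lt.2 (neg_nonpos.2 (hs0 _)))

section CrossSystem

variable {τ : Type*} [Fintype τ] [DecidableEq τ] {r : ℕ} {G : Matrix τ τ ℂ}
  {A T : Fin 3 → Matrix τ τ ℂ} {B R : Fin 3 → Matrix (Fin r) (Fin r) ℂ} {α : Fin 3 → τ → ℝ}
  {β : Fin 3 → Fin r → ℝ}

theorem IsCrossSystem.mem_horn_of_card_le (h : IsCrossSystem G A T B R α β)
    (hβ : ∀ k, Antitone (β k)) {q : ℕ} (hr : r ≤ q) (hS : r < q → HornSufficient r)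
    (hq : ∀ f, r + (Finset.univ.filter fun t => α 2 t ≤ β 2 f).card ≤ q) :
    ((fun f => ((Finset.univ.filter fun t => β 0 f.rev < α 0 t).card : ℝ)),
      (fun f => ((Finset.univ.filter fun t => β 1 f.rev < α 1 t).card : ℝ)),
      fun f => ((Finset.univ.filter fun t => α 2 t ≤ β 2 f).card : ℝ)) ∈ Horn r := by
  rcases hr.lt_or_eq with hr | rfl
  · exact h.mem_horn hβ (hS hr)
  · have h2 : ∀ f, (Finset.univ.filter fun t => α 2 t ≤ β 2 f).card = 0 := fun f => by
      have := hq f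
      omega
    have h3 : ∀ f, (Finset.univ.filter fun t => β 2 f < α 2 t).card = Fintype.card τ := fun f => by
      have := Finset.card_filter_add_card_filter_not (s := (Finset.univ : Finset τ))
        (fun t => β 2 f < α 2 t)
      simp only [not_lt, Finset.card_univ] at this
      rw [h2 f] at this
      exact this
    have h4 := h.sum_card_le
    rw [Fin.sum_univ_three] at h4
    simp only [h3, Finset.sum_const, Finset.card_univ, Fintype.card_fin, smul_eq_mul] at h4
    rw [mul_comm (Fintype.card τ) r] at h4
    have h5 : ∑ f, (Finset.univ.filter fun t => β 0 f < α 0 t).card = 0 := by omega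
    have h6 : ∑ f, (Finset.univ.filter fun t => β 1 f < α 1 t).card = 0 := by omega
    simp only [Finset.sum_eq_zero_iff, Finset.mem_univ, true_imp_iff] at h5 h6
    simp only [h2, h5, h6, Nat.cast_zero]
    exact zero_mem_horn r

theorem IsCrossSystem.sum_le (h : IsCrossSystem G A T B R α β) (hβ : ∀ k, Antitone (β k))
    (hr : 1 ≤ r) {p q : ℕ} (hS : r < q → HornSufficient r)
    {lam : Fin (p + q) → ℝ} {s : Fin q → ℝ} (hlam : Antitone lam) (hs : Antitone s)
    (hs0 : ∀ i, 0 ≤ s i)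
    (hLR : ∀ (I J K : Finset (Fin q)) (hI : I.card = r) (hJ : J.card = r) (hK : K.card = r),
      (muVec I hI, muVec J hJ, muVec K hK) ∈ Horn r →
      ∑ k ∈ K, s k ≤ ∑ i ∈ I, lam (Fin.castLE (Nat.le_add_left q p) i) -
        ∑ j ∈ J, lam (Fin.castLE (Nat.le_add_left q p) j).rev)
    (hα : ∀ t, α 1 t = -α 0 t) (hβ2 : ∀ f, β 2 f < 0) (hβ01 : ∀ i j, -β 1 j ≤ β 0 i)
    {ι : Type*} [Fintype ι] [DecidableEq ι] {X C : Matrix ι ι ℂ} (hX : HasSpec X lam)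
    (hX' : HasSpec X (Sum.elim (Sum.elim (β 0) fun f => -β 1 f) (α 0)))
    (hC : HasSpec C (hatPQ p q s))
    (hC' : HasSpec C (Sum.elim (Sum.elim (fun f : Fin r => -β 2 f.rev) fun f : Fin r => β 2 f.rev)
      fun t => -α 2 t)) :
    0 ≤ ∑ f, β 0 f + ∑ f, β 1 f + ∑ f, β 2 f := by
  have hXP := fun (P : ℝ → Prop) [DecidablePred P] =>
    (hX.card_filter_eq hX' P).trans (card_filter_sum_elim _ _ _ P)
  have hCP := fun (P : ℝ → Prop) [DecidablePred P] =>
    (hC.card_filter_eq hC' P).trans (card_filter_sum_elim _ _ _ P)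
  have hq : ∀ f, r + (Finset.univ.filter fun t => α 2 t ≤ β 2 f).card ≤ q := fun f => by
    refine le_trans ?_ (card_hatPQ_pos_le (p := p) hs0)
    rw [hCP fun x => 0 < x]
    have h1 : (Finset.univ.filter fun f : Fin r => 0 < -β 2 f.rev).card = r := by
      rw [Finset.filter_true_of_mem fun f _ => neg_pos.2 (hβ2 f.rev), Finset.card_univ,
        Fintype.card_fin]
    have h2 : (Finset.univ.filter fun t => α 2 t ≤ β 2 f).card ≤
        (Finset.univ.filter fun t => 0 < -α 2 t).card := Finset.card_le_card fun t => by
      simpa using fun h => lt_of_le_of_lt h (hβ2 f)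
    omega
  have hrq : r ≤ q := le_trans (Nat.le_add_right _ _) (hq ⟨0, hr⟩)
  have hH := h.mem_horn_of_card_le hβ hrq hS hq
  have hM : ∀ f, ((Finset.univ.filter fun t => α 2 t ≤ β 2 f).card : ℝ) ≤ ((q - r : ℕ) : ℝ) :=
    fun f => Nat.cast_le.2 (by have := hq f; omega)
  have h0 : ∀ f, (Finset.univ.filter fun t => β 0 f < α 0 t).card ≤ q - r := fun f => by
    have := le_of_mem_horn hH (fun _ => Nat.cast_nonneg _) hM f.rev
    simpa using this
  have h1 : ∀ f, (Finset.univ.filter fun t => β 1 f < α 1 t).card ≤ q - r := fun f => by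
    have := le_of_mem_horn (horn_comm hH) (fun _ => Nat.cast_nonneg _) hM f.rev
    simpa using this
  let F : (Fin r → ℕ) → Fin r → Fin q := fun m f => ⟨min (f + m f) (q - 1), by
    have := f.isLt
    omega⟩
  have hF : ∀ m, Monotone m → (∀ f, m f ≤ q - r) → (∀ f, (F m f : ℕ) = f + m f) ∧
      StrictMono (F m) := by
    intro m hm hle
    have hval : ∀ f, (F m f : ℕ) = f + m f := fun f => min_eq_left (by
      have := f.isLt
      have := hle f
      omega)
    refine ⟨hval, fun f g hfg => ?_⟩
    rw [Fin.lt_def, hval, hval]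
    exact add_lt_add_of_lt_of_le hfg (hm hfg.le)
  obtain ⟨v0, s0⟩ := hF (fun f => (Finset.univ.filter fun t => β 0 f < α 0 t).card)
    (fun i j hij => Finset.card_le_card fun t => by simpa using fun h => (hβ 0 hij).trans_lt h) h0
  obtain ⟨v1, s1⟩ := hF (fun f => (Finset.univ.filter fun t => β 1 f < α 1 t).card)
    (fun i j hij => Finset.card_le_card fun t => by simpa using fun h => (hβ 1 hij).trans_lt h) h1
  obtain ⟨v2, s2⟩ := hF (fun f => (Finset.univ.filter fun t => α 2 t ≤ β 2 f.rev).card)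
    (fun i j hij => Finset.card_le_card fun t => by
      simpa using fun h => h.trans (hβ 2 (Fin.rev_le_rev.2 hij)))
    fun f => by have := hq f.rev; omega
  generalize F (fun f => (Finset.univ.filter fun t => β 0 f < α 0 t).card) = F0 at v0 s0
  generalize F (fun f => (Finset.univ.filter fun t => β 1 f < α 1 t).card) = F1 at v1 s1
  generalize F (fun f => (Finset.univ.filter fun t => α 2 t ≤ β 2 f.rev).card) = F2 at v2 s2
  have key := hLR (Finset.univ.image F0) (Finset.univ.image F1) (Finset.univ.image F2)
    (card_image_of_strictMono s0) (card_image_of_strictMono s1) (card_image_of_strictMono s2) (by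
      convert hH using 2
      · funext f
        rw [muVec_eq_of_strictMono _ s0 rfl, v0]
        push_cast
        ring
      · congr 1
        · funext f
          rw [muVec_eq_of_strictMono _ s1 rfl, v1]
          push_cast
          ring
        · funext f
          rw [muVec_eq_of_strictMono _ s2 rfl, v2, Fin.rev_rev]
          push_cast
          ring)
  rw [Finset.sum_image fun _ _ _ _ h => s0.injective h,
    Finset.sum_image fun _ _ _ _ h => s1.injective h,
    Finset.sum_image fun _ _ _ _ h => s2.injective h] at key
  have e0 : ∀ f, lam (Fin.castLE (Nat.le_add_left q p) (F0 f)) = β 0 f := fun f => by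
    refine antitone_eq_of_interlaced hlam (hβ 0) (η := fun f => -β 1 f) hβ01 (g := α 0) hXP ?_ ?_
    · rw [Fin.val_castLE, v0]
    · rw [Fin.val_castLE, v0]
      exact Nat.add_le_add_left (Finset.card_le_card fun t => by simpa using le_of_lt) _
  have e1 : ∀ f, -lam (Fin.castLE (Nat.le_add_left q p) (F1 f)).rev = β 1 f := fun f => by
    refine antitone_eq_of_interlaced (v := fun k => -lam k.rev)
      (fun i j hij => neg_le_neg (hlam (Fin.rev_le_rev.2 hij))) (hβ 1) (η := fun f => -β 0 f)
      (fun i j => neg_le.1 (hβ01 j i)) (g := α 1) (fun P _ => ?_) ?_ ?_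
    · have h2 := hXP fun x => P (-x)
      simp only [neg_neg] at h2
      simp only [hα]
      rw [add_comm (Finset.card _) (Finset.card _), ← h2]
      exact Finset.card_equiv Fin.revPerm fun k => by simp
    · rw [Fin.val_castLE, v1]
    · rw [Fin.val_castLE, v1]
      exact Nat.add_le_add_left (Finset.card_le_card fun t => by simpa using le_of_lt) _
  have e2 : ∀ f, s (F2 f) = -β 2 f.rev := fun f => by
    have h2 : hatPQ p q s (Fin.castLE (Nat.le_add_left q p) (F2 f)) = s (F2 f) := by
      rw [hatPQ, dif_pos (by exact (F2 f).isLt)]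
      rfl
    rw [← h2]
    refine antitone_eq_of_interlaced (hatPQ_antitone hs hs0)
      (fun i j hij => neg_le_neg (hβ 2 (Fin.rev_le_rev.2 hij))) (η := fun f => β 2 f.rev)
      (fun i j => ?_) (g := fun t => -α 2 t) hCP ?_ ?_
    · have := hβ2 i.rev
      have := hβ2 j.rev
      linarith
    · rw [Fin.val_castLE, v2]
      exact Nat.add_le_add_left (Finset.card_le_card fun t => by simpa using le_of_lt) _
    · rw [Fin.val_castLE, v2]
      simp only [neg_le_neg_iff]
      exact le_rfl
  simp only [e0, e2] at key
  have e1' : ∀ f, lam (Fin.castLE (Nat.le_add_left q p) (F1 f)).rev = -β 1 f := fun f => by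
    rw [← e1, neg_neg]
  simp only [e1', Finset.sum_neg_distrib] at key
  have h3 := Equiv.sum_comp Fin.revPerm (β 2)
  simp only [Fin.revPerm_apply] at h3
  rw [h3] at key
  linarith

end CrossSystem

section BottomFrame

variable {ι : Type*} [Fintype ι] [DecidableEq ι]

theorem exists_eigenvalue_neg {E J : Matrix ι ι ℂ} (hE : E.IsHermitian) (hJJ : J * J = 1)
    (hJE : J * E * J = -E) (h0 : E ≠ 0) : ∃ i, hE.eigenvalues i < 0 := by
  obtain ⟨U, u1, u2, d⟩ := exists_diag_fintype hE
  by_contra! hv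
  have h1 : HasSpec (-E) hE.eigenvalues := by
    rw [← hJE]
    exact (hasSpec_of_eq u1 u2 d).conj hJJ hJJ
  have h2 := (HasSpec.neg u1 u2 d).card_filter_eq h1 fun x => x < 0
  rw [Finset.filter_false_of_mem fun i _ => not_lt.2 (hv i), Finset.card_empty,
    Finset.card_eq_zero, Finset.filter_eq_empty_iff] at h2
  refine h0 ?_
  have h3 : (fun i => (hE.eigenvalues i : ℂ)) = 0 := funext fun i => by
    have := h2 (Finset.mem_univ i)
    have := hv i
    simp only [Pi.zero_apply, Complex.ofReal_eq_zero]
    linarith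
  rw [d, h3]
  simp

theorem star_dotProduct_diagonal_mulVec (w : ι → ℝ) (φ : ι → ℂ) :
    (star φ ⬝ᵥ diagonal (fun i => (w i : ℂ)) *ᵥ φ).re = ∑ i, w i * Complex.normSq (φ i) := by
  rw [dotProduct, Complex.re_sum]
  refine Finset.sum_congr rfl fun i _ => ?_
  rw [mulVec_diagonal, Pi.star_apply, mul_left_comm, Complex.star_def, ← Complex.normSq_eq_conj_mul_self,
    ← Complex.ofReal_mul, Complex.ofReal_re]

theorem exists_bottom_frame {E J C : Matrix ι ι ℂ} (hE : E.IsHermitian) (hJJ : J * J = 1)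
    (hJE : J * E * J = -E) (h0 : E ≠ 0) (hC : C.IsHermitian) :
    ∃ (r : ℕ) (e : ℝ) (M : Matrix ι (Fin r) ℂ) (c : Fin r → ℝ), 1 ≤ r ∧ 0 < e ∧ Antitone c ∧
      Mᴴ * M = 1 ∧ E * M = -(e : ℂ) • M ∧ Mᴴ * C * M = diagonal (fun i => (c i : ℂ)) ∧
      ∀ ψ : ι → ℂ, ψ ≠ 0 → Mᴴ *ᵥ ψ = 0 → 0 < (star ψ ⬝ᵥ (E + (e : ℂ) • 1) *ᵥ ψ).re := by
  obtain ⟨i₁, hi₁⟩ := exists_eigenvalue_neg hE hJJ hJE h0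
  obtain ⟨U, u1, u2, d⟩ := exists_diag_fintype hE
  set v := hE.eigenvalues with hv
  have : Nonempty ι := ⟨i₁⟩
  obtain ⟨i₀, hi₀⟩ := Finite.exists_min v
  let κ := {i // v i = v i₀}
  let f := (Fintype.equivFin κ).symm
  let M := U.submatrix id fun k => (f k : ι)
  have hM : Mᴴ * M = 1 := by
    rw [conjTranspose_submatrix, ← submatrix_mul _ _ _ id _ Function.bijective_id, u2]
    exact submatrix_one _ (Subtype.val_injective.comp f.injective)
  have hEU : E * U = U * diagonal (fun i => (v i : ℂ)) := by
    conv_lhs => rw [d]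
    rw [Matrix.mul_assoc, u2, Matrix.mul_one]
  have hEM : E * M = (v i₀ : ℂ) • M := by
    ext i k
    have := congrFun (congrFun hEU i) (f k)
    rw [mul_diagonal, (f k).2] at this
    rw [Matrix.smul_apply, smul_eq_mul, mul_comm]
    exact this
  obtain ⟨R, c, hc, r1, r2, hR⟩ := exists_diag_antitone
    (isHermitian_conjTranspose_mul_mul M hC) (Fintype.card_fin (Fintype.card κ))
  refine ⟨Fintype.card κ, -v i₀, M * R, c, Fintype.card_pos_iff.2 ⟨⟨i₀, rfl⟩⟩,
    neg_pos.2 ((hi₀ i₁).trans_lt hi₁), hc, ?_, ?_, ?_, ?_⟩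
  · rw [conjTranspose_mul]
    calc _ = Rᴴ * (Mᴴ * M) * R := by simp only [Matrix.mul_assoc]
      _ = 1 := by rw [hM, Matrix.mul_one, r2]
  · rw [← Matrix.mul_assoc, hEM, Matrix.smul_mul, Complex.ofReal_neg, neg_neg]
  · rw [conjTranspose_mul]
    calc _ = Rᴴ * (Mᴴ * C * M) * R := by simp only [Matrix.mul_assoc]
      _ = (Rᴴ * R) * diagonal (fun i => (c i : ℂ)) * (Rᴴ * R) := by
        rw [hR]
        simp only [Matrix.mul_assoc]
      _ = _ := by rw [r2, Matrix.one_mul, Matrix.mul_one]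
  · intro ψ hψ hMψ
    have h1 : Mᴴ *ᵥ ψ = 0 := by
      rw [conjTranspose_mul, ← mulVec_mulVec] at hMψ
      have := congrArg (fun x => R *ᵥ x) hMψ
      simpa [mulVec_mulVec, ← Matrix.mul_assoc, r1] using this
    have hE' : E + ((-v i₀ : ℝ) : ℂ) • 1 =
        U * diagonal (fun i => ((v i - v i₀ : ℝ) : ℂ)) * Uᴴ := by
      have h2 : (diagonal fun i => ((v i - v i₀ : ℝ) : ℂ)) =
          diagonal (fun i => (v i : ℂ)) + ((-v i₀ : ℝ) : ℂ) • 1 := by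
        ext i j
        by_cases hij : i = j <;> simp [hij, sub_eq_add_neg]
      rw [h2, Matrix.mul_add, Matrix.add_mul, ← d, Matrix.mul_smul, Matrix.smul_mul,
        Matrix.mul_one, u1]
    have h3 : (star ψ ⬝ᵥ (E + ((-v i₀ : ℝ) : ℂ) • 1) *ᵥ ψ) =
        star (Uᴴ *ᵥ ψ) ⬝ᵥ diagonal (fun i => ((v i - v i₀ : ℝ) : ℂ)) *ᵥ (Uᴴ *ᵥ ψ) := by
      rw [hE', star_mulVec, conjTranspose_conjTranspose, ← dotProduct_mulVec, mulVec_mulVec,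
        mulVec_mulVec]
    rw [h3, star_dotProduct_diagonal_mulVec]
    have hφ : Uᴴ *ᵥ ψ ≠ 0 := fun h => hψ (by
      have := congrArg (fun x => U *ᵥ x) h
      simpa [mulVec_mulVec, u1] using this)
    obtain ⟨i, hi⟩ := Function.ne_iff.1 hφ
    refine Finset.sum_pos' (fun j _ => mul_nonneg (sub_nonneg.2 (hi₀ j)) (Complex.normSq_nonneg _))
      ⟨i, Finset.mem_univ _, mul_pos (sub_pos.2 ((hi₀ i).lt_of_ne fun h => hi ?_))
        (Complex.normSq_pos.2 hi)⟩
    have := congrFun h1 (f.symm ⟨i, h.symm⟩)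
    simp only [mulVec, dotProduct, conjTranspose_apply, M, submatrix_apply, id,
      Equiv.apply_symm_apply] at this
    simp only [mulVec, dotProduct, conjTranspose_apply]
    exact this

end BottomFrame

section Blocks

variable {ι κ τ : Type*} [Fintype ι] [Fintype κ] [Fintype τ] [DecidableEq ι] [DecidableEq κ]
  [DecidableEq τ] {M : Matrix ι κ ℂ} {Q : Matrix ι τ ℂ}

omit [DecidableEq ι] in
theorem card_le_of_orthonormal_cols (hM : Mᴴ * M = 1) : Fintype.card κ ≤ Fintype.card ι := by
  have h1 := rank_mul_le_right Mᴴ M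
  rw [hM, rank_one] at h1
  exact h1.trans (rank_le_card_height M)

omit [Fintype κ] [Fintype τ] [DecidableEq ι] in
theorem fromCols_orthonormal_iff : (fromCols M Q)ᴴ * fromCols M Q = 1 ↔
    Mᴴ * M = 1 ∧ Mᴴ * Q = 0 ∧ Qᴴ * M = 0 ∧ Qᴴ * Q = 1 := by
  rw [conjTranspose_fromCols_eq_fromRows_conjTranspose, fromRows_mul_fromCols, ← fromBlocks_one,
    fromBlocks_inj]

omit [Fintype τ] [DecidableEq ι] in
theorem conj_fromCols (h : (fromCols M Q)ᴴ * fromCols M Q = 1) {Z : Matrix ι ι ℂ}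
    (hZ : Z.IsHermitian) {N : Matrix κ κ ℂ} (hN : Z * M = M * N) :
    (fromCols M Q)ᴴ * Z * fromCols M Q = fromBlocks N 0 0 (Qᴴ * Z * Q) := by
  obtain ⟨h1, h2, h3, h4⟩ := fromCols_orthonormal_iff.1 h
  have h5 : Mᴴ * Z = Nᴴ * Mᴴ := by
    rw [← conjTranspose_mul, ← hN, conjTranspose_mul, hZ.eq]
  rw [conjTranspose_fromCols_eq_fromRows_conjTranspose, Matrix.mul_assoc, mul_fromCols,
    fromRows_mul_fromCols, hN, ← Matrix.mul_assoc, h1, ← Matrix.mul_assoc Qᴴ M, h3,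
    ← Matrix.mul_assoc Mᴴ Z, h5, Matrix.mul_assoc Nᴴ, h2]
  simp [Matrix.mul_assoc]

theorem mul_eq_mul_compress (h : (fromCols M Q)ᴴ * fromCols M Q = 1)
    (h' : fromCols M Q * (fromCols M Q)ᴴ = 1) {Z : Matrix ι ι ℂ}
    (hZ : Z.IsHermitian) {N : Matrix κ κ ℂ} (hN : Z * M = M * N) : Z * Q = Q * (Qᴴ * Z * Q) := by
  obtain ⟨h1, h2, h3, h4⟩ := fromCols_orthonormal_iff.1 h
  have h5 : Mᴴ * Z = Nᴴ * Mᴴ := by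
    rw [← conjTranspose_mul, ← hN, conjTranspose_mul, hZ.eq]
  have h6 : M * Mᴴ + Q * Qᴴ = 1 := by
    rw [← h', conjTranspose_fromCols_eq_fromRows_conjTranspose, fromCols_mul_fromRows]
  calc Z * Q = (M * Mᴴ + Q * Qᴴ) * (Z * Q) := by rw [h6, Matrix.one_mul]
    _ = M * (Mᴴ * Z * Q) + Q * (Qᴴ * Z * Q) := by simp only [Matrix.add_mul, Matrix.mul_assoc]
    _ = _ := by rw [h5, Matrix.mul_assoc Nᴴ, h2, Matrix.mul_zero, Matrix.mul_zero, zero_add]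

end Blocks

theorem sum_eq_re_trace_of_spectral {κ : Type*} [Fintype κ] [DecidableEq κ] {A R : Matrix κ κ ℂ}
    {v : κ → ℝ} (hR : Rᴴ * R = 1) (hA : A = R * diagonal (fun i => (v i : ℂ)) * Rᴴ) :
    ∑ i, v i = A.trace.re := by
  rw [hA, trace_mul_cycle, hR, Matrix.one_mul, trace_diagonal, ← Complex.ofReal_sum,
    Complex.ofReal_re]

theorem diagonal_ofReal_neg {κ : Type*} [DecidableEq κ] (v : κ → ℝ) :
    (diagonal fun i => ((-v i : ℝ) : ℂ)) = -diagonal fun i => (v i : ℂ) := by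
  ext i j
  by_cases hij : i = j <;> simp [hij]

theorem exists_isCrossSystem {τ : Type*} [Fintype τ] [DecidableEq τ] {r : ℕ} (hr : 1 ≤ r) {e : ℝ}
    (he : 0 < e) {x y : Matrix (Fin r) (Fin r) ℂ} {c : Fin r → ℝ} {J X C D G : Matrix τ τ ℂ}
    (hx : x.IsHermitian) (hy : y.IsHermitian) (hc : Antitone c)
    (hxy : x - y = diagonal (fun i => ((c i - 2 * e : ℝ) : ℂ))) (hJ : J.IsHermitian)
    (hX : X.IsHermitian) (hC : C.IsHermitian) (hD : D.IsHermitian) (hJJ : J * J = 1)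
    (hJD : J * D = -(D * J)) (hJC : J * C = -(C * J)) (hXD : X * D = D * X) (hCD : C * D = D * C)
    (hDX : D = X - J * X * J - C) (hG : D + (2 * e : ℂ) • (1 : Matrix τ τ ℂ) = (2 : ℂ) • G)
    (hpos : ∀ ψ : τ → ℂ, ψ ≠ 0 → 0 < (star ψ ⬝ᵥ G *ᵥ ψ).re)
    (h : SecondOrder (fromBlocks (fromBlocks 0 1 1 0) 0 0 J) (fromBlocks (fromBlocks x 0 0 y) 0 0 X)
      (fromBlocks (fromBlocks (diagonal fun i => (c i : ℂ)) 0 0 (-diagonal fun i => (c i : ℂ)))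
        0 0 C)
      (fromBlocks (fromBlocks (-(2 * e : ℂ) • (1 : Matrix (Fin r) (Fin r) ℂ)) 0 0
        ((2 * e : ℂ) • (1 : Matrix (Fin r) (Fin r) ℂ))) 0 0 D)) :
    ∃ (A T : Fin 3 → Matrix τ τ ℂ) (B R : Fin 3 → Matrix (Fin r) (Fin r) ℂ) (α : Fin 3 → τ → ℝ)
      (β : Fin 3 → Fin r → ℝ), IsCrossSystem G A T B R α β ∧ (∀ k, Antitone (β k)) ∧
      (∀ t, α 1 t = -α 0 t) ∧ (∀ f, β 2 f < 0) ∧ (∀ i j, -β 1 j ≤ β 0 i) ∧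
      HasSpec (fromBlocks (fromBlocks x 0 0 y) 0 0 X)
        (Sum.elim (Sum.elim (β 0) fun f => -β 1 f) (α 0)) ∧
      HasSpec (fromBlocks (fromBlocks (diagonal fun i => (c i : ℂ)) 0 0
          (-diagonal fun i => (c i : ℂ))) 0 0 C)
        (Sum.elim (Sum.elim (fun f : Fin r => -β 2 f.rev) fun f : Fin r => β 2 f.rev)
          fun t => -α 2 t) ∧ ∑ f, β 0 f + ∑ f, β 1 f + ∑ f, β 2 f < 0 := by
  have hcH : (diagonal fun i => (c i : ℂ)).IsHermitian := by
    rw [IsHermitian, diagonal_conjTranspose]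
    congr 1
    funext i
    simp
  obtain ⟨T₀, t1, t2, t3⟩ := exists_diag_fintype hX
  obtain ⟨T₂, w1, w2, w3⟩ := exists_diag_fintype hC.neg
  generalize hX.eigenvalues = a at t3
  generalize hC.neg.eigenvalues = g at w3
  obtain ⟨R₀, b, hb, r1, r2, r3⟩ := exists_diag_antitone hx (Fintype.card_fin r)
  obtain ⟨R₁, b', hb', p1, p2, p3⟩ := exists_diag_antitone hy.neg (Fintype.card_fin r)
  have hc' : Antitone fun f : Fin r => -c f.rev := fun i j hij =>
    neg_le_neg (hc (Fin.rev_le_rev.2 hij))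
  obtain ⟨R₂, q1, q2, q3⟩ := exists_diag_of_hasSpec hcH.neg hc'
    ((hasSpec_diagonal c).neg_rev (Equiv.refl _) hcH hc)
  have hy' : y = R₁ * diagonal (fun i => ((-b' i : ℝ) : ℂ)) * R₁ᴴ := by
    rw [diagonal_ofReal_neg, Matrix.mul_neg, Matrix.neg_mul, ← p3, neg_neg]
  obtain ⟨hc0, hle⟩ := pos_and_le_of_secondOrder he r1 r3 p1 hy' hxy h.of_fromBlocks
  have hJXJ : -(J * X * J) = J * T₀ * diagonal (fun i => ((-a i : ℝ) : ℂ)) * (J * T₀)ᴴ := by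
    rw [diagonal_ofReal_neg, conjTranspose_mul, hJ.eq, t3]
    simp only [Matrix.mul_neg, Matrix.neg_mul, Matrix.mul_assoc]
  have hGc : ∀ Y : Matrix τ τ ℂ, Y * D = D * Y → G * Y = Y * G := fun Y hY => by
    have h2 : (2 : ℂ) • (G * Y) = (2 : ℂ) • (Y * G) := by
      rw [← Matrix.smul_mul, ← Matrix.mul_smul, ← hG, Matrix.add_mul, Matrix.mul_add, hY,
        Matrix.smul_mul, Matrix.mul_smul, Matrix.one_mul, Matrix.mul_one]
    exact smul_right_injective _ two_ne_zero h2
  have hGh : G.IsHermitian := by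
    have h2 : G = (1 / 2 : ℂ) • (D + (2 * e : ℂ) • (1 : Matrix τ τ ℂ)) := by
      rw [hG, smul_smul]
      norm_num
    rw [h2, IsHermitian, conjTranspose_smul, conjTranspose_add, hD.eq, conjTranspose_smul,
      conjTranspose_one]
    congr 2
    · simp
    · simp
  have hJXJD : -(J * X * J) * D = D * -(J * X * J) := by
    have h1 : J * X * J * D = D * (J * X * J) := by
      calc J * X * J * D = J * X * (J * D) := by simp only [Matrix.mul_assoc]
        _ = -(J * (X * D) * J) := by
          rw [hJD]
          simp only [Matrix.mul_neg, Matrix.mul_assoc]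
        _ = -(J * D) * (X * J) := by
          rw [hXD]
          simp only [Matrix.neg_mul, Matrix.mul_assoc]
        _ = _ := by
          rw [hJD, neg_neg]
          simp only [Matrix.mul_assoc]
    rw [Matrix.neg_mul, Matrix.mul_neg, h1]
  have hS : IsCrossSystem G ![X, -(J * X * J), -C] ![T₀, J * T₀, T₂]
      ![x, -y, -diagonal fun i => (c i : ℂ)] ![R₀, R₁, R₂] ![a, fun t => -a t, g]
      ![b, b', fun f => -c f.rev] := by
    refine ⟨hGh, hpos, ?_, ?_, ?_, ?_, ?_, ?_, ?_⟩
    · intro k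
      fin_cases k
      · exact hGc _ hXD
      · exact hGc _ hJXJD
      · exact hGc (-C) (by rw [Matrix.neg_mul, Matrix.mul_neg, hCD])
    · intro k
      fin_cases k
      · exact t1
      · show J * T₀ * (J * T₀)ᴴ = 1
        rw [conjTranspose_mul, hJ.eq, show J * T₀ * (T₀ᴴ * J) = J * (T₀ * T₀ᴴ) * J by
          simp only [Matrix.mul_assoc], t1, Matrix.mul_one, hJJ]
      · exact w1
    · intro k
      fin_cases k
      · exact t3
      · exact hJXJ
      · exact w3
    · intro k
      fin_cases k
      · exact r1
      · exact p1
      · exact q1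
    · intro k
      fin_cases k
      · exact r3
      · exact p3
      · exact q3
    · intro φ
      rw [Fin.sum_univ_three]
      show (X * φ - φ * x) + (-(J * X * J) * φ - φ * -y) +
        (-C * φ - φ * -diagonal fun i => (c i : ℂ)) = _
      have h3 : (diagonal fun i => (c i : ℂ)) = x - y + (2 * e : ℂ) • 1 := by
        rw [hxy]
        ext i j
        by_cases hij : i = j <;> simp [hij]
      rw [← Matrix.smul_mul, ← hG, hDX, h3]
      simp only [Matrix.add_mul, Matrix.sub_mul, Matrix.mul_add, Matrix.mul_sub, Matrix.mul_neg,
        Matrix.neg_mul, Matrix.mul_smul, Matrix.smul_mul, Matrix.one_mul, Matrix.mul_one]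
      abel
    · intro Z hZ
      rw [Fin.sum_univ_three] at hZ ⊢
      exact h.cross hx hy hcH hX hC hD hJ hJJ hJD hJC hG hZ
  refine ⟨_, _, _, _, _, _, hS, ?_, fun t => rfl, fun f => neg_lt_zero.2 (hc0 _),
    fun i j => hle i j, ?_, ?_, ?_⟩
  · intro k
    fin_cases k
    · exact hb
    · exact hb'
    · exact hc'
  · exact ((hasSpec_of_eq r1 r2 r3).fromBlocks (hasSpec_of_eq p1 p2 hy')).fromBlocks
      (hasSpec_of_eq t1 t2 t3)
  · have h1 : HasSpec C fun t => -g t := by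
      have := HasSpec.neg w1 w2 w3
      rwa [neg_neg] at this
    have h2 := hasSpec_diagonal (fun i => -c i)
    rw [diagonal_ofReal_neg] at h2
    have := ((hasSpec_diagonal c).fromBlocks h2).fromBlocks h1
    show HasSpec _ (Sum.elim (Sum.elim (fun f : Fin r => -(-c f.rev.rev)) fun f : Fin r =>
      -c f.rev.rev) fun t => -g t)
    simpa only [Fin.rev_rev, neg_neg] using this
  · show ∑ f, b f + ∑ f, b' f + ∑ f : Fin r, -c f.rev < 0
    have h1 := congrArg (fun Y => (trace Y).re) hxy
    simp only [trace_sub, Complex.sub_re, trace_diagonal, ← Complex.ofReal_sum,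
      Complex.ofReal_re, Finset.sum_sub_distrib, Finset.sum_const, Finset.card_univ,
      Fintype.card_fin, nsmul_eq_mul] at h1
    have h2 := sum_eq_re_trace_of_spectral p2 p3
    rw [trace_neg, Complex.neg_re] at h2
    have h3 := Equiv.sum_comp Fin.revPerm fun f => -c f
    simp only [Fin.revPerm_apply] at h3
    rw [h3, sum_eq_re_trace_of_spectral r2 r3, h2, Finset.sum_neg_distrib]
    have h4 : (1 : ℝ) ≤ r := Nat.one_le_cast.2 hr
    have h5 : 0 < (r : ℝ) * (2 * e) := by positivity
    linarith

section

variable {ι : Type*} [Fintype ι] [DecidableEq ι]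

theorem eq_mul_of_bottom_frame {D : Matrix ι ι ℂ} {r : ℕ} {e : ℝ} {M : Matrix ι (Fin r) ℂ}
    (hM : Mᴴ * M = 1) (hDM : D * M = -(2 * e : ℂ) • M)
    (hpos : ∀ ψ : ι → ℂ, ψ ≠ 0 → Mᴴ *ᵥ ψ = 0 →
      0 < (star ψ ⬝ᵥ ((1 / 2 : ℂ) • D + (e : ℂ) • 1) *ᵥ ψ).re)
    {W : Matrix ι (Fin r) ℂ} (hW : D * W = -(2 * e : ℂ) • W) : W = M * (Mᴴ * W) := by
  rw [← sub_eq_zero]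
  set N := W - M * (Mᴴ * W) with hN
  have h1 : Mᴴ * N = 0 := by
    rw [hN, Matrix.mul_sub, ← Matrix.mul_assoc, hM, Matrix.one_mul, sub_self]
  have h2 : ((1 / 2 : ℂ) • D + (e : ℂ) • 1) * N = 0 := by
    have h3 : D * N = -(2 * e : ℂ) • N := by
      rw [hN, Matrix.mul_sub, ← Matrix.mul_assoc, hDM, hW, Matrix.smul_mul, smul_sub]
    rw [Matrix.add_mul, Matrix.smul_mul, h3, Matrix.smul_mul, Matrix.one_mul, smul_smul, ← add_smul]
    ring_nf
    simp
  have h4 : ∀ j, (fun i => N i j) = 0 := fun j => by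
    by_contra hne
    have h5 := hpos _ hne (funext fun k => congrFun (congrFun h1 k) j)
    have h6 : ((1 / 2 : ℂ) • D + (e : ℂ) • 1) *ᵥ (fun i => N i j) = 0 :=
      funext fun k => congrFun (congrFun h2 k) j
    rw [h6, dotProduct_zero] at h5
    exact lt_irrefl _ h5
  ext i j
  exact congrFun (h4 j) i

theorem SecondOrder.eq_zero {J X C D : Matrix ι ι ℂ} (hJ : J.IsHermitian) (hJJ : J * J = 1)
    (hX : X.IsHermitian) (hC : C.IsHermitian) (hD : D.IsHermitian) (hJC : J * C * J = -C)
    (hJD : J * D * J = -D) (hXD : X * D = D * X) (hCD : C * D = D * C)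
    (hDX : D = X - J * X * J - C) (h : SecondOrder J X C D) {p q : ℕ}
    (hS : ∀ r, r < q → HornSufficient r) {lam : Fin (p + q) → ℝ} {s : Fin q → ℝ}
    (hlam : Antitone lam) (hs : Antitone s) (hs0 : ∀ i, 0 ≤ s i)
    (hLR : ∀ r : ℕ, 1 ≤ r → r ≤ q → ∀ (I J K : Finset (Fin q)) (hI : I.card = r) (hJ : J.card = r)
      (hK : K.card = r), (muVec I hI, muVec J hJ, muVec K hK) ∈ Horn r →
      ∑ k ∈ K, s k ≤ ∑ i ∈ I, lam (Fin.castLE (Nat.le_add_left q p) i) -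
        ∑ j ∈ J, lam (Fin.castLE (Nat.le_add_left q p) j).rev)
    (hXs : HasSpec X lam) (hCs : HasSpec C (hatPQ p q s)) : D = 0 := by
  by_contra h0
  have jj : ∀ {κ : Type} (Z : Matrix ι κ ℂ), J * (J * Z) = Z := fun Z => by
    rw [← Matrix.mul_assoc, hJJ, Matrix.one_mul]
  have hswap : ∀ Z : Matrix ι ι ℂ, J * Z * J = -Z → J * Z = -(Z * J) := fun Z hZ => by
    rw [← Matrix.neg_mul, ← hZ, Matrix.mul_assoc _ J J, hJJ, Matrix.mul_one]
  have hJC' := hswap C hJC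
  have hJD' := hswap D hJD
  have hE : ((1 / 2 : ℂ) • D).IsHermitian := by
    rw [IsHermitian, conjTranspose_smul, hD.eq]
    congr 1
    simp
  obtain ⟨r, e, M₀, c, hr, he, hc, hM, hEM, hCM, hpos⟩ := exists_bottom_frame hE hJJ
    (by rw [Matrix.mul_smul, Matrix.smul_mul, hJD, smul_neg])
    (smul_ne_zero (by norm_num) h0) hC
  have hDM : D * M₀ = -(2 * e : ℂ) • M₀ := by
    have h1 := congrArg (fun Y => (2 : ℂ) • Y) hEM
    simp only [Matrix.smul_mul, smul_smul] at h1
    norm_num at h1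
    rw [h1, neg_smul]
  have hcomm : ∀ Y : Matrix ι ι ℂ, Y * D = D * Y → Y * M₀ = M₀ * (M₀ᴴ * Y * M₀) := fun Y hY => by
    rw [Matrix.mul_assoc M₀ᴴ]
    refine eq_mul_of_bottom_frame hM hDM hpos ?_
    rw [← Matrix.mul_assoc, ← hY, Matrix.mul_assoc, hDM, Matrix.mul_smul]
  have hJXJD : J * X * J * D = D * (J * X * J) := by
    calc J * X * J * D = J * X * (J * D) := by simp only [Matrix.mul_assoc]
      _ = -(J * (X * D) * J) := by
        rw [hJD']
        simp only [Matrix.mul_neg, Matrix.mul_assoc]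
      _ = -(J * D) * (X * J) := by
        rw [hXD]
        simp only [Matrix.neg_mul, Matrix.mul_assoc]
      _ = _ := by
        rw [hJD', neg_neg]
        simp only [Matrix.mul_assoc]
  have hXM := hcomm X hXD
  have hYM := hcomm _ hJXJD
  have hCM' := hcomm C hCD
  rw [hCM] at hCM'
  set x := M₀ᴴ * X * M₀ with hx
  set y := M₀ᴴ * (J * X * J) * M₀ with hy
  set δ := diagonal fun i => (c i : ℂ) with hδ
  have hxH : x.IsHermitian := isHermitian_conjTranspose_mul_mul M₀ hX
  have hJXJ : (J * X * J).IsHermitian := by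
    have := isHermitian_conjTranspose_mul_mul J hX
    rwa [hJ.eq] at this
  have hyH : y.IsHermitian := isHermitian_conjTranspose_mul_mul M₀ hJXJ
  have hxy : x - y = diagonal (fun i => ((c i - 2 * e : ℝ) : ℂ)) := by
    have h1 : x - y - δ = -(2 * e : ℂ) • 1 := by
      rw [hx, hy, ← hCM, ← Matrix.sub_mul, ← Matrix.sub_mul, ← Matrix.mul_sub, ← Matrix.mul_sub,
        ← hDX, Matrix.mul_assoc, hDM, Matrix.mul_smul, hM]
    rw [sub_eq_iff_eq_add] at h1
    rw [h1, hδ]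
    ext i j
    by_cases hij : i = j
    · subst hij
      simp
      ring
    · simp [hij]
  set M₁ := J * M₀ with hM₁
  have hDM₁ : D * M₁ = (2 * e : ℂ) • M₁ := by
    rw [hM₁, ← Matrix.mul_assoc, ← neg_neg (D * J), ← hJD', Matrix.neg_mul, Matrix.mul_assoc, hDM,
      Matrix.mul_smul, ← neg_smul, neg_neg]
  have h01 : M₀ᴴ * M₁ = 0 := by
    have h1 : M₀ᴴ * D = -(2 * e : ℂ) • M₀ᴴ := by
      have h2 := congrArg conjTranspose hDM
      rw [conjTranspose_mul, hD.eq, conjTranspose_smul] at h2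
      rw [h2]
      congr 1
      simp
    have h3 : (2 * e : ℂ) • (M₀ᴴ * M₁) = -(2 * e : ℂ) • (M₀ᴴ * M₁) := by
      rw [← Matrix.mul_smul, ← hDM₁, ← Matrix.mul_assoc, h1, Matrix.smul_mul]
    rw [← sub_eq_zero, ← sub_smul] at h3
    refine (smul_eq_zero.1 h3).resolve_left ?_
    have : (e : ℂ) ≠ 0 := Complex.ofReal_ne_zero.2 he.ne'
    ring_nf
    simpa using this
  have h10 : M₁ᴴ * M₀ = 0 := by
    rw [← conjTranspose_conjTranspose M₀, ← conjTranspose_mul, h01, conjTranspose_zero]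
  have h11 : M₁ᴴ * M₁ = 1 := by
    rw [hM₁, conjTranspose_mul, hJ.eq, Matrix.mul_assoc, jj, hM]
  have hMM := fromCols_orthonormal_iff.2 ⟨hM, h01, h10, h11⟩
  have hcard : Fintype.card ι = Fintype.card (Fin r ⊕ Fin r) +
      Fintype.card (Fin (Fintype.card ι - Fintype.card (Fin r ⊕ Fin r))) := by
    rw [Fintype.card_fin]
    have := card_le_of_orthonormal_cols hMM
    omega
  obtain ⟨Q, hV, hV'⟩ := exists_unitary_extension hcard hMM
  generalize Fintype.card ι - Fintype.card (Fin r ⊕ Fin r) = n at Q hV hV'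
  have nJ : J * fromCols M₀ M₁ = fromCols M₀ M₁ *
      fromBlocks 0 (1 : Matrix (Fin r) (Fin r) ℂ) (1 : Matrix (Fin r) (Fin r) ℂ) 0 := by
    rw [mul_fromCols, fromCols_mul_fromBlocks, hM₁, jj]
    simp
  have nX : X * fromCols M₀ M₁ = fromCols M₀ M₁ * fromBlocks x 0 0 y := by
    have h1 : X * M₁ = M₁ * y := by
      rw [hM₁, Matrix.mul_assoc J, ← hYM]
      simp only [Matrix.mul_assoc, jj]
    rw [mul_fromCols, fromCols_mul_fromBlocks, hXM, h1]
    simp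
  have nC : C * fromCols M₀ M₁ = fromCols M₀ M₁ * fromBlocks δ 0 0 (-δ) := by
    have h1 : C * M₁ = M₁ * -δ := by
      rw [hM₁, ← Matrix.mul_assoc, ← neg_neg (C * J), ← hJC', Matrix.neg_mul, Matrix.mul_assoc,
        hCM', Matrix.mul_neg, Matrix.mul_assoc]
    rw [mul_fromCols, fromCols_mul_fromBlocks, hCM', h1]
    simp
  have nD : D * fromCols M₀ M₁ = fromCols M₀ M₁ *
      fromBlocks (-(2 * e : ℂ) • (1 : Matrix (Fin r) (Fin r) ℂ)) 0 0
        ((2 * e : ℂ) • (1 : Matrix (Fin r) (Fin r) ℂ)) := by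
    rw [mul_fromCols, fromCols_mul_fromBlocks, hDM, hDM₁]
    simp
  obtain ⟨k1, k2, k3, k4⟩ := fromCols_orthonormal_iff.1 hV
  have k5 : M₀ᴴ * Q = 0 := by
    rw [conjTranspose_fromCols_eq_fromRows_conjTranspose, fromRows_mul] at k2
    ext i j
    exact congrFun (congrFun k2 (Sum.inl i)) j
  have hmul : ∀ Z Z' : Matrix ι ι ℂ, Z' * Q = Q * (Qᴴ * Z' * Q) →
      (Qᴴ * Z * Q) * (Qᴴ * Z' * Q) = Qᴴ * (Z * Z') * Q := fun Z Z' hZ' => by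
    rw [Matrix.mul_assoc (Qᴴ * Z), ← hZ']
    simp only [Matrix.mul_assoc]
  have qJ := mul_eq_mul_compress hV hV' hJ nJ
  have qX := mul_eq_mul_compress hV hV' hX nX
  have qC := mul_eq_mul_compress hV hV' hC nC
  have qD := mul_eq_mul_compress hV hV' hD nD
  have hSO := h.conj hV' hV
  have bX := conj_fromCols hV hX nX
  have bC := conj_fromCols hV hC nC
  rw [conj_fromCols hV hJ nJ, bX, bC, conj_fromCols hV hD nD] at hSO
  obtain ⟨A, T, B, R, α, β, hsys, hβ, hα, hβ2, hβ01, hX', hC', hlt⟩ := exists_isCrossSystem hr he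
    (G := Qᴴ * ((1 / 2 : ℂ) • D + (e : ℂ) • 1) * Q) hxH hyH hc hxy
    (isHermitian_conjTranspose_mul_mul Q hJ) (isHermitian_conjTranspose_mul_mul Q hX)
    (isHermitian_conjTranspose_mul_mul Q hC) (isHermitian_conjTranspose_mul_mul Q hD)
    (by rw [hmul _ _ qJ, hJJ, Matrix.mul_one, k4])
    (by rw [hmul _ _ qJ, hmul _ _ qD, hJD', Matrix.mul_neg, Matrix.neg_mul])
    (by rw [hmul _ _ qJ, hmul _ _ qC, hJC', Matrix.mul_neg, Matrix.neg_mul])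
    (by rw [hmul _ _ qX, hmul _ _ qD, hXD]) (by rw [hmul _ _ qC, hmul _ _ qD, hCD])
    (by
      rw [hmul _ _ qX, hmul _ _ qJ, ← Matrix.sub_mul, ← Matrix.sub_mul, ← Matrix.mul_sub,
        ← Matrix.mul_sub, ← hDX])
    (by
      rw [Matrix.mul_add, Matrix.add_mul, Matrix.mul_smul, Matrix.smul_mul, Matrix.mul_smul,
        Matrix.smul_mul, Matrix.mul_one, k4, smul_add, smul_smul, smul_smul]
      norm_num)
    (fun ψ hψ => by
      have h1 := hpos (Q *ᵥ ψ) (fun h1 => hψ (by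
        have := congrArg (fun x => Qᴴ *ᵥ x) h1
        simpa [mulVec_mulVec, k4] using this)) (by rw [mulVec_mulVec, k5, zero_mulVec])
      rw [star_mulVec, ← dotProduct_mulVec, mulVec_mulVec, mulVec_mulVec] at h1
      exact h1) hSO
  rw [← bX] at hX'
  rw [← bC] at hC'
  refine absurd (hsys.sum_le hβ hr (fun hrq => hS r hrq) hlam hs hs0 (fun I J K hI hJ hK => ?_) hα
    hβ2 hβ01 (hXs.conj hV' hV) hX' (hCs.conj hV' hV) hC') (not_le.2 hlt)
  exact hLR r hr (by
    have := Finset.card_le_univ I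
    rwa [hI, Fintype.card_fin] at this) I J K hI hJ hK

end

theorem rectDiag_smul {p q : ℕ} (c : ℝ) (s : Fin q → ℝ) :
    rectDiag p (fun i => c * s i) = (c : ℂ) • rectDiag p s := by
  ext i j
  simp [rectDiag]

theorem exists_fromBlocks_of_lr {p q : ℕ} (hpq : q ≤ p) (hS : ∀ r, r < q → HornSufficient r)
    {lam : Fin (p + q) → ℝ} {s : Fin q → ℝ} (hlam : Antitone lam) (hs : Antitone s)
    (hs0 : ∀ i, 0 ≤ s i)
    (hLR : ∀ r : ℕ, 1 ≤ r → r ≤ q → ∀ (I J K : Finset (Fin q)) (hI : I.card = r) (hJ : J.card = r)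
      (hK : K.card = r), (muVec I hI, muVec J hJ, muVec K hK) ∈ Horn r →
      2 * ∑ k ∈ K, s k ≤ ∑ i ∈ I, lam (Fin.castLE (Nat.le_add_left q p) i) -
        ∑ j ∈ J, lam (Fin.castLE (Nat.le_add_left q p) j).rev) :
    ∃ X : Matrix (Fin p ⊕ Fin q) (Fin p ⊕ Fin q) ℂ, X.IsHermitian ∧ HasSpec X lam ∧
      X.toBlocks₁₂ = rectDiag p s := by
  let L : Matrix (Fin p ⊕ Fin q) (Fin p ⊕ Fin q) ℂ :=
    (diagonal fun i => (lam i : ℂ)).submatrix finSumFinEquiv finSumFinEquiv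
  have hL : L.IsHermitian := by
    refine IsHermitian.submatrix ?_ _
    rw [IsHermitian, diagonal_conjTranspose]
    congr 1
    funext i
    simp
  have hLs : HasSpec L lam := (hasSpec_diagonal lam).reindex _
  let H : Matrix (Fin p ⊕ Fin q) (Fin p ⊕ Fin q) ℂ :=
    fromBlocks 0 (rectDiag p fun i => 2 * s i) (rectDiag p fun i => 2 * s i)ᴴ 0
  have hHs : HasSpec H _ := hasSpec_hat hpq fun i => 2 * s i
  let J : Matrix (Fin p ⊕ Fin q) (Fin p ⊕ Fin q) ℂ := fromBlocks 1 0 0 (-1)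
  have hJ : J.IsHermitian := by
    simp [J, IsHermitian, fromBlocks_conjTranspose]
  have hJJ : J * J = 1 := by
    simp [J, fromBlocks_multiply]
  have hH : H.IsHermitian := by
    simp [H, IsHermitian, fromBlocks_conjTranspose]
  have hJH : J * H * J = -H := by
    simp [J, H, fromBlocks_multiply, fromBlocks_neg]
  obtain ⟨X, C, U, W, D, u1, u2, w1, w2, hJW, hX, hC, hD, hXh, hCh, hDh, hJC, hJD, hXD, hCD, h⟩ :=
    exists_critical hJ hJJ hL hH hJH
  have hXs : HasSpec X lam := hX ▸ hLs.conj u2 u1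
  have hCs : HasSpec C (hatPQ p q fun i => 2 * s i) := hC ▸ hHs.conj w2 w1
  have hD0 : D = 0 := h.eq_zero hJ hJJ hXh hCh hDh hJC hJD hXD hCD hD hS hlam
    (fun i j hij => mul_le_mul_of_nonneg_left (hs hij) zero_le_two)
    (fun i => mul_nonneg zero_le_two (hs0 i))
    (fun r h1 h2 I J K hI hJ hK hm => by
      rw [← Finset.mul_sum]
      exact hLR r h1 h2 I J K hI hJ hK hm) hXs hCs
  have hJW' : J * Wᴴ = Wᴴ * J := by
    have := congrArg conjTranspose hJW
    rw [conjTranspose_mul, conjTranspose_mul, hJ.eq] at this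
    exact this.symm
  have key : Wᴴ * X * W - J * (Wᴴ * X * W) * J = H := by
    have h1 : X - J * X * J = C := by
      rw [hD0] at hD
      exact sub_eq_zero.1 hD.symm
    calc _ = Wᴴ * X * W - (J * Wᴴ) * X * (W * J) := by simp only [Matrix.mul_assoc]
      _ = Wᴴ * (X - J * X * J) * W := by
        rw [hJW', ← hJW]
        simp only [Matrix.mul_sub, Matrix.sub_mul, Matrix.mul_assoc]
      _ = (Wᴴ * W) * H * (Wᴴ * W) := by
        rw [h1, hC]
        simp only [Matrix.mul_assoc]
      _ = H := by rw [w2, Matrix.one_mul, Matrix.mul_one]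
  refine ⟨Wᴴ * X * W, isHermitian_conjTranspose_mul_mul W hXh, hXs.conj w1 w2, ?_⟩
  generalize Wᴴ * X * W = Y at key ⊢
  rw [← fromBlocks_toBlocks Y] at key
  simp only [J, H, fromBlocks_multiply, fromBlocks_sub_fromBlocks] at key
  have h2 := (fromBlocks_inj.1 key).2.1
  rw [rectDiag_smul] at h2
  simp only [Matrix.one_mul, Matrix.zero_mul, add_zero, Matrix.mul_zero, Matrix.mul_neg,
    Matrix.mul_one, zero_add, sub_neg_eq_add, ← two_smul ℂ] at h2
  refine smul_right_injective _ (two_ne_zero (α := ℂ)) ?_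
  simpa [two_smul] using h2

theorem eq_zero_of_sum_mul_diag_eq_zero {r : ℕ} {P N : Matrix (Fin r) (Fin r) ℂ} {x y : Fin r → ℝ}
    (hx : ∀ i, 0 < x i) (hy : ∀ i, 0 < y i)
    (h : ∑ i, x i * ((P * Pᴴ) i i).re + ∑ i, y i * ((N * Nᴴ) i i).re = 0) : P = 0 ∧ N = 0 := by
  have e (M : Matrix (Fin r) (Fin r) ℂ) (i : Fin r) :
      ((M * Mᴴ) i i).re = ∑ j, Complex.normSq (M i j) := by
    simp only [Matrix.mul_apply, conjTranspose_apply, Complex.re_sum]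
    refine Finset.sum_congr rfl fun j _ => ?_
    rw [Complex.star_def, Complex.mul_conj, Complex.ofReal_re]
  have n (M : Matrix (Fin r) (Fin r) ℂ) (i : Fin r) : 0 ≤ ((M * Mᴴ) i i).re := by
    rw [e]
    exact Finset.sum_nonneg fun j _ => Complex.normSq_nonneg _
  have z (M : Matrix (Fin r) (Fin r) ℂ) {w : Fin r → ℝ} (hw : ∀ i, 0 < w i)
      (h : ∑ i, w i * ((M * Mᴴ) i i).re = 0) : M = 0 := by
    ext i j
    have h1 := (Finset.sum_eq_zero_iff_of_nonneg
      fun i _ => mul_nonneg (hw i).le (n M i)).1 h i (Finset.mem_univ i)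
    have h2 := (mul_eq_zero.1 h1).resolve_left (hw i).ne'
    rw [e] at h2
    exact Complex.normSq_eq_zero.1 ((Finset.sum_eq_zero_iff_of_nonneg
      fun j _ => Complex.normSq_nonneg _).1 h2 j (Finset.mem_univ j))
  have hP := Finset.sum_nonneg fun i (_ : i ∈ Finset.univ) => mul_nonneg (hx i).le (n P i)
  have hN := Finset.sum_nonneg fun i (_ : i ∈ Finset.univ) => mul_nonneg (hy i).le (n N i)
  exact ⟨z P hx (by linarith), z N hy (by linarith)⟩

theorem exists_diag_append_of_hasSpec {m n : ℕ} {X : Matrix (Fin m ⊕ Fin n) (Fin m ⊕ Fin n) ℂ}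
    (hX : X.IsHermitian) {x : Fin m → ℝ} {y : Fin n → ℝ} (hxy : Antitone (Fin.append x y))
    (h : HasSpec X (Fin.append x y)) :
    ∃ U : Matrix (Fin m ⊕ Fin n) (Fin m ⊕ Fin n) ℂ, U * Uᴴ = 1 ∧ Uᴴ * U = 1 ∧
      X = U * fromBlocks (diagonal fun i => (x i : ℂ)) 0 0 (diagonal fun i => (y i : ℂ)) * Uᴴ := by
  obtain ⟨U, h1, h2, h3⟩ := exists_diag_of_hasSpec (hX.submatrix finSumFinEquiv.symm) hxy
    (h.reindex finSumFinEquiv.symm)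
  refine ⟨U.submatrix finSumFinEquiv finSumFinEquiv, ?_, ?_, ?_⟩
  · rw [conjTranspose_submatrix, submatrix_mul_equiv, h1, submatrix_one_equiv]
  · rw [conjTranspose_submatrix, submatrix_mul_equiv, h2, submatrix_one_equiv]
  · have hd : fromBlocks (diagonal fun i => (x i : ℂ)) 0 0 (diagonal fun i => (y i : ℂ)) =
        (diagonal fun i => ((Fin.append x y i : ℝ) : ℂ)).submatrix finSumFinEquiv finSumFinEquiv := by
      rw [fromBlocks_diagonal, submatrix_diagonal_equiv]
      congr 1
      funext i
      rcases i with i | i <;> simp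
    rw [hd, conjTranspose_submatrix, submatrix_mul_equiv, submatrix_mul_equiv, ← h3,
      submatrix_submatrix]
    simp

/-- Equality in the trace bound for the off-diagonal block forces a decomposition of that block. -/
theorem exists_unitary_of_two_mul_trace_eq {r : ℕ} {x y : Fin r → ℝ} (hx : ∀ i, 0 < x i)
    (hy : ∀ i, 0 < y i) {U : Matrix (Fin r ⊕ Fin r) (Fin r ⊕ Fin r) ℂ} (hU' : Uᴴ * U = 1)
    {H S K : Matrix (Fin r) (Fin r) ℂ}
    (hX : fromBlocks H S S K =
      U * fromBlocks (diagonal fun i => (x i : ℂ)) 0 0 (-diagonal fun i => (y i : ℂ)) * Uᴴ)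
    (ht : 2 * S.trace.re = ∑ i, x i + ∑ i, y i) :
    ∃ N P : Matrix (Fin r) (Fin r) ℂ, N * Nᴴ = 1 ∧ P * Pᴴ = 1 ∧
      S + S = Nᴴ * (diagonal fun i => (x i : ℂ)) * N + Pᴴ * (diagonal fun i => (y i : ℂ)) * P := by
  set D := diagonal fun i => (x i : ℂ)
  set E := diagonal fun i => (y i : ℂ)
  have hk : (((√2)⁻¹ : ℝ) : ℂ) * (((√2)⁻¹ : ℝ) : ℂ) = 1 / 2 := by
    rw [← Complex.ofReal_mul, ← mul_inv, Real.mul_self_sqrt (by norm_num)]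
    norm_num
  set k : ℂ := (((√2)⁻¹ : ℝ) : ℂ)
  have hks : star k = k := Complex.conj_ofReal _
  let V : Matrix (Fin r ⊕ Fin r) (Fin r ⊕ Fin r) ℂ :=
    fromBlocks (k • 1) (k • 1) (k • 1) (-(k • 1))
  have hV : Vᴴ = V := by
    simp [V, fromBlocks_conjTranspose, conjTranspose_smul, hks]
  have hVV : V * V = 1 := by
    rw [← fromBlocks_one]
    simp only [V, fromBlocks_multiply, smul_mul_smul_comm, hk, Matrix.one_mul, Matrix.mul_neg,
      Matrix.neg_mul, neg_neg, add_neg_cancel, ← add_smul]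
    norm_num
  have hVX : V * fromBlocks H S S K * V = fromBlocks ((1 / 2 : ℂ) • (H + S + (S + K)))
      ((1 / 2 : ℂ) • (H + S - (S + K))) ((1 / 2 : ℂ) • (H - S + (S - K)))
      ((1 / 2 : ℂ) • (H - S - (S - K))) := by
    rw [← hk]
    simp only [V, fromBlocks_multiply, Matrix.smul_mul, Matrix.mul_smul, Matrix.one_mul,
      Matrix.mul_one, Matrix.neg_mul, Matrix.mul_neg, mul_smul]
    rw [fromBlocks_inj]
    refine ⟨?_, ?_, ?_, ?_⟩ <;> module
  obtain ⟨N, P, N', P', hW⟩ : ∃ N P N' P', Uᴴ * V = fromBlocks N P N' P' :=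
    ⟨_, _, _, _, (fromBlocks_toBlocks _).symm⟩
  have hWW : fromBlocks N P N' P' * (fromBlocks N P N' P')ᴴ = 1 := by
    rw [← hW, conjTranspose_mul, conjTranspose_conjTranspose, hV]
    calc _ = Uᴴ * (V * V) * U := by simp only [Matrix.mul_assoc]
      _ = 1 := by rw [hVV, Matrix.mul_one, hU']
  have hB : V * fromBlocks H S S K * V =
      (fromBlocks N P N' P')ᴴ * fromBlocks D 0 0 (-E) * fromBlocks N P N' P' := by
    rw [← hW, conjTranspose_mul, conjTranspose_conjTranspose, hV, hX]
    simp only [Matrix.mul_assoc]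
  rw [← fromBlocks_one] at hWW
  simp only [fromBlocks_conjTranspose, fromBlocks_multiply, fromBlocks_inj] at hWW
  rw [hVX] at hB
  simp only [fromBlocks_conjTranspose, fromBlocks_multiply, fromBlocks_inj, Matrix.mul_zero,
    add_zero, zero_add, Matrix.mul_neg, Matrix.neg_mul] at hB
  have hX' : (fromBlocks H S S K).trace.re = ∑ i, x i - ∑ i, y i := by
    rw [hX, trace_mul_comm, ← Matrix.mul_assoc, hU', Matrix.one_mul, trace_fromBlocks_eq, trace_neg]
    simp [D, E, trace_diagonal, sub_eq_add_neg]
  rw [trace_fromBlocks_eq, Complex.add_re] at hX'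
  have tr (M : Matrix (Fin r) (Fin r) ℂ) (w : Fin r → ℝ) :
      (Mᴴ * (diagonal fun i => (w i : ℂ)) * M).trace.re = ∑ i, w i * ((M * Mᴴ) i i).re := by
    rw [trace_mul_comm, ← Matrix.mul_assoc, trace, Complex.re_sum]
    refine Finset.sum_congr rfl fun i _ => ?_
    rw [diag_apply, mul_diagonal, mul_comm, Complex.re_ofReal_mul]
  have h11 := congrArg (fun M => M.trace.re) hB.1
  simp only [trace_add, trace_smul, trace_neg, Complex.add_re, Complex.neg_re, D, E, tr,
    smul_eq_mul] at h11
  have hN (i : Fin r) : ((N * Nᴴ) i i).re = 1 - ((P * Pᴴ) i i).re := by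
    have := congrArg (fun M => (M i i).re) hWW.1
    simp only [Matrix.add_apply, Complex.add_re, Matrix.one_apply_eq, Complex.one_re] at this
    linarith
  simp only [hN, mul_sub, mul_one, Finset.sum_sub_distrib] at h11
  have hre (z : ℂ) : ((1 / 2 : ℂ) * z).re = z.re / 2 := by
    simp; ring
  simp only [hre, Complex.add_re] at h11
  obtain ⟨rfl, rfl⟩ := eq_zero_of_sum_mul_diag_eq_zero (P := P) (N := N') hx hy (by linarith)
  refine ⟨N, P', by simpa using hWW.1, by simpa using hWW.2.2.2, ?_⟩
  have e1 := hB.1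
  have e2 := hB.2.2.2
  simp only [Matrix.mul_zero, conjTranspose_zero, Matrix.zero_mul, add_zero, zero_add,
    neg_zero] at e1 e2
  rw [← e1, ← neg_eq_iff_eq_neg.2 e2]
  module

theorem mem_horn_of_diagonal_eq {r : ℕ} {a b c : Fin r → ℝ} (ha : Antitone a) (hb : Antitone b)
    (hc : Antitone c) {N P : Matrix (Fin r) (Fin r) ℂ} (hN : N * Nᴴ = 1) (hP : P * Pᴴ = 1)
    (h : (diagonal fun i => (c i : ℂ)) = Nᴴ * (diagonal fun i => (a i : ℂ)) * N +
      Pᴴ * (diagonal fun i => (b i.rev : ℂ)) * P) : (a, b, c) ∈ Horn r := by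
  have hA : HasSpec (Nᴴ * (diagonal fun i => (a i : ℂ)) * N) a :=
    (hasSpec_diagonal a).conj hN (mul_eq_one_comm.1 hN)
  have hB : HasSpec (Pᴴ * (diagonal fun i => (b i.rev : ℂ)) * P) b := by
    have := ((hasSpec_diagonal fun i : Fin r => b i.rev).conj hP
      (mul_eq_one_comm.1 hP)).comp_equiv Fin.revPerm
    have e : (fun i => b i.rev) ∘ Fin.revPerm = b := by
      funext i
      simp
    rwa [e] at this
  have hAh : (Nᴴ * (diagonal fun i => (a i : ℂ)) * N).IsHermitian :=
    isHermitian_of_spectral (T := Nᴴ) (by rw [conjTranspose_conjTranspose])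
  have hBh : (Pᴴ * (diagonal fun i : Fin r => (b i.rev : ℂ)) * P).IsHermitian :=
    isHermitian_of_spectral (T := Pᴴ) (α := fun i : Fin r => b i.rev)
      (by rw [conjTranspose_conjTranspose])
  have hC := hasSpec_diagonal c
  rw [h] at hC
  generalize Nᴴ * (diagonal fun i => (a i : ℂ)) * N = A at *
  generalize Pᴴ * (diagonal fun i => (b i.rev : ℂ)) * P = B at *
  exact ⟨A, B, hAh, hBh, (eigVec_eq hAh ha hA).symm, (eigVec_eq hBh hb hB).symm,
    (eigVec_eq (hAh.add hBh) hc hC).symm⟩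

theorem hornSufficient_of_lt (r : ℕ) (h : ∀ r' < r, HornSufficient r') : HornSufficient r := by
  intro a b c ha hb hc hsum hin
  set t : ℝ := ∑ i, |a i| + ∑ i, |b i| + ∑ i, |c i| + 1 with ht
  have bd (w : Fin r → ℝ) (i : Fin r) : -w i ≤ ∑ j, |w j| :=
    (neg_le_abs _).trans (Finset.single_le_sum (f := fun j => |w j|)
      (fun _ _ => abs_nonneg _) (Finset.mem_univ i))
  have nn (w : Fin r → ℝ) : 0 ≤ ∑ j, |w j| := Finset.sum_nonneg fun _ _ => abs_nonneg _
  have hx (i : Fin r) : 0 < a i + t := by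
    linarith [bd a i, nn b, nn c]
  have hy (i : Fin r) : 0 < b i + t := by
    linarith [bd b i, nn a, nn c]
  have hz (i : Fin r) : 0 ≤ (c i + 2 * t) / 2 := by
    linarith [bd c i, nn a, nn b, nn c]
  have hlam : Antitone (Fin.append (fun i => a i + t) fun i => -(b i.rev + t)) := by
    intro i j hij
    induction i using Fin.addCases with
    | left i =>
      induction j using Fin.addCases with
      | left j => simpa using ha hij
      | right j =>
        simp only [Fin.append_left, Fin.append_right]
        linarith [hx i, hy j.rev]
    | right i =>
      induction j using Fin.addCases with
      | left j =>
        exfalso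
        have := Fin.le_def.1 hij
        simp only [Fin.val_natAdd, Fin.val_castAdd] at this
        omega
      | right j =>
        have hij' : i ≤ j := by
          have := Fin.le_def.1 hij
          simp only [Fin.val_natAdd] at this
          exact Fin.le_def.2 (by omega)
        have := hb (Fin.rev_le_rev.2 hij')
        simp only [Fin.append_right]
        linarith
  obtain ⟨X, hXh, hXs, hX12⟩ := exists_fromBlocks_of_lr (le_refl r) h hlam
    (s := fun i => (c i + 2 * t) / 2)
    (fun i j hij => by have := hc hij; dsimp only; linarith) hz (by
      intro d hd1 hd2 I J K hI hJ hK hm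
      have := hin d hd1 hd2 I J K hI hJ hK hm
      have e1 (i : Fin r) : Fin.castLE (Nat.le_add_left r r) i = Fin.castAdd r i := rfl
      have e2 (i : Fin r) : (Fin.castLE (Nat.le_add_left r r) i).rev = Fin.natAdd r i.rev := by
        ext; simp; omega
      simp only [e1]
      simp only [← e1, e2]
      simp only [e1, Fin.append_left, Fin.append_right, Fin.rev_rev, Finset.sum_neg_distrib,
        ← Finset.sum_div, Finset.sum_add_distrib, Finset.sum_const, hI, hJ, hK, nsmul_eq_mul]
      linarith)
  obtain ⟨U, -, u2, hU⟩ := exists_diag_append_of_hasSpec hXh hlam hXs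
  rw [diagonal_ofReal_neg] at hU
  set S : Matrix (Fin r) (Fin r) ℂ := diagonal fun i => (((c i + 2 * t) / 2 : ℝ) : ℂ) with hSdef
  have hS12 : X.toBlocks₁₂ = S := by
    rw [hX12]
    ext i j
    by_cases hij : i = j
    · subst hij
      simp [rectDiag, S]
    · have : (i : ℕ) ≠ j := fun h => hij (Fin.ext h)
      simp [rectDiag, S, hij, this]
  have hS21 : X.toBlocks₂₁ = S := by
    have h1 : X.toBlocks₂₁ = X.toBlocks₁₂ᴴ := by
      ext i j
      exact (hXh.apply (Sum.inr i) (Sum.inl j)).symm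
    rw [h1, hS12, hSdef, diagonal_conjTranspose]
    congr 1
    funext i
    exact Complex.conj_ofReal _
  rw [← fromBlocks_toBlocks X, hS12, hS21] at hU
  obtain ⟨N, P, hN, hP, hNP⟩ := exists_unitary_of_two_mul_trace_eq hx (fun i => hy i.rev) u2 hU
    (by
      rw [hSdef, trace_diagonal, ← Complex.ofReal_sum, Complex.ofReal_re, ← Finset.sum_div,
        show ∑ i : Fin r, (b i.rev + t) = ∑ i, (b i + t) from
          Equiv.sum_comp Fin.revPerm (fun i => b i + t)]
      simp only [Finset.sum_add_distrib, ← hsum, ← Finset.mul_sum]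
      ring)
  have hd (w : Fin r → ℝ) (u : ℝ) : (diagonal fun i => ((w i + u : ℝ) : ℂ)) =
      (diagonal fun i => (w i : ℂ)) + (u : ℂ) • 1 := by
    ext i j
    by_cases hij : i = j <;> simp [hij]
  have hSS : S + S = (diagonal fun i => ((c i + 2 * t : ℝ) : ℂ)) := by
    rw [hSdef, diagonal_add]
    congr 1
    funext i
    push_cast
    ring
  refine mem_horn_of_diagonal_eq ha hb hc hN hP ?_
  rw [hSS, hd, hd, hd (fun i => b i.rev)] at hNP
  simp only [Matrix.mul_add, Matrix.add_mul, Matrix.mul_smul, Matrix.smul_mul, Matrix.mul_one,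
    mul_eq_one_comm.1 hN, mul_eq_one_comm.1 hP] at hNP
  rw [← sub_eq_zero] at hNP ⊢
  rw [← hNP]
  push_cast
  module

theorem hornSufficient (r : ℕ) : HornSufficient r :=
  r.strong_induction_on hornSufficient_of_lt

theorem stmt_3 (p q : ℕ) (hq : 1 ≤ q) (hpq : q ≤ p)
    (lam : Fin (p + q) → ℝ) (hlam : Antitone lam)
    (s : Fin q → ℝ) (hs : Antitone s) (hs0 : ∀ i, 0 ≤ s i) :
    (lam, s) ∈ coneA p q ↔
      ∀ (r : ℕ), 1 ≤ r → r ≤ q →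
        ∀ (I J K : Finset (Fin q)) (hI : I.card = r) (hJ : J.card = r) (hK : K.card = r),
          (muVec I hI, muVec J hJ, muVec K hK) ∈ Horn r →
          (∑ i ∈ I, lam (Fin.castLE (Nat.le_add_left q p) i)) -
            (∑ j ∈ J, lam (Fin.rev (Fin.castLE (Nat.le_add_left q p) j))) ≥
            2 * ∑ k ∈ K, s k := by
  constructor
  · intro h r hr hrq I J K hI hJ hK hLR
    exact lr_inequality_of_mem_coneA hpq hs hs0 h hI hJ hK hLR
  · intro h
    obtain ⟨X, hX, hXs, hX12⟩ := exists_fromBlocks_of_lr hpq (fun r _ => hornSufficient r) hlam hs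
      hs0 h
    have hX' := hX.submatrix (finSumFinEquiv (m := p) (n := q)).symm
    refine ⟨_, hX', (eigVec_eq hX' hlam (hXs.reindex finSumFinEquiv.symm)).symm, fun i => ?_⟩
    refine (sval_eq hpq hs hs0 (W₁ := 1) (W₂ := 1) (by simp) (by simp) (by simp) ?_ i).symm
    rw [Matrix.one_mul, conjTranspose_one, Matrix.mul_one, ← hX12]
    ext j k
    simp [blockTR, toBlocks₁₂]
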